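/- Let S ⊂ ℙ(V) be a reduced irreducible ruled surface of degree d ≥ 3 which is not a cone. Then the singular locus of S is either empty or purely 1-dimensional; in particular S has no isolated singular points. -/

import Mathlib

namespace RQS

open MvPolynomial


open MvPolynomial

variable (K : Type) [Field K]

/-- Projective n-space modelled as the projectivization of `Fin n → K`
(so `PP K (n+1)` is ℙⁿ). -/
abbrev PP (n : ℕ) : Type := Projectivization K (Fin n → K)

variable {K}

/-- Vanishing of a (homogeneous) polynomial at a projective point. -/
def vanishes {n : ℕ} (p : MvPolynomial (Fin n) K) (x : PP K n) : Prop :=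
  ∀ (v : Fin n → K) (h : v ≠ 0), Projectivization.mk K v h = x → eval v p = 0

/-- Projective zero locus of a set of polynomials. -/
def zeroLocus {n : ℕ} (S : Set (MvPolynomial (Fin n) K)) : Set (PP K n) :=
  {x | ∀ p ∈ S, vanishes p x}

/-- Zariski closed subsets of projective space. -/
def ZClosed {n : ℕ} (X : Set (PP K n)) : Prop :=
  ∃ S : Set (MvPolynomial (Fin n) K), (∀ p ∈ S, ∃ d, p.IsHomogeneous d) ∧ X = zeroLocus S

/-- Irreducibility with respect to the Zariski topology. -/
def ZIrred {n : ℕ} (X : Set (PP K n)) : Prop :=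
  X.Nonempty ∧ ∀ A B : Set (PP K n), ZClosed A → ZClosed B → X ⊆ A ∪ B → X ⊆ A ∨ X ⊆ B

/-- `X` contains a chain of closed irreducible subsets of length `d+1`. -/
def dimGE {n : ℕ} (X : Set (PP K n)) (d : ℕ) : Prop :=
  ∃ f : Fin (d + 1) → Set (PP K n),
    (∀ i, ZClosed (f i) ∧ ZIrred (f i) ∧ f i ⊆ X) ∧ StrictMono f

/-- `X` has (Krull) dimension exactly `d`. -/
def HasDim {n : ℕ} (X : Set (PP K n)) (d : ℕ) : Prop := dimGE X d ∧ ¬ dimGE X (d + 1)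

/-- The hyperplane with coefficient vector `φ`. -/
def hyp {n : ℕ} (φ : Fin n → K) : Set (PP K n) :=
  {x | ∀ (v : Fin n → K) (h : v ≠ 0), Projectivization.mk K v h = x → ∑ i, φ i * v i = 0}

/-- Degree of a (reduced) curve: every hyperplane not containing it meets it in at most `d`
points, and some hyperplane meets it in exactly `d` points. -/
def HasCurveDeg {n : ℕ} (X : Set (PP K n)) (d : ℕ) : Prop :=
  (∀ φ : Fin n → K, φ ≠ 0 → ¬ X ⊆ hyp φ →
    (X ∩ hyp φ).Finite ∧ (X ∩ hyp φ).ncard ≤ d) ∧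
  (∃ φ : Fin n → K, φ ≠ 0 ∧ ¬ X ⊆ hyp φ ∧ (X ∩ hyp φ).ncard = d)

/-- An irreducible projective curve of degree `d`. -/
def IsCurveOfDeg {n : ℕ} (X : Set (PP K n)) (d : ℕ) : Prop :=
  ZClosed X ∧ ZIrred X ∧ HasDim X 1 ∧ HasCurveDeg X d

/-- A property holds at a general point of `S`. -/
def GenericPts {n : ℕ} (S : Set (PP K n)) (Q : PP K n → Prop) : Prop :=
  ∃ T : Set (PP K n), ZClosed T ∧ ¬ S ⊆ T ∧ ∀ p ∈ S, p ∉ T → Q p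

/-! ### Plücker coordinates: `p₁₂,p₁₃,p₁₄,p₂₃,p₂₄,p₃₄` indexed by `0,…,5` -/

/-- Plücker coordinates of the line through `u` and `v`, i.e. the bivector `u ∧ v`. -/
def plucker (u v : Fin 4 → K) : Fin 6 → K :=
  ![u 0 * v 1 - u 1 * v 0, u 0 * v 2 - u 2 * v 0, u 0 * v 3 - u 3 * v 0,
    u 1 * v 2 - u 2 * v 1, u 1 * v 3 - u 3 * v 1, u 2 * v 3 - u 3 * v 2]

/-- The Plücker quadric `p₁₂p₃₄ - p₁₃p₂₄ + p₁₄p₂₃`, i.e. `½ w ∧ w`. -/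
def plQuad (w : Fin 6 → K) : K := w 0 * w 5 - w 1 * w 4 + w 2 * w 3

/-- The wedge pairing `w ∧ z ∈ Λ⁴V ≅ K` of two bivectors. -/
def plPair (w z : Fin 6 → K) : K :=
  w 0 * z 5 + w 5 * z 0 - w 1 * z 4 - w 4 * z 1 + w 2 * z 3 + w 3 * z 2

/-- The wedge `w ∧ v ∈ Λ³V ≅ V*` of a bivector `w` with a vector `v`;
`w ∧ v = 0` expresses that the point `v̄` lies on the line `w̄`. -/
def wedgePt (w : Fin 6 → K) (v : Fin 4 → K) : Fin 4 → K :=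
  ![w 0 * v 2 - w 1 * v 1 + w 3 * v 0,
    w 0 * v 3 - w 2 * v 1 + w 4 * v 0,
    w 1 * v 3 - w 2 * v 2 + w 5 * v 0,
    w 3 * v 3 - w 4 * v 2 + w 5 * v 1]

/-- The set of points of ℙ³ on the line with Plücker vector `w`. -/
def lineOfRep (w : Fin 6 → K) : Set (PP K 4) :=
  {p | ∀ (v : Fin 4 → K) (h : v ≠ 0), Projectivization.mk K v h = p → wedgePt w v = 0}

/-- `w` represents a line of ℙ³: it is nonzero and decomposable. -/
def IsLineRep (w : Fin 6 → K) : Prop := w ≠ 0 ∧ plQuad w = 0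

variable (K) in
/-- The Grassmannian `Gr(2,4) ⊂ ℙ⁵` of lines in ℙ³. -/
def grass : Set (PP K 6) :=
  {x | ∃ (w : Fin 6 → K) (h : w ≠ 0), Projectivization.mk K w h = x ∧ plQuad w = 0}

/-- The line in ℙ³ corresponding to a point `x` of the Grassmannian. -/
def lineOf (x : PP K 6) : Set (PP K 4) :=
  {p | ∀ (w : Fin 6 → K) (h : w ≠ 0), Projectivization.mk K w h = x → p ∈ lineOfRep w}

/-- The set of (Grassmann points of) lines contained in a surface `S ⊂ ℙ³`. -/
def linesOf (S : Set (PP K 4)) : Set (PP K 6) :=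
  {x | x ∈ grass K ∧ lineOf x ⊆ S}

/-- A ruled surface: an irreducible closed surface which is a union of lines. -/
def IsRuled (S : Set (PP K 4)) : Prop :=
  ZClosed S ∧ ZIrred S ∧ HasDim S 2 ∧ ∀ p ∈ S, ∃ x ∈ linesOf S, p ∈ lineOf x

/-- Degree of a surface in ℙ³ via intersections with lines. -/
def HasSurfDeg (S : Set (PP K 4)) (d : ℕ) : Prop :=
  (∀ w : Fin 6 → K, IsLineRep w → ¬ lineOfRep w ⊆ S →
    (S ∩ lineOfRep w).Finite ∧ (S ∩ lineOfRep w).ncard ≤ d) ∧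
  (∃ w : Fin 6 → K, IsLineRep w ∧ ¬ lineOfRep w ⊆ S ∧ (S ∩ lineOfRep w).ncard = d)

/-- A cone: all lines of `S` pass through a common point. -/
def IsCone (S : Set (PP K 4)) : Prop :=
  ∃ p : PP K 4, ∀ x ∈ linesOf S, p ∈ lineOf x

/-- `σ₂(p₀)`: the 2-plane in the Grassmannian of all lines through `p₀`. -/
def sigma2 (p₀ : PP K 4) : Set (PP K 6) := {x | x ∈ grass K ∧ p₀ ∈ lineOf x}

/-- The projective tangent space `T_{Gr,x₀}` of the Plücker quadric at `x₀`,
namely the hyperplane `{z̄ : w₀ ∧ z = 0}`. -/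
def tangentGr (x₀ : PP K 6) : Set (PP K 6) :=
  {x | ∀ (w : Fin 6 → K) (h : w ≠ 0), Projectivization.mk K w h = x →
    ∀ (w₀ : Fin 6 → K) (h₀ : w₀ ≠ 0), Projectivization.mk K w₀ h₀ = x₀ → plPair w₀ w = 0}

/-- The linear span of (the representatives of) a subset of projective space. -/
def spanOfSet {n : ℕ} (X : Set (PP K n)) : Submodule K (Fin n → K) :=
  Submodule.span K {v | ∃ h : v ≠ 0, Projectivization.mk K v h ∈ X}

/-- The projective subspace associated to a linear subspace. -/
def projSub {n : ℕ} (U : Submodule K (Fin n → K)) : Set (PP K n) :=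
  {x | ∀ (v : Fin n → K) (h : v ≠ 0), Projectivization.mk K v h = x → v ∈ U}

/-- `P(C)`: the smallest projective subspace containing `C`. -/
def projSpanOf {n : ℕ} (X : Set (PP K n)) : Set (PP K n) := projSub (spanOfSet X)

/-! ### Smoothness via Jacobian criteria -/

/-- The homogeneous polynomials vanishing on `X`. -/
def homIdeal {n : ℕ} (X : Set (PP K n)) : Set (MvPolynomial (Fin n) K) :=
  {p | (∃ d, p.IsHomogeneous d) ∧ ∀ x ∈ X, vanishes p x}

/-- The span of the gradients at `v` of all homogeneous polynomials vanishing on `X`. -/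
def gradSpan {n : ℕ} (X : Set (PP K n)) (v : Fin n → K) : Submodule K (Fin n → K) :=
  Submodule.span K
    {g | ∃ p ∈ homIdeal X, g = fun i => eval v (pderiv i p)}

/-- Smooth point of a projective *curve* `X ⊂ ℙ(Kⁿ)` (Jacobian criterion:
the affine cone over `X` has a 2-dimensional tangent space there). -/
def CurveSmoothPt {n : ℕ} (X : Set (PP K n)) (x : PP K n) : Prop :=
  ∀ (v : Fin n → K) (h : v ≠ 0), Projectivization.mk K v h = x →
    Module.finrank K (gradSpan X v) = n - 2

/-- Smooth point of a *surface* `S ⊂ ℙ³` (Jacobian criterion). -/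
def SurfSmoothPt (S : Set (PP K 4)) (x : PP K 4) : Prop :=
  ∀ (v : Fin 4 → K) (h : v ≠ 0), Projectivization.mk K v h = x →
    Module.finrank K (gradSpan S v) = 1

/-- The singular locus of a surface `S ⊂ ℙ³`. -/
def singLocus (S : Set (PP K 4)) : Set (PP K 4) := {x ∈ S | ¬ SurfSmoothPt S x}


theorem eval_bind₁_eq {R σ τ : Type*} [CommSemiring R] (p : τ → R) (g : σ → MvPolynomial τ R)
    (f : MvPolynomial σ R) : eval p (bind₁ g f) = eval (fun i => eval p (g i)) f :=
  eval₂Hom_bind₁ (RingHom.id R) p g f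

/-! ### Consequences of the Nullstellensatz -/

/-- A polynomial vanishing on the zero set of a prime polynomial is divisible by it. -/
theorem dvd_of_forall_eval_eq_zero [IsAlgClosed K] {σ : Type} [Finite σ]
    {f g : MvPolynomial σ K} (hf : Prime f)
    (h : ∀ p, eval p f = 0 → eval p g = 0) : f ∣ g := by
  have : (Ideal.span {f}).IsPrime := (Ideal.span_singleton_prime hf.ne_zero).2 hf
  rw [← Ideal.mem_span_singleton,
    ← MvPolynomial.IsPrime.vanishingIdeal_zeroLocus (K := K) (Ideal.span {f}),
    mem_vanishingIdeal_iff]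
  intro x hx
  rw [mem_zeroLocus_iff] at hx
  simpa [aeval_eq_eval] using h x
    (by simpa [aeval_eq_eval] using hx f (Ideal.mem_span_singleton_self f))

/-- A point of affine space over an extension field specialises to a rational point. -/
theorem exists_eval_eq_zero_of_aeval_eq_zero [IsAlgClosed K] {σ : Type} [Finite σ]
    {E : Type*} [CommRing E] [Nontrivial E] [Algebra K E] (e : σ → E) :
    ∃ p : σ → K, ∀ g : MvPolynomial σ K, aeval e g = 0 → eval p g = 0 := by
  obtain ⟨m, hm, hle⟩ := Ideal.exists_le_maximal (RingHom.ker (aeval (R := K) e))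
    (RingHom.ker_ne_top _)
  obtain ⟨p, rfl⟩ := eq_vanishingIdeal_singleton_of_isMaximal K hm
  refine ⟨p, fun g hg => ?_⟩
  have := hle (show g ∈ RingHom.ker (aeval (R := K) e) from hg)
  rw [mem_vanishingIdeal_singleton_iff] at this
  simpa [aeval_eq_eval] using this

/-! ### A line through the generic point -/

/-- If every rational point of the surface `f = 0` lies on a line of the surface, then so does
the generic point. -/
theorem exists_generic_line [IsAlgClosed K] {σ : Type} [Finite σ] {f : MvPolynomial σ K}
    (hf : Prime f)
    (hline : ∀ p, eval p f = 0 → ∃ w : σ → K, w ≠ 0 ∧ ∀ s : K, eval (p + s • w) f = 0) :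
    ∃ (E : Type) (_ : Field E) (_ : Algebra K E) (η w : σ → E),
      (∀ g : MvPolynomial σ K, aeval η g = 0 ↔ f ∣ g) ∧ w ≠ 0 ∧
      ∀ s : E, aeval (η + s • w) f = 0 := by
  classical
  let V := {p : σ → K // eval p f = 0}
  choose w hw0 hw using fun p : V => hline p.1 p.2
  let D : MvPolynomial σ K → Set V := fun g => {p | eval p.1 g ≠ 0}
  let F : Filter V :=
    { sets := {T | ∃ g, ¬ f ∣ g ∧ D g ⊆ T}
      univ_sets := ⟨1, fun h => hf.not_isUnit (isUnit_of_dvd_one h), Set.subset_univ _⟩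
      sets_of_superset := fun ⟨g, hg, h⟩ h' => ⟨g, hg, h.trans h'⟩
      inter_sets := fun ⟨g, hg, h⟩ ⟨g', hg', h'⟩ => ⟨g * g',
        fun H => (hf.dvd_or_dvd H).elim hg hg', fun p hp => by
          simp only [D, map_mul, Set.mem_ofPred_eq, ne_eq, mul_eq_zero, not_or] at hp
          exact ⟨h hp.1, h' hp.2⟩⟩ }
  have hF : F.NeBot := by
    refine ⟨fun hbot => ?_⟩
    have : (∅ : Set V) ∈ F := by rw [hbot]; trivial
    obtain ⟨g, hg, h⟩ := this
    refine hg (dvd_of_forall_eval_eq_zero hf fun p hp => ?_)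
    by_contra hne
    exact h (show (⟨p, hp⟩ : V) ∈ D g from hne)
  let U : Ultrafilter V := Ultrafilter.of F
  have hUF : (U : Filter V) ≤ F := Ultrafilter.of_le F
  let q : (V → K) →+* Filter.Germ (U : Filter V) K := Filter.Germ.coeRingHom (U : Filter V)
  let alg : Algebra K (Filter.Germ (U : Filter V) K) := (q.comp (algebraMap K (V → K))).toAlgebra
  let Q : (V → K) →ₐ[K] Filter.Germ (U : Filter V) K := { q with commutes' := fun _ => rfl }
  have hQ : ∀ (e : σ → V → K) (g : MvPolynomial σ K),
      aeval (fun i => Q (e i)) g = Q (fun p => eval (fun i => e i p) g) := by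
    intro e g
    have h1 : aeval (fun i => Q (e i)) g = Q (aeval e g) := by
      rw [← AlgHom.comp_apply, comp_aeval]
    rw [h1]; congr 1; funext p
    have h2 : (Pi.evalAlgHom K (fun _ : V => K) p) (aeval e g) = eval (fun i => e i p) g := by
      rw [← AlgHom.comp_apply, comp_aeval, aeval_eq_eval]; rfl
    exact h2
  have hQ0 : ∀ u : V → K, Q u = 0 ↔ ∀ᶠ p in (U : Filter V), u p = 0 := fun u =>
    Filter.Germ.coe_eq (f := u) (g := fun _ => 0)
  refine ⟨Filter.Germ (U : Filter V) K, inferInstance, alg, fun i => Q (fun p => p.1 i),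
    fun i => Q (fun p => w p i), fun g => ?_, fun h => ?_, fun s => ?_⟩
  · rw [hQ (fun i p => p.1 i) g, hQ0]
    refine ⟨fun h => ?_, fun ⟨c, hc⟩ => Filter.Eventually.of_forall fun p => ?_⟩
    · by_contra hg
      have h1 : ∀ᶠ p in (U : Filter V), p ∈ D g := hUF ⟨g, hg, subset_rfl⟩
      obtain ⟨p, hp, hp'⟩ := (h.and h1).exists
      exact hp' hp
    · have := p.2
      simp only [hc, map_mul]
      erw [this, zero_mul]
  · have h1 : ∀ i, ∀ᶠ p in (U : Filter V), w p i = 0 := fun i => (hQ0 _).1 (congrFun h i)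
    obtain ⟨p, hp⟩ := (Filter.eventually_all.2 h1).exists
    exact hw0 p (funext hp)
  · induction s using Filter.Germ.inductionOn with
    | _ s =>
    have h1 : ((fun i => Q (fun p => p.1 i)) + (↑s : Filter.Germ (U : Filter V) K) •
        fun i => Q (fun p => w p i)) = fun i => Q (fun p => p.1 i + s p * w p i) := by
      funext i; rfl
    rw [h1, hQ, hQ0]
    exact Filter.Eventually.of_forall fun p => hw p (s p)

/-! ### Directions of lines at a dominating valuation -/

/-- If no line of `f = 0` through the origin has vanishing initial coordinate, then, at a valuation
centred at the origin, the direction of a line of `f = 0` through the centre is dominated by its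
initial coordinate. -/
theorem direction_mem_valuationSubring [IsAlgClosed K] {f : MvPolynomial (Fin 3) K}
    (hdir : ¬ ∃ w : Fin 3 → K, w ≠ 0 ∧ w 0 = 0 ∧ ∀ s : K, eval (s • w) f = 0)
    {E : Type} [Field E] [Algebra K E] {η w : Fin 3 → E} (hw : w ≠ 0)
    (hf : ∀ s : E, aeval (η + s • w) f = 0) (B : ValuationSubring E)
    (hK : ∀ c : K, algebraMap K E c ∈ B) (hη : ∀ i, η i ∈ B.nonunits) :
    w 0 ≠ 0 ∧ ∀ i, w i / w 0 ∈ B := by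
  classical
  obtain ⟨j, -, hj⟩ := Finset.exists_max_image Finset.univ (fun i => B.valuation (w i))
    Finset.univ_nonempty
  have hwj : w j ≠ 0 := fun h => hw <| funext fun i => by
    have := hj i (Finset.mem_univ i)
    rw [h, map_zero] at this
    exact (Valuation.zero_iff _).1 (le_antisymm this zero_le)
  have hmem : ∀ i, w i / w j ∈ B := fun i => by
    rw [← B.valuation_le_one_iff, map_div₀]
    exact div_le_one_of_le₀ (hj i (Finset.mem_univ i)) zero_le
  let φ : K →+* B := (algebraMap K E).codRestrict B hK
  let : Algebra K B := φ.toAlgebra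
  let : Algebra K (IsLocalRing.ResidueField B) := ((IsLocalRing.residue B).comp φ).toAlgebra
  let ι : B →ₐ[K] E := { B.subtype with commutes' := fun _ => rfl }
  let ρ : B →ₐ[K] IsLocalRing.ResidueField B :=
    { IsLocalRing.residue B with commutes' := fun _ => rfl }
  let ηB : Fin 3 → B := fun i => ⟨η i, B.nonunits_subset (hη i)⟩
  let wB : Fin 3 → B := fun i => ⟨w i / w j, hmem i⟩
  have hηB : ∀ i, ρ (ηB i) = 0 := fun i => by
    change IsLocalRing.residue B (ηB i) = 0
    rw [IsLocalRing.residue_eq_zero_iff]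
    exact ValuationSubring.coe_mem_nonunits_iff.1 (hη i)
  have hfB : ∀ s : K, aeval (fun i => ηB i + algebraMap K B s * wB i) f = 0 := fun s => by
    have hinj : Function.Injective ι := Subtype.val_injective
    apply hinj
    rw [map_zero, ← AlgHom.comp_apply, comp_aeval]
    convert hf (algebraMap K E s / w j) using 2
    refine congrArg _ (funext fun i => ?_)
    change η i + algebraMap K E s * (w i / w j) = η i + algebraMap K E s / w j * w i
    field_simp
  have hfρ : ∀ s : K, aeval (fun i => algebraMap K _ s * ρ (wB i)) f = 0 := fun s => by
    have := congrArg ρ (hfB s)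
    rw [map_zero, ← AlgHom.comp_apply, comp_aeval] at this
    simpa only [map_add, hηB, zero_add, map_mul, AlgHom.commutes] using this
  have hw0 : ρ (wB 0) ≠ 0 := fun h0 => by
    obtain ⟨p, hp⟩ := exists_eval_eq_zero_of_aeval_eq_zero (K := K) (fun i => ρ (wB i))
    have hpj : p j = 1 := by
      have h1 : wB j = 1 := Subtype.ext (div_self hwj)
      have := hp (X j - 1) (by simp [h1])
      simpa [sub_eq_zero] using this
    refine hdir ⟨p, fun h => by simp [h] at hpj, by simpa using hp (X 0) (by simpa using h0),
      fun s => ?_⟩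
    have := hp (bind₁ (fun i => C s * X i) f) (by
      rw [aeval_bind₁]; simpa using hfρ s)
    rw [eval_bind₁_eq] at this
    simpa [Pi.smul_def, smul_eq_mul] using this
  have hunit : IsUnit (wB 0) := by
    by_contra h
    exact hw0 ((IsLocalRing.residue_eq_zero_iff _).2 h)
  have hw0' : w 0 / w j ≠ 0 := fun h => hunit.ne_zero (Subtype.ext h)
  refine ⟨fun h => hw0' (by simp [h]), fun i => ?_⟩
  obtain ⟨u, hu⟩ := hunit
  have h2 : (w 0 / w j) * ((↑u⁻¹ : B) : E) = 1 := by
    have : wB 0 * (↑u⁻¹ : B) = 1 := by rw [← hu]; simp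
    exact congrArg Subtype.val this
  have : w i / w 0 = (w i / w j) * ((↑u⁻¹ : B) : E) := by
    rw [eq_div_of_mul_eq hw0' ((mul_comm _ _).trans h2)]
    field_simp
  rw [this]
  exact B.mul_mem _ _ (hmem i) (↑u⁻¹ : B).2

/-- A ring homomorphism to a field is dominated by a valuation subring centred on a given ideal. -/
theorem exists_valuationSubring_of_forall_ne_one {R E : Type*} [CommRing R] [Field E]
    (φ : R →+* E) (J : Ideal R) (hJ : ∀ j ∈ J, φ j ≠ 1) :
    ∃ B : ValuationSubring E, (∀ r, φ r ∈ B) ∧ ∀ j ∈ J, φ j ∈ B.nonunits := by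
  obtain ⟨B, h1, h2⟩ := Ideal.image_subset_nonunits_valuationSubring (A := φ.range)
    (J.map φ.rangeRestrict) (fun h => by
      have h1 : (1 : φ.range) ∈ J.map φ.rangeRestrict := h ▸ Submodule.mem_top
      obtain ⟨j, hj, hj1⟩ :=
        (Ideal.mem_map_iff_of_surjective _ φ.rangeRestrict_surjective).1 h1
      exact hJ j hj (congrArg Subtype.val hj1))
  exact ⟨B, fun r => h1 ⟨r, rfl⟩, fun j hj =>
    h2 ⟨φ.rangeRestrict j, Ideal.mem_map_of_mem _ hj, rfl⟩⟩

/-- An element lying in all valuation subrings centred at the origin becomes integral after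
multiplication by a function which does not vanish at the origin. -/
theorem exists_isIntegralElem_of_forall_mem_valuationSubring {σ : Type} {E : Type*} [Field E]
    [Algebra K E] {η : σ → E} (y : E)
    (hy : ∀ B : ValuationSubring E, (∀ c : K, algebraMap K E c ∈ B) →
      (∀ i, η i ∈ B.nonunits) → y ∈ B) :
    ∃ c : MvPolynomial σ K, eval 0 c ≠ 0 ∧
      (aeval (R := K) η).toRingHom.IsIntegralElem (aeval η c * y) := by
  classical
  rcases eq_or_ne y 0 with rfl | hy0
  · exact ⟨1, by simp, by simpa using RingHom.isIntegralElem_zero _⟩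
  let φ : Polynomial (MvPolynomial σ K) →+* E :=
    Polynomial.eval₂RingHom (aeval (R := K) η).toRingHom y⁻¹
  let J : Ideal (Polynomial (MvPolynomial σ K)) :=
    RingHom.ker ((eval (0 : σ → K)).comp Polynomial.constantCoeff)
  have hex : ∃ j ∈ J, φ j = 1 := by
    by_contra! hJ
    obtain ⟨B, h1, h2⟩ := exists_valuationSubring_of_forall_ne_one φ J hJ
    have hyB := hy B (fun c => by simpa [φ] using h1 (Polynomial.C (C c)))
      (fun i => by simpa [φ] using h2 (Polynomial.C (X i)) (by simp [J, RingHom.mem_ker]))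
    have hyi : y⁻¹ ∈ B.nonunits := by
      simpa [φ] using h2 Polynomial.X (by simp [J, RingHom.mem_ker])
    rcases B.inv_mem_nonunits_iff.1 hyi with h | h
    · exact hy0 h
    · exact h hyB
  obtain ⟨j, hj, hj1⟩ := hex
  let q := 1 - j
  have hq0 : eval 0 (q.coeff 0) = 1 := by
    have : eval 0 (j.coeff 0) = 0 := by simpa [J, RingHom.mem_ker] using hj
    rw [Polynomial.coeff_sub, map_sub, this, Polynomial.coeff_one_zero, map_one, sub_zero]
  have hq : q.coeff 0 ≠ 0 := fun h => by simp [h] at hq0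
  have hroot : Polynomial.eval₂ (aeval (R := K) η).toRingHom y⁻¹ q = 0 := by
    change φ q = 0
    simp [q, hj1]
  refine ⟨q.coeff 0, hq0 ▸ one_ne_zero, ?_⟩
  have h1 : Polynomial.eval₂ (aeval (R := K) η).toRingHom y q.reverse = 0 := by
    let := invertibleOfNonzero (inv_ne_zero hy0)
    have h := (Polynomial.eval₂_reverse_eq_zero_iff (aeval (R := K) η).toRingHom y⁻¹ q).2 hroot
    rwa [invOf_eq_inv, inv_inv] at h
  have h2 := RingHom.isIntegralElem_leadingCoeff_mul (aeval (R := K) η).toRingHom q.reverse y h1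
  rwa [Polynomial.reverse_leadingCoeff, Polynomial.trailingCoeff,
    Polynomial.natTrailingDegree_eq_zero.2 (Or.inr hq)] at h2

/-- The point with parameter `x` on the line `z₁ = α + z₀ γ`, `z₂ = β + z₀ δ`. -/
def linePt {R : Type*} [CommRing R] (x α β γ δ : R) : Fin 3 → R := ![x, α + x * γ, β + x * δ]

theorem map_linePt {R S F : Type*} [CommRing R] [CommRing S] [FunLike F R S] [RingHomClass F R S]
    (φ : F) (x α β γ δ : R) :
    (fun i => φ (linePt x α β γ δ i)) = linePt (φ x) (φ α) (φ β) (φ γ) (φ δ) := by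
  funext i; fin_cases i <;> simp [linePt]

/-- The function field of the surface is generated by the coordinates of a generic line together
with a free parameter on it. -/
theorem exists_ruled_parametrization [IsAlgClosed K] {f : MvPolynomial (Fin 3) K} (hf : Prime f)
    (hf0 : eval 0 f = 0)
    (hline : ∀ p, eval p f = 0 → ∃ w : Fin 3 → K, w ≠ 0 ∧ ∀ s : K, eval (p + s • w) f = 0)
    (hdir : ¬ ∃ w : Fin 3 → K, w ≠ 0 ∧ w 0 = 0 ∧ ∀ s : K, eval (s • w) f = 0) :
    ∃ (k : Type) (_ : Field k) (_ : Algebra K k) (α β γ δ : k),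
      IntermediateField.adjoin K {α, β, γ, δ} = ⊤ ∧
      ∀ g : MvPolynomial (Fin 3) K,
        aeval (linePt (Polynomial.X : Polynomial k) (Polynomial.C α) (Polynomial.C β)
          (Polynomial.C γ) (Polynomial.C δ)) g = 0 ↔ f ∣ g := by
  obtain ⟨E, _, _, η, w, hker, hw, hfw⟩ := exists_generic_line hf hline
  obtain ⟨B, hB1, hB2⟩ := exists_valuationSubring_of_forall_ne_one
    (aeval (R := K) η).toRingHom (RingHom.ker (eval (0 : Fin 3 → K))) (fun j hj h => by
      have h1 : f ∣ j - 1 := (hker _).1 (by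
        rw [map_sub, map_one, sub_eq_zero]; exact h)
      obtain ⟨c, hc⟩ := h1
      have := congrArg (eval (0 : Fin 3 → K)) hc
      rw [RingHom.mem_ker] at hj
      rw [map_sub, map_mul, hj, hf0, map_one, zero_mul, zero_sub] at this
      exact one_ne_zero (neg_eq_zero.1 this))
  obtain ⟨hw0, -⟩ := direction_mem_valuationSubring hdir hw hfw B
    (fun c => by simpa using hB1 (C c))
    (fun i => by simpa using hB2 (X i) (by simp [RingHom.mem_ker]))
  set c := w 1 / w 0 with hc
  set e := w 2 / w 0 with he
  set a := η 1 - η 0 * c with ha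
  set b := η 2 - η 0 * e with hb
  let k := IntermediateField.adjoin K {a, b, c, e}
  have hmem : ∀ y ∈ ({a, b, c, e} : Set E), y ∈ k := IntermediateField.subset_adjoin K _
  let α : k := ⟨a, hmem a (by simp)⟩
  let β : k := ⟨b, hmem b (by simp)⟩
  let γ : k := ⟨c, hmem c (by simp)⟩
  let δ : k := ⟨e, hmem e (by simp)⟩
  have hev : ∀ (s : E) (g : MvPolynomial (Fin 3) K),
      Polynomial.aeval s (aeval (linePt (Polynomial.X : Polynomial k) (Polynomial.C α)
        (Polynomial.C β) (Polynomial.C γ) (Polynomial.C δ)) g) = aeval (linePt s a b c e) g := by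
    intro s g
    have h := comp_aeval_apply (linePt (Polynomial.X : Polynomial k) (Polynomial.C α)
        (Polynomial.C β) (Polynomial.C γ) (Polynomial.C δ))
        ((Polynomial.aeval s : Polynomial k →ₐ[k] E).restrictScalars K) g
    rw [AlgHom.restrictScalars_apply] at h
    rw [h]
    congr 2
    rw [map_linePt]
    simp [α, β, γ, δ, IntermediateField.algebraMap_apply]
  refine ⟨k, inferInstance, inferInstance, α, β, γ, δ, ?_, fun g => ⟨fun h => ?_, ?_⟩⟩
  · apply IntermediateField.map_injective k.val
    rw [IntermediateField.adjoin_map, ← AlgHom.fieldRange_eq_map, IntermediateField.fieldRange_val]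
    congr 1
    simp [Set.image_insert_eq, α, β, γ, δ]
  · have := hev (η 0) g
    rw [h, map_zero] at this
    refine (hker g).1 (this.symm ▸ congrArg (fun e => aeval e g) ?_)
    funext i
    fin_cases i <;> simp [linePt, ha, hb]
  · rintro ⟨c', rfl⟩
    rw [map_mul]
    convert zero_mul _
    have hinf : ∀ s : E, Polynomial.aeval s (aeval (linePt (Polynomial.X : Polynomial k)
        (Polynomial.C α) (Polynomial.C β) (Polynomial.C γ) (Polynomial.C δ)) f) = 0 := by
      intro s
      rw [hev, ← hfw ((s - η 0) / w 0)]
      refine congrArg (fun e => aeval e f) (funext fun i => ?_)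
      fin_cases i <;> simp [linePt, ha, hb, hc, he] <;> field_simp <;> ring
    have : Infinite E := Infinite.of_injective _ (algebraMap K E).injective
    rw [← Polynomial.map_eq_zero_iff (algebraMap k E).injective]
    refine Polynomial.funext fun s => ?_
    rw [Polynomial.eval_map_algebraMap, hinf, Polynomial.eval_zero]

/-! ### Polynomials with vanishing derivatives -/

theorem coeff_pderiv_eq {R σ : Type*} [CommSemiring R] (i : σ) (P : MvPolynomial σ R)
    (m : σ →₀ ℕ) :
    coeff m (pderiv i P) = coeff (m + Finsupp.single i 1) P * (m i + 1) := by
  classical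
  induction P using MvPolynomial.induction_on' with
  | monomial s a =>
    rw [pderiv_monomial, coeff_monomial, coeff_monomial]
    by_cases h : s = m + Finsupp.single i 1
    · subst h
      simp
    · rw [if_neg h, zero_mul]
      split_ifs with h2
      · by_cases hs : s i = 0
        · simp [hs]
        · exfalso
          apply h
          rw [← h2, tsub_add_cancel_of_le]
          rw [Finsupp.single_le_iff]
          lia
      · rfl
  | add p q hp hq => simp only [map_add, coeff_add, hp, hq, add_mul]

/-- Over an algebraically closed field, a polynomial with vanishing derivatives is constant or
a proper power. -/
theorem eq_C_or_eq_pow_of_pderiv_eq_zero [IsAlgClosed K] {σ : Type*} (P : MvPolynomial σ K)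
    (h : ∀ i, pderiv i P = 0) :
    (∃ c, P = C c) ∨ ∃ (p : ℕ) (Q : MvPolynomial σ K), 1 < p ∧ P = Q ^ p := by
  classical
  obtain ⟨p, hp⟩ := CharP.exists K
  have hdvd : ∀ s ∈ P.support, ∀ i, p ∣ s i := by
    intro s hs i
    rcases Nat.eq_zero_or_pos (s i) with h0 | h0
    · simp [h0]
    have h1 := congrArg (coeff (s - Finsupp.single i 1)) (h i)
    rw [coeff_pderiv_eq, coeff_zero, tsub_add_cancel_of_le (Finsupp.single_le_iff.2 h0)] at h1
    have h2 := (mul_eq_zero.1 h1).resolve_left (mem_support_iff.1 hs)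
    rw [← CharP.cast_eq_zero_iff K p]
    rw [Finsupp.tsub_apply, Finsupp.single_eq_same] at h2
    rw [← h2, Nat.cast_sub h0]
    simp
  rcases CharP.char_is_prime_or_zero K p with hpp | rfl
  · right
    have : Fact p.Prime := ⟨hpp⟩
    have : ExpChar K p := ExpChar.prime hpp
    choose r hr using fun a : K => IsAlgClosed.exists_pow_nat_eq a hpp.pos
    refine ⟨p, ∑ s ∈ P.support, monomial (s.mapRange (· / p) (by simp)) (r (coeff s P)),
      hpp.one_lt, ?_⟩
    rw [sum_pow_char]
    conv_lhs => rw [P.as_sum]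
    refine Finset.sum_congr rfl fun s hs => ?_
    have hs' : p • s.mapRange (· / p) (by simp) = s := by
      ext i
      simp [Nat.mul_div_cancel' (hdvd s hs i)]
    rw [monomial_pow, hr, hs']
  · left
    refine ⟨coeff 0 P, ?_⟩
    ext m
    rw [coeff_C]
    split_ifs with hm
    · rw [hm]
    · by_contra hne
      apply hm
      ext i
      simpa using (zero_dvd_iff.1 (hdvd m (mem_support_iff.2 hne) i)).symm

theorem exists_pderiv_ne_zero_of_irreducible [IsAlgClosed K] {σ : Type*} {P : MvPolynomial σ K}
    (hP : Irreducible P) : ∃ i, pderiv i P ≠ 0 := by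
  by_contra! h
  rcases eq_C_or_eq_pow_of_pderiv_eq_zero P h with ⟨c, rfl⟩ | ⟨p, Q, hp, rfl⟩
  · refine hP.not_isUnit (IsUnit.map C (isUnit_iff_ne_zero.2 fun hc => hP.ne_zero ?_))
    rw [hc, map_zero]
  · exact not_irreducible_pow (by lia) hP

theorem totalDegree_pderiv_lt {R σ : Type*} [CommSemiring R] {P : MvPolynomial σ R} {i : σ}
    (h : pderiv i P ≠ 0) : (pderiv i P).totalDegree < P.totalDegree := by
  classical
  obtain ⟨m, hm, hd⟩ := Finset.exists_mem_eq_sup _ (support_nonempty.2 h)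
    (fun s : σ →₀ ℕ => s.degree)
  have h1 : (pderiv i P).totalDegree = m.degree := by
    rw [totalDegree]
    exact hd
  have h2 : m + Finsupp.single i 1 ∈ P.support := by
    rw [mem_support_iff] at hm ⊢
    rw [coeff_pderiv_eq] at hm
    exact left_ne_zero_of_mul hm
  have h3 := le_totalDegree h2
  rw [h1]
  change (m + Finsupp.single i 1).degree ≤ _ at h3
  rw [map_add, Finsupp.degree_single] at h3
  lia

/-- Algebraically dependent elements satisfy a relation with a nonvanishing derivative. -/
theorem exists_relation_pderiv_ne_zero [IsAlgClosed K] {ι E : Type*} [Field E] [Algebra K E]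
    {a : ι → E} (ha : ¬ AlgebraicIndependent K a) :
    ∃ P : MvPolynomial ι K, aeval a P = 0 ∧ ∃ i, aeval a (pderiv i P) ≠ 0 := by
  classical
  have hex : ∃ n, ∃ P : MvPolynomial ι K, P ≠ 0 ∧ aeval a P = 0 ∧ P.totalDegree = n := by
    rw [algebraicIndependent_iff] at ha
    push Not at ha
    obtain ⟨P, h1, h2⟩ := ha
    exact ⟨_, P, h2, h1, rfl⟩
  obtain ⟨P, hP0, hPa, hPn⟩ := Nat.find_spec hex
  have hmin : ∀ Q : MvPolynomial ι K, Q ≠ 0 → aeval a Q = 0 → P.totalDegree ≤ Q.totalDegree :=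
    fun Q h1 h2 => hPn ▸ Nat.find_min' hex ⟨Q, h1, h2, rfl⟩
  obtain ⟨i, hi⟩ := exists_pderiv_ne_zero_of_irreducible
    (irreducible_of_forall_totalDegree_le hmin hP0 hPa)
  exact ⟨P, hPa, i, fun h => (totalDegree_pderiv_lt hi).not_ge (hmin _ hi h)⟩

/-! ### The function field of a ruled surface -/

theorem derivation_aeval_eq_sum {R A N ι : Type*} [CommSemiring R] [CommSemiring A] [Algebra R A]
    [AddCommMonoid N] [Module R N] [Module A N] [Fintype ι] (D : Derivation R A N) (a : ι → A)
    (P : MvPolynomial ι R) :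
    D (aeval a P) = ∑ i, aeval a (pderiv i P) • D (a i) := by
  classical
  induction P using MvPolynomial.induction_on with
  | C c => simp
  | add p q hp hq => simp only [map_add, hp, hq, add_smul, Finset.sum_add_distrib]
  | mul_X p j hp =>
    rw [map_mul, aeval_X, D.leibniz, hp]
    simp only [Derivation.leibniz, pderiv_X, smul_eq_mul, map_add, map_mul, aeval_X, add_smul,
      Finset.sum_add_distrib, Finset.smul_sum, mul_smul]
    congr 1
    rw [Finset.sum_eq_single j]
    · simp
    · intro i _ hi
      simp [Pi.single_eq_of_ne' hi]
    · simp

/-- `M = k(x)` is the function field of `f = 0`, where `k` is generated by the coordinates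
`α, β, γ, δ` of a generic line of the surface and `x` is a parameter on this line. -/
structure IsRuledModel (f : MvPolynomial (Fin 3) K) {k M : Type} [Field k] [Field M] [Algebra K k]
    [Algebra K M] [Algebra k M] (x : M) (α β γ δ : k) : Prop where
  transcendental : Transcendental k x
  adjoin_x : IntermediateField.adjoin k {x} = ⊤
  adjoin_coeffs : IntermediateField.adjoin K {α, β, γ, δ} = ⊤
  aeval_eq_zero_iff : ∀ g : MvPolynomial (Fin 3) K,
    aeval (linePt x (algebraMap k M α) (algebraMap k M β) (algebraMap k M γ)
      (algebraMap k M δ)) g = 0 ↔ f ∣ g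

theorem exists_isRuledModel [IsAlgClosed K] {f : MvPolynomial (Fin 3) K} (hf : Prime f)
    (hf0 : eval 0 f = 0)
    (hline : ∀ p, eval p f = 0 → ∃ w : Fin 3 → K, w ≠ 0 ∧ ∀ s : K, eval (p + s • w) f = 0)
    (hdir : ¬ ∃ w : Fin 3 → K, w ≠ 0 ∧ w 0 = 0 ∧ ∀ s : K, eval (s • w) f = 0) :
    ∃ (k M : Type) (_ : Field k) (_ : Field M) (_ : Algebra K k) (_ : Algebra K M)
      (_ : Algebra k M) (_ : IsScalarTower K k M) (x : M) (α β γ δ : k),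
      IsRuledModel f x α β γ δ := by
  obtain ⟨k, _, _, α, β, γ, δ, hgen, hker⟩ := exists_ruled_parametrization hf hf0 hline hdir
  have hinj : Function.Injective (algebraMap (Polynomial k) (FractionRing (Polynomial k))) :=
    IsFractionRing.injective _ _
  refine ⟨k, FractionRing (Polynomial k), inferInstance, inferInstance, inferInstance,
    inferInstance, inferInstance, inferInstance, algebraMap (Polynomial k) _ Polynomial.X, α, β, γ, δ,
    ?_, ?_, hgen, fun g => ?_⟩
  · rw [transcendental_iff]
    intro p hp
    rw [Polynomial.aeval_algebraMap_apply, Polynomial.aeval_X_left_apply] at hp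
    exact hinj (hp.trans (map_zero _).symm)
  · rw [eq_top_iff]
    intro y _
    have hP : ∀ p : Polynomial k, algebraMap (Polynomial k) (FractionRing (Polynomial k)) p ∈
        IntermediateField.adjoin k {algebraMap (Polynomial k) (FractionRing (Polynomial k))
          Polynomial.X} := by
      intro p
      have : algebraMap (Polynomial k) (FractionRing (Polynomial k)) p =
          Polynomial.aeval (algebraMap (Polynomial k) (FractionRing (Polynomial k)) Polynomial.X)
            p := by
        rw [Polynomial.aeval_algebraMap_apply, Polynomial.aeval_X_left_apply]
      rw [this]
      exact IntermediateField.algebra_adjoin_le_adjoin k _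
        (Polynomial.aeval_mem_adjoin_singleton k _)
    obtain ⟨p, q, -, rfl⟩ := IsFractionRing.div_surjective (A := Polynomial k) y
    exact div_mem (hP p) (hP q)
  · rw [← hker g]
    have h := aeval_algebraMap_apply (FractionRing (Polynomial k))
      (linePt (Polynomial.X : Polynomial k) (Polynomial.C α) (Polynomial.C β) (Polynomial.C γ) (Polynomial.C δ)) g
    have h2 := map_linePt (algebraMap (Polynomial k) (FractionRing (Polynomial k)))
      (Polynomial.X : Polynomial k) (Polynomial.C α) (Polynomial.C β) (Polynomial.C γ)
      (Polynomial.C δ)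
    have h3 : ∀ c : k, algebraMap (Polynomial k) (FractionRing (Polynomial k)) (Polynomial.C c) =
        algebraMap k _ c := fun c => by
      rw [IsScalarTower.algebraMap_apply k (Polynomial k), Polynomial.algebraMap_eq]
    simp only [h3] at h2
    rw [Function.comp_def, h2] at h
    rw [h, map_eq_zero_iff _ hinj]

namespace IsRuledModel

variable {f : MvPolynomial (Fin 3) K} {k M : Type} [Field k] [Field M] [Algebra K k]
    [Algebra K M] [Algebra k M] [IsScalarTower K k M] {x : M} {α β γ δ : k}

/-- The generic point of the surface. -/
abbrev genPt (x : M) (α β γ δ : k) : Fin 3 → M :=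
  linePt x (algebraMap k M α) (algebraMap k M β) (algebraMap k M γ) (algebraMap k M δ)

theorem aeval_linePt_eq_zero (h : IsRuledModel f x α β γ δ) {N : Type*} [CommRing N] [Algebra K N]
    [Algebra k N] [IsScalarTower K k N] (s : N) :
    aeval (linePt s (algebraMap k N α) (algebraMap k N β) (algebraMap k N γ)
      (algebraMap k N δ)) f = 0 := by
  have hev : ∀ {N : Type _} [CommRing N] [Algebra K N] [Algebra k N] [IsScalarTower K k N] (s : N),
      Polynomial.aeval s (aeval (linePt (Polynomial.X : Polynomial k) (Polynomial.C α)
        (Polynomial.C β) (Polynomial.C γ) (Polynomial.C δ)) f) =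
      aeval (linePt s (algebraMap k N α) (algebraMap k N β) (algebraMap k N γ)
        (algebraMap k N δ)) f := by
    intro N _ _ _ _ s
    have h := comp_aeval_apply (linePt (Polynomial.X : Polynomial k) (Polynomial.C α)
        (Polynomial.C β) (Polynomial.C γ) (Polynomial.C δ))
        ((Polynomial.aeval s : Polynomial k →ₐ[k] N).restrictScalars K) f
    rw [AlgHom.restrictScalars_apply] at h
    rw [h]
    congr 2
    rw [map_linePt]
    simp
  have h0 : aeval (linePt (Polynomial.X : Polynomial k) (Polynomial.C α)
        (Polynomial.C β) (Polynomial.C γ) (Polynomial.C δ)) f = 0 := by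
    have h1 := h.transcendental
    rw [transcendental_iff] at h1
    apply h1
    have h2 := (h.aeval_eq_zero_iff f).2 dvd_rfl
    have h3 := comp_aeval_apply (linePt (Polynomial.X : Polynomial k) (Polynomial.C α)
        (Polynomial.C β) (Polynomial.C γ) (Polynomial.C δ))
        ((Polynomial.aeval x : Polynomial k →ₐ[k] M).restrictScalars K) f
    rw [AlgHom.restrictScalars_apply] at h3
    rw [h3, ← h2]
    congr 2
    rw [map_linePt]
    simp
  rw [← hev, h0, map_zero]

theorem eq_top (h : IsRuledModel f x α β γ δ) (T : IntermediateField K M)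
    (hx : x ∈ T) (hα : algebraMap k M α ∈ T) (hβ : algebraMap k M β ∈ T)
    (hγ : algebraMap k M γ ∈ T) (hδ : algebraMap k M δ ∈ T) : T = ⊤ := by
  have h1 : T.comap (IsScalarTower.toAlgHom K k M) = ⊤ := by
    rw [eq_top_iff, ← h.adjoin_coeffs, IntermediateField.adjoin_le_iff]
    rintro y (rfl | rfl | rfl | rfl) <;> assumption
  have hT : ∀ c : k, algebraMap k M c ∈ T := fun c => by
    have : c ∈ T.comap (IsScalarTower.toAlgHom K k M) := h1 ▸ trivial
    exact this
  let T' : IntermediateField k M := { T with algebraMap_mem' := hT }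
  have h2 : T' = ⊤ := by
    rw [eq_top_iff, ← h.adjoin_x, IntermediateField.adjoin_le_iff]
    rintro y rfl
    exact hx
  rw [eq_top_iff]
  intro y _
  have : y ∈ T' := h2 ▸ trivial
  exact this

/-- The slopes of the generic line become integral over the coordinate ring after multiplication
by a function not vanishing at the origin. -/
theorem exists_isIntegralElem [IsAlgClosed K] (h : IsRuledModel f x α β γ δ)
    (hdir : ¬ ∃ w : Fin 3 → K, w ≠ 0 ∧ w 0 = 0 ∧ ∀ s : K, eval (s • w) f = 0) :
    ∃ c : MvPolynomial (Fin 3) K, eval 0 c ≠ 0 ∧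
      (aeval (R := K) (genPt x α β γ δ)).toRingHom.IsIntegralElem
        (aeval (genPt x α β γ δ) c * algebraMap k M γ) ∧
      (aeval (R := K) (genPt x α β γ δ)).toRingHom.IsIntegralElem
        (aeval (genPt x α β γ δ) c * algebraMap k M δ) := by
  have key : ∀ B : ValuationSubring M, (∀ c : K, algebraMap K M c ∈ B) →
      (∀ i, genPt x α β γ δ i ∈ B.nonunits) → algebraMap k M γ ∈ B ∧ algebraMap k M δ ∈ B := by
    intro B hB hB2
    have h1 := direction_mem_valuationSubring hdir (η := genPt x α β γ δ)
      (w := ![1, algebraMap k M γ, algebraMap k M δ]) (fun h => by simpa using congrFun h 0)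
      (fun s => by
        rw [← h.aeval_linePt_eq_zero (x + s)]
        refine congrArg (fun e => aeval e f) (funext fun i => ?_)
        fin_cases i <;> simp [linePt] <;> ring) B hB hB2
    exact ⟨by simpa using h1.2 1, by simpa using h1.2 2⟩
  obtain ⟨c, hc, hci⟩ := exists_isIntegralElem_of_forall_mem_valuationSubring
    (η := genPt x α β γ δ) _ fun B h1 h2 => (key B h1 h2).1
  obtain ⟨e, he, hei⟩ := exists_isIntegralElem_of_forall_mem_valuationSubring
    (η := genPt x α β γ δ) _ fun B h1 h2 => (key B h1 h2).2
  refine ⟨c * e, by rw [map_mul]; exact mul_ne_zero hc he, ?_, ?_⟩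
  · rw [map_mul, mul_comm (aeval _ c), mul_assoc]
    exact RingHom.IsIntegralElem.mul _ (RingHom.isIntegralElem_map _) hci
  · rw [map_mul, mul_assoc]
    exact RingHom.IsIntegralElem.mul _ (RingHom.isIntegralElem_map _) hei

end IsRuledModel

namespace IsRuledModel

variable {f : MvPolynomial (Fin 3) K} {k M : Type} [Field k] [Field M] [Algebra K k]
    [Algebra K M] [Algebra k M] [IsScalarTower K k M] {x : M} {α β γ δ : k}

variable (K) in
/-- The subfield of `M` generated by the coordinates of the generic point. -/
abbrev coordField (x : M) (α β γ δ : k) : IntermediateField K M :=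
  IntermediateField.adjoin K (Set.range (genPt x α β γ δ))

theorem genPt_mem (x : M) (α β γ δ : k) (i : Fin 3) :
    genPt x α β γ δ i ∈ coordField K x α β γ δ :=
  IntermediateField.subset_adjoin K _ ⟨i, rfl⟩

theorem aeval_genPt_mem (x : M) (α β γ δ : k) (g : MvPolynomial (Fin 3) K) :
    aeval (genPt x α β γ δ) g ∈ coordField K x α β γ δ := by
  have := comp_aeval_apply (fun i => (⟨_, genPt_mem x α β γ δ i⟩ : coordField K x α β γ δ))
    (coordField K x α β γ δ).val g
  change _ = aeval (genPt x α β γ δ) g at this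
  rw [← this]
  exact Subtype.property _

theorem isIntegral_of_isIntegralElem {y : M}
    (hy : (aeval (R := K) (genPt x α β γ δ)).toRingHom.IsIntegralElem y) :
    IsIntegral (coordField K x α β γ δ) y := by
  obtain ⟨p, hp, hpy⟩ := hy
  refine ⟨p.map (aeval (R := K) (fun i =>
    (⟨_, genPt_mem x α β γ δ i⟩ : coordField K x α β γ δ))).toRingHom, hp.map _, ?_⟩
  rw [Polynomial.eval₂_map, ← hpy]
  congr 1
  apply RingHom.ext
  intro g
  exact comp_aeval_apply (fun i => (⟨_, genPt_mem x α β γ δ i⟩ : coordField K x α β γ δ))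
    (coordField K x α β γ δ).val g

theorem aeval_genPt_ne_zero (h : IsRuledModel f x α β γ δ) (hf0 : eval 0 f = 0)
    {c : MvPolynomial (Fin 3) K} (hc : eval 0 c ≠ 0) : aeval (genPt x α β γ δ) c ≠ 0 := by
  intro h0
  obtain ⟨g, rfl⟩ := (h.aeval_eq_zero_iff c).1 h0
  rw [map_mul, hf0, zero_mul] at hc
  exact hc rfl

theorem isIntegral_slopes [IsAlgClosed K] (h : IsRuledModel f x α β γ δ) (hf0 : eval 0 f = 0)
    (hdir : ¬ ∃ w : Fin 3 → K, w ≠ 0 ∧ w 0 = 0 ∧ ∀ s : K, eval (s • w) f = 0) :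
    IsIntegral (coordField K x α β γ δ) (algebraMap k M γ) ∧
      IsIntegral (coordField K x α β γ δ) (algebraMap k M δ) := by
  obtain ⟨c, hc, h1, h2⟩ := h.exists_isIntegralElem hdir
  have hc0 := h.aeval_genPt_ne_zero hf0 hc
  have key : ∀ y : M, IsIntegral (coordField K x α β γ δ) (aeval (genPt x α β γ δ) c * y) →
      IsIntegral (coordField K x α β γ δ) y := by
    intro y hy
    have : y = algebraMap (coordField K x α β γ δ) M ⟨_, aeval_genPt_mem x α β γ δ c⟩⁻¹ *
        (aeval (genPt x α β γ δ) c * y) := by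
      rw [map_inv₀]
      exact (inv_mul_cancel_left₀ hc0 y).symm
    rw [this]
    exact isIntegral_algebraMap.mul hy
  exact ⟨key _ (isIntegral_of_isIntegralElem h1), key _ (isIntegral_of_isIntegralElem h2)⟩

theorem eq_top_of_slopes_mem (h : IsRuledModel f x α β γ δ) (T : IntermediateField K M)
    (hL : coordField K x α β γ δ ≤ T) (hγ : algebraMap k M γ ∈ T) (hδ : algebraMap k M δ ∈ T) :
    T = ⊤ := by
  have hx : x ∈ T := hL (genPt_mem x α β γ δ 0)
  have h1 := hL (genPt_mem x α β γ δ 1)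
  have h2 := hL (genPt_mem x α β γ δ 2)
  refine h.eq_top T hx ?_ ?_ hγ hδ
  · have : algebraMap k M α = genPt x α β γ δ 1 - x * algebraMap k M γ := by simp [linePt]
    rw [this]
    exact sub_mem h1 (mul_mem hx hγ)
  · have : algebraMap k M β = genPt x α β γ δ 2 - x * algebraMap k M δ := by simp [linePt]
    rw [this]
    exact sub_mem h2 (mul_mem hx hδ)

theorem finiteDimensional [IsAlgClosed K] (h : IsRuledModel f x α β γ δ) (hf0 : eval 0 f = 0)
    (hdir : ¬ ∃ w : Fin 3 → K, w ≠ 0 ∧ w 0 = 0 ∧ ∀ s : K, eval (s • w) f = 0) :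
    FiniteDimensional (coordField K x α β γ δ) M := by
  obtain ⟨h1, h2⟩ := h.isIntegral_slopes hf0 hdir
  let L := coordField K x α β γ δ
  have hfin : FiniteDimensional L
      (IntermediateField.adjoin L {algebraMap k M γ, algebraMap k M δ}) :=
    IntermediateField.finiteDimensional_adjoin (by
      rintro y (rfl | rfl) <;> assumption)
  have htop : (IntermediateField.adjoin L
      {algebraMap k M γ, algebraMap k M δ}).restrictScalars K = ⊤ := by
    refine h.eq_top_of_slopes_mem _ (fun y hy => ?_) ?_ ?_
    · exact IntermediateField.algebraMap_mem
        (IntermediateField.adjoin L {algebraMap k M γ, algebraMap k M δ}) (⟨y, hy⟩ : L)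
    · exact IntermediateField.subset_adjoin L _ (by simp)
    · exact IntermediateField.subset_adjoin L _ (by simp)
  have htop' : IntermediateField.adjoin L {algebraMap k M γ, algebraMap k M δ} = ⊤ := by
    rw [eq_top_iff]
    intro y _
    have : y ∈ (IntermediateField.adjoin L
      {algebraMap k M γ, algebraMap k M δ}).restrictScalars K := htop ▸ trivial
    exact this
  rw [htop'] at hfin
  exact Module.Finite.equiv (IntermediateField.topEquiv (F := L) (E := M)).toLinearEquiv

theorem not_algebraicIndependent [IsAlgClosed K] (h : IsRuledModel f x α β γ δ)
    (hf : f ≠ 0) (hf0 : eval 0 f = 0)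
    (hdir : ¬ ∃ w : Fin 3 → K, w ≠ 0 ∧ w 0 = 0 ∧ ∀ s : K, eval (s • w) f = 0) (a b : k) :
    ¬ AlgebraicIndependent K ![a, b] := by
  intro hab
  have hfd := h.finiteDimensional hf0 hdir
  have halg : Algebra.IsAlgebraic (Algebra.adjoin K (Set.range (genPt x α β γ δ))) M := by
    open scoped IntermediateField.algebraAdjoinAdjoin in
    rw [IsFractionRing.comap_isAlgebraic_iff
      (A := Algebra.adjoin K (Set.range (genPt x α β γ δ))) (K := coordField K x α β γ δ)]
    infer_instance
  obtain ⟨t, hts, ht⟩ := exists_isTranscendenceBasis_subset (R := K)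
    (Set.range (genPt x α β γ δ))
  have hcard : Cardinal.mk t ≤ 2 := by
    by_contra! hlt
    have hfin : (Set.range (genPt x α β γ δ)).Finite := Set.finite_range _
    have h4 : (Set.range (genPt x α β γ δ)).ncard ≤ 3 := by
      rw [← Set.image_univ]
      exact (Set.ncard_image_le Set.finite_univ).trans (by simp [Set.ncard_univ])
    have h5 : 2 < t.ncard := by
      rw [← Set.cast_ncard (hfin.subset hts)] at hlt
      exact_mod_cast hlt
    have h6 := Set.ncard_le_ncard hts hfin
    have h3 : t = Set.range (genPt x α β γ δ) :=
      Set.eq_of_subset_of_ncard_le hts (by lia) hfin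
    have hinj : Function.Injective (genPt x α β γ δ) := by
      have : Function.Injective (Set.rangeFactorization (genPt x α β γ δ)) := by
        refine ((Nat.bijective_iff_surjective_and_card _).2
          ⟨Set.rangeFactorization_surjective, ?_⟩).1
        rw [Nat.card_coe_set_eq, Nat.card_fin]
        lia
      exact (Set.rangeFactorization_injective).1 this
    have hind : AlgebraicIndependent K (genPt x α β γ δ) := by
      rw [← algebraicIndependent_subtype_range hinj]
      exact h3 ▸ ht.1
    exact hf (hind.eq_zero_of_aeval_eq_zero f ((h.aeval_eq_zero_iff f).2 dvd_rfl))
  have h1 : (2 : Cardinal) ≤ Algebra.trdeg K k := by simpa using hab.cardinalMk_le_trdeg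
  have h2 : (1 : Cardinal) ≤ Algebra.trdeg k M := by
    have := (algebraicIndependent_unique_type_iff (ι := Unit) (x := fun _ => x)).2 h.transcendental
    simpa using this.cardinalMk_le_trdeg
  have h3 := _root_.trdeg_add_eq K k (A := M)
  rw [← ht.cardinalMk_eq_trdeg] at h3
  have h4 := (add_le_add h1 h2).trans (h3.le.trans hcard)
  norm_num at h4

theorem eq_zero_of_sub_mul_eq_zero (h : IsRuledModel f x α β γ δ) {u v : k}
    (h0 : algebraMap k M u - algebraMap k M v * x = 0) : u = 0 ∧ v = 0 := by
  have htr := h.transcendental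
  rw [transcendental_iff] at htr
  have h4 := htr (Polynomial.C u - Polynomial.C v * Polynomial.X) (by simpa using h0)
  have h5 := congrArg (Polynomial.coeff · 0) h4
  have h6 := congrArg (Polynomial.coeff · 1) h4
  simp [Polynomial.coeff_C] at h5 h6
  exact ⟨h5, h6⟩

/-- The function field is separable over the field of coordinates. -/
theorem isSeparable [IsAlgClosed K] (h : IsRuledModel f x α β γ δ)
    (hf : f ≠ 0) (hf0 : eval 0 f = 0)
    (hdir : ¬ ∃ w : Fin 3 → K, w ≠ 0 ∧ w 0 = 0 ∧ ∀ s : K, eval (s • w) f = 0) :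
    Algebra.IsSeparable (coordField K x α β γ δ) M := by
  have hfd := h.finiteDimensional hf0 hdir
  rw [← Algebra.FormallyUnramified.iff_isSeparable]
  let L := coordField K x α β γ δ
  let D : Derivation K M (KaehlerDifferential L M) :=
    (KaehlerDifferential.D L M).restrictScalars K
  have hDL : ∀ y ∈ L, D y = 0 := fun y hy =>
    (KaehlerDifferential.D L M).map_algebraMap (⟨y, hy⟩ : L)
  have hx : D x = 0 := hDL x (genPt_mem x α β γ δ 0)
  have key : ∀ a b : k, algebraMap k M a + x * algebraMap k M b ∈ L →
      D (algebraMap k M a) = 0 ∧ D (algebraMap k M b) = 0 := by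
    intro a b hab
    have h1 : D (algebraMap k M a) = - (x • D (algebraMap k M b)) := by
      have := hDL _ hab
      rw [map_add, D.leibniz, hx, smul_zero, add_zero] at this
      exact eq_neg_of_add_eq_zero_left this
    obtain ⟨P, hP, hi⟩ := exists_relation_pderiv_ne_zero
      (h.not_algebraicIndependent hf hf0 hdir a b)
    have hval : ∀ Q : MvPolynomial (Fin 2) K, aeval (fun i => algebraMap k M (![a, b] i)) Q =
        algebraMap k M (aeval ![a, b] Q) := fun Q => aeval_algebraMap_apply M ![a, b] Q
    have h2 := derivation_aeval_eq_sum D (fun i => algebraMap k M (![a, b] i)) P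
    simp only [hval, hP, map_zero, Fin.sum_univ_two, Matrix.cons_val_zero,
      Matrix.cons_val_one] at h2
    rw [h1, smul_neg, smul_smul, neg_add_eq_sub, ← sub_smul] at h2
    have h3 : algebraMap k M (aeval ![a, b] (pderiv 1 P)) -
        algebraMap k M (aeval ![a, b] (pderiv 0 P)) * x ≠ 0 := by
      intro h0
      obtain ⟨h5, h6⟩ := h.eq_zero_of_sub_mul_eq_zero h0
      obtain ⟨i, hi⟩ := hi
      fin_cases i
      · exact hi h6
      · exact hi h5
    have h4 : D (algebraMap k M b) = 0 := (smul_eq_zero.1 h2.symm).resolve_left h3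
    exact ⟨by rw [h1, h4, smul_zero, neg_zero], h4⟩
  obtain ⟨hα, hγ⟩ := key α γ (genPt_mem x α β γ δ 1)
  obtain ⟨hβ, hδ⟩ := key β δ (genPt_mem x α β γ δ 2)
  let T : IntermediateField K M :=
    { carrier := {y | D y = 0}
      mul_mem' := fun {y z} hy hz => by
        have hy' : D y = 0 := hy
        have hz' : D z = 0 := hz
        change D (y * z) = 0
        rw [D.leibniz, hy', hz', smul_zero, smul_zero, add_zero]
      add_mem' := fun {y z} hy hz => by
        have hy' : D y = 0 := hy
        have hz' : D z = 0 := hz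
        change D (y + z) = 0
        rw [map_add, hy', hz', add_zero]
      algebraMap_mem' := fun c => D.map_algebraMap c
      inv_mem' := fun y hy => by
        have hy' : D y = 0 := hy
        change D y⁻¹ = 0
        rw [D.leibniz_inv, hy', smul_zero] }
  have hT : T = ⊤ := h.eq_top T hx hα hβ hγ hδ
  have hD : ∀ y, KaehlerDifferential.D L M y = 0 := fun y => by
    have : y ∈ T := hT ▸ trivial
    exact this
  refine ⟨(Submodule.subsingleton_iff M).1 ?_⟩
  rw [← subsingleton_iff_bot_eq_top, ← KaehlerDifferential.span_range_derivation L M, eq_comm,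
    Submodule.span_eq_bot]
  rintro _ ⟨y, rfl⟩
  exact hD y
end IsRuledModel

theorem exists_isIntegralElem_of_not_algebraicIndependent {k : Type} [Field k] [Algebra K k]
    {a b : k} (hab : ¬ AlgebraicIndependent K ![b, a]) (ha : Transcendental K a) :
    ∃ c : Polynomial K, c ≠ 0 ∧
      (Polynomial.aeval (R := K) a).toRingHom.IsIntegralElem (Polynomial.aeval a c * b) := by
  rw [algebraicIndependent_iff] at hab
  push Not at hab
  obtain ⟨Q, hQ, hQ0⟩ := hab
  let e := MvPolynomial.uniqueAlgEquiv K (Fin 1)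
  let P : Polynomial (Polynomial K) := (finSuccEquiv K 1 Q).map e.toRingEquiv.toRingHom
  have hP : P ≠ 0 := by
    intro h
    apply hQ0
    have h1 : finSuccEquiv K 1 Q = 0 :=
      (Polynomial.map_eq_zero_iff (f := e.toRingEquiv.toRingHom) e.injective).1 h
    exact (map_eq_zero_iff _ (finSuccEquiv K 1).injective).1 h1
  have hval : ∀ q : MvPolynomial (Fin 2) K, ((finSuccEquiv K 1 q).map e.toRingEquiv.toRingHom).eval₂
      (Polynomial.aeval (R := K) a).toRingHom b = aeval ![b, a] q := by
    intro q
    induction q using MvPolynomial.induction_on with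
    | C r => simp [finSuccEquiv_apply, e, uniqueAlgEquiv]
    | add p q hp hq => simp only [map_add, Polynomial.map_add, Polynomial.eval₂_add, hp, hq]
    | mul_X p i hp =>
      rw [map_mul, Polynomial.map_mul, Polynomial.eval₂_mul, hp, map_mul]
      congr 1
      fin_cases i
      · simp [finSuccEquiv_X_zero]
      · have : finSuccEquiv K 1 (X 1) = Polynomial.C (X 0) := finSuccEquiv_X_succ (j := 0)
        simp [this, e, uniqueAlgEquiv]
  exact ⟨P.leadingCoeff, Polynomial.leadingCoeff_ne_zero.2 hP,
    RingHom.isIntegralElem_leadingCoeff_mul _ P b ((hval Q).trans hQ)⟩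

theorem exists_eq_of_monic_eval₂_eq_zero [IsAlgClosed K] {E : Type*} [Field E] (ρ : K →+* E)
    {p : Polynomial K} (hp : p.Monic) {y : E} (hy : p.eval₂ ρ y = 0) : ∃ r, ρ r = y := by
  letI := ρ.toAlgebra
  have hint : IsIntegral K y := ⟨p, hp, hy⟩
  have h1 := IsAlgClosed.degree_eq_one_of_irreducible K (minpoly.irreducible hint)
  exact minpoly.mem_range_of_degree_eq_one K y h1

/-- Specialisation of one of two independent generic points to a rational point. -/
theorem exists_specialization [IsAlgClosed K] {k N ι : Type} [Field k] [Field N] [Algebra K k]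
    [Algebra K N] (τ σ : k →ₐ[K] N) (a : k)
    (ha : ∀ P : Polynomial k, P.eval₂ (σ : k →+* N) (τ a) = 0 → P = 0) (e : ι → k)
    (c : Polynomial K) (hc : ∀ i, (Polynomial.aeval (R := K) a).toRingHom.IsIntegralElem
      (Polynomial.aeval a c * e i)) (a0 : K) (ha0 : c.eval a0 ≠ 0) :
    ∃ b : ι → K, (∀ i, e i = a → b i = a0) ∧ ∀ G : MvPolynomial ι k,
      eval₂ (σ : k →+* N) (fun i => τ (e i)) G = 0 → eval (fun i => algebraMap K k (b i)) G = 0 := by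
  obtain ⟨B, hB, hJ⟩ := exists_valuationSubring_of_forall_ne_one
    (Polynomial.eval₂RingHom (σ : k →+* N) (τ a))
    (Ideal.span {Polynomial.X - Polynomial.C (algebraMap K k a0)}) (fun j hj h1 => by
      have h2 : j - 1 = 0 := ha _ (by
        rw [Polynomial.eval₂_sub, Polynomial.eval₂_one, sub_eq_zero]; exact h1)
      rw [sub_eq_zero] at h2
      subst h2
      rw [Ideal.mem_span_singleton, Polynomial.dvd_iff_isRoot] at hj
      simp at hj)
  have hσ : ∀ r, σ r ∈ B := fun r => by simpa using hB (Polynomial.C r)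
  have hτa : τ a ∈ B := by simpa using hB Polynomial.X
  let σ' : k →+* B := (σ : k →+* N).codRestrict B.toSubring hσ
  let res := IsLocalRing.residue B
  let ρ : k →+* IsLocalRing.ResidueField B := res.comp σ'
  have hpoly : ∀ p : Polynomial K, τ (Polynomial.aeval a p) = Polynomial.eval₂
      ((σ : k →+* N).comp (algebraMap K k)) (τ a) p := by
    intro p
    rw [← AlgHom.comp_apply]
    have h1 : (τ.comp (Polynomial.aeval a)).toRingHom =
        Polynomial.eval₂RingHom ((σ : k →+* N).comp (algebraMap K k)) (τ a) := by
      apply Polynomial.ringHom_ext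
      · intro r; simp
      · simp
    exact congrArg (· p) (congrArg DFunLike.coe h1)
  let A' : B := ⟨τ a, hτa⟩
  have hresA : res A' = ρ (algebraMap K k a0) := by
    have h1 : τ a - σ (algebraMap K k a0) ∈ B.nonunits := by
      simpa using hJ _ (Ideal.mem_span_singleton_self _)
    have h2 : A' - σ' (algebraMap K k a0) ∈ IsLocalRing.maximalIdeal B :=
      ValuationSubring.coe_mem_nonunits_iff.1 h1
    have h3 := (IsLocalRing.residue_eq_zero_iff _).2 h2
    rw [map_sub, sub_eq_zero] at h3
    exact h3
  have hpolyB : ∀ p : Polynomial K, ((Polynomial.eval₂ (σ'.comp (algebraMap K k)) A' p : B) : N) =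
      τ (Polynomial.aeval a p) := by
    intro p
    rw [hpoly, ← ValuationSubring.subtype_apply, Polynomial.hom_eval₂]
    rfl
  have hpolyres : ∀ p : Polynomial K, res (Polynomial.eval₂ (σ'.comp (algebraMap K k)) A' p) =
      ρ (algebraMap K k (p.eval a0)) := by
    intro p
    rw [Polynomial.hom_eval₂, hresA, ← RingHom.comp_assoc]
    change Polynomial.eval₂ (ρ.comp (algebraMap K k)) ((ρ.comp (algebraMap K k)) a0) p = _
    rw [Polynomial.eval₂_at_apply]
    rfl
  have hex : ∀ i, ∃ (y : B) (r : K), (y : N) = τ (e i) ∧ res y = ρ (algebraMap K k r) := by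
    intro i
    obtain ⟨p, hp, hp0⟩ := hc i
    have h0 : (p.map (Polynomial.eval₂RingHom (σ'.comp (algebraMap K k)) A')).eval₂ B.subtype
        (τ (Polynomial.aeval a c * e i)) = 0 := by
      have := congrArg τ hp0
      rw [map_zero] at this
      rw [← this, Polynomial.eval₂_map]
      change _ = (τ : k →+* N) _
      rw [Polynomial.hom_eval₂]
      congr 1
      apply RingHom.ext
      intro q
      exact hpolyB q
    have hmem : ∃ w : B, (w : N) = τ (Polynomial.aeval a c * e i) := by
      have : IsIntegral B (τ (Polynomial.aeval a c * e i)) := ⟨_, hp.map _, h0⟩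
      exact IsIntegrallyClosed.isIntegral_iff.1 this
    obtain ⟨w, hw⟩ := hmem
    let C' : B := Polynomial.eval₂ (σ'.comp (algebraMap K k)) A' c
    have hC' : IsUnit C' := by
      by_contra h
      have h1 := (IsLocalRing.residue_eq_zero_iff _).2 h
      have h2 := hpolyres c
      rw [show res (Polynomial.eval₂ (σ'.comp (algebraMap K k)) A' c) = 0 from h1] at h2
      exact ha0 ((map_eq_zero _).1 ((map_eq_zero _).1 h2.symm))
    obtain ⟨u, hu⟩ := hC'
    have hwr : ∃ r, (ρ.comp (algebraMap K k)) r = res w := by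
      refine exists_eq_of_monic_eval₂_eq_zero _ (hp.map (Polynomial.evalRingHom a0)) ?_
      have h3 : (p.map (Polynomial.eval₂RingHom (σ'.comp (algebraMap K k)) A')).eval w = 0 := by
        apply Subtype.val_injective
        rw [← hw] at h0
        have h4 := Polynomial.hom_eval₂ (p.map (Polynomial.eval₂RingHom
          (σ'.comp (algebraMap K k)) A')) (RingHom.id B) B.subtype w
        rw [RingHom.comp_id] at h4
        exact h4.trans h0
      have h4 := congrArg res h3
      rw [map_zero, Polynomial.eval_map, Polynomial.hom_eval₂] at h4
      rw [Polynomial.eval₂_map, ← h4]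
      congr 1
      apply RingHom.ext
      intro q
      exact (hpolyres q).symm
    obtain ⟨r, hr⟩ := hwr
    refine ⟨↑u⁻¹ * w, (c.eval a0)⁻¹ * r, ?_, ?_⟩
    · have h1 : (u : B) * (↑u⁻¹ * w) = w := u.mul_inv_cancel_left w
      have h2 := congrArg Subtype.val h1
      rw [hw, map_mul, ← hpolyB c, hu] at h2
      have h3 : ((C' : B) : N) ≠ 0 := by
        rw [← hu]
        exact_mod_cast u.ne_zero
      exact mul_left_cancel₀ h3 h2
    · have h1 : (u : B) * (↑u⁻¹ * w) = w := u.mul_inv_cancel_left w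
      have h2 := congrArg res h1
      have h4 : res u = ρ (algebraMap K k (c.eval a0)) := by rw [hu]; exact hpolyres c
      rw [map_mul, ← hr, h4] at h2
      have h3 : ρ (algebraMap K k (c.eval a0)) ≠ 0 := by simpa using ha0
      apply mul_left_cancel₀ h3
      rw [h2, ← map_mul, ← map_mul, mul_inv_cancel_left₀ ha0]
      rfl
  choose y b hy hb using hex
  refine ⟨b, fun i hi => ?_, fun G hG => ?_⟩
  · have h1 : y i = A' := Subtype.val_injective (by rw [hy i, hi])
    have h2 := hb i
    rw [h1, hresA] at h2
    exact ((algebraMap K k).injective (ρ.injective h2)).symm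
  · have h1 : eval₂ σ' y G = 0 := by
      apply Subtype.val_injective
      have h2 := hom_eval₂ G σ' B.subtype y
      have h3 : (fun i => B.subtype (y i)) = fun i => τ (e i) := funext hy
      rw [h3] at h2
      exact h2.trans hG
    have h2 := congrArg res h1
    rw [hom_eval₂, map_zero] at h2
    apply ρ.injective
    rw [map_zero, ← h2]
    have h3 : (fun i => res (y i)) = fun i => ρ (algebraMap K k (b i)) := funext hb
    rw [h3]
    have := hom_eval₂ G (RingHom.id k) ρ (fun i => algebraMap K k (b i))
    rw [RingHom.comp_id] at this
    exact this

theorem exists_algHom_apply_ne {L M : Type} [Field L] [Field M] [Algebra L M]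
    [Algebra.IsSeparable L M] {y : M} (hy : y ∉ (algebraMap L M).range) :
    ∃ σ : M →ₐ[L] AlgebraicClosure M, σ y ≠ algebraMap M (AlgebraicClosure M) y := by
  have hsep := Algebra.IsSeparable.isSeparable L y
  have hint := hsep.isIntegral
  have hspl : ((minpoly L y).map (algebraMap L (AlgebraicClosure M))).Splits :=
    IsAlgClosed.splits _
  have hcard := Polynomial.card_rootSet_eq_natDegree (K := AlgebraicClosure M) hsep hspl
  have hdeg := (minpoly.two_le_natDegree_iff hint).2 hy
  have hroot : algebraMap M (AlgebraicClosure M) y ∈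
      (minpoly L y).rootSet (AlgebraicClosure M) := by
    rw [Polynomial.mem_rootSet]
    exact ⟨minpoly.ne_zero hint, by
      rw [Polynomial.aeval_algebraMap_apply, minpoly.aeval, map_zero]⟩
  obtain ⟨⟨r, hr⟩, hne⟩ := Fintype.exists_ne_of_one_lt_card (by rw [hcard]; lia)
    (⟨_, hroot⟩ : (minpoly L y).rootSet (AlgebraicClosure M))
  obtain ⟨σ, hσ⟩ := IntermediateField.exists_algHom_of_splits_of_aeval (F := L) (E := M)
    (K := AlgebraicClosure M) (fun s => ⟨(Algebra.IsSeparable.isSeparable L s).isIntegral,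
      IsAlgClosed.splits _⟩) (x := y) (y := r) (Polynomial.mem_rootSet.1 hr).2
  exact ⟨σ, fun h => hne (Subtype.ext (hσ.symm.trans h))⟩

theorem eval₂_injective_of_relation {k N : Type} [Field k] [Field N] (s : k →+* N) {x : N}
    (hx : ∀ P : Polynomial k, P.eval₂ s x = 0 → P = 0) {a g : N} {a' g' : k}
    (hrel : a + x * g = s a' + x * s g') (hg : s g' ≠ g) :
    (∀ P : Polynomial k, P.eval₂ s a = 0 → P = 0) ∨
      (∀ P : Polynomial k, P.eval₂ s g = 0 → P = 0) := by
  by_contra! hcon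
  obtain ⟨⟨P, hP, hP0⟩, ⟨Q, hQ, hQ0⟩⟩ := hcon
  letI := s.toAlgebra
  have h1 : IsAlgebraic k a := ⟨P, hP0, hP⟩
  have h2 : IsAlgebraic k g := ⟨Q, hQ0, hQ⟩
  have h3 : ∀ r, IsAlgebraic k (s r) := fun r => isAlgebraic_algebraMap r
  have h4 : x = (a - s a') * (s g' - g)⁻¹ := by
    rw [eq_mul_inv_iff_mul_eq₀ (sub_ne_zero.2 hg)]
    linear_combination -hrel
  have h5 : IsAlgebraic k x := by
    rw [h4]
    exact (h1.sub (h3 a')).mul ((h3 g').sub h2).inv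
  obtain ⟨R, hR0, hR⟩ := h5
  exact hR0 (hx R hR)

namespace IsRuledModel

variable {f : MvPolynomial (Fin 3) K} {k M : Type} [Field k] [Field M] [Algebra K k]
    [Algebra K M] [Algebra k M] [IsScalarTower K k M] {x : M} {α β γ δ : k}

/-- If the generic ruling is not a function of the generic point, then it meets three distinct
constant lines. -/
theorem exists_three_lines [IsAlgClosed K] (h : IsRuledModel f x α β γ δ)
    (hf : f ≠ 0) (hf0 : eval 0 f = 0)
    (hdir : ¬ ∃ w : Fin 3 → K, w ≠ 0 ∧ w 0 = 0 ∧ ∀ s : K, eval (s • w) f = 0)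
    (htop : coordField K x α β γ δ ≠ ⊤) :
    ∃ b : Fin 3 → Fin 4 → K, Function.Injective b ∧ ∀ j,
      (algebraMap K k (b j 0) - α) * (algebraMap K k (b j 3) - δ) =
        (algebraMap K k (b j 1) - β) * (algebraMap K k (b j 2) - γ) := by
  have hsep := h.isSeparable hf hf0 hdir
  let L := coordField K x α β γ δ
  let ι := algebraMap M (AlgebraicClosure M)
  have hσ : ∃ σ : M →ₐ[L] AlgebraicClosure M, σ (algebraMap k M γ) ≠ ι (algebraMap k M γ) ∨
      σ (algebraMap k M δ) ≠ ι (algebraMap k M δ) := by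
    by_cases hγ : algebraMap k M γ ∈ L
    · by_cases hδ : algebraMap k M δ ∈ L
      · exact absurd (h.eq_top_of_slopes_mem L le_rfl hγ hδ) htop
      · obtain ⟨σ, hσ⟩ := exists_algHom_apply_ne (L := L) (y := algebraMap k M δ) (by
          rintro ⟨y, hy⟩
          exact hδ (hy ▸ y.2))
        exact ⟨σ, Or.inr hσ⟩
    · obtain ⟨σ, hσ⟩ := exists_algHom_apply_ne (L := L) (y := algebraMap k M γ) (by
          rintro ⟨y, hy⟩
          exact hγ (hy ▸ y.2))
      exact ⟨σ, Or.inl hσ⟩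
  obtain ⟨σ, hσ⟩ := hσ
  have hfix : ∀ y ∈ L, σ y = ι y := fun y hy => σ.commutes ⟨y, hy⟩
  let σK : M →ₐ[K] AlgebraicClosure M := σ.restrictScalars K
  let σ' : k →ₐ[K] AlgebraicClosure M := σK.comp (IsScalarTower.toAlgHom K k M)
  let τ : k →ₐ[K] AlgebraicClosure M :=
    (IsScalarTower.toAlgHom K M (AlgebraicClosure M)).comp (IsScalarTower.toAlgHom K k M)
  have hx0 : σ x = ι x := hfix x (genPt_mem x α β γ δ 0)
  have hx : ∀ P : Polynomial k, P.eval₂ (σ' : k →+* AlgebraicClosure M) (ι x) = 0 → P = 0 := by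
    intro P hP
    have h1 := Polynomial.hom_eval₂ P (algebraMap k M) (σ : M →+* AlgebraicClosure M) x
    have h2 : (σ : M →+* AlgebraicClosure M) x = ι x := hx0
    rw [h2] at h1
    exact transcendental_iff.1 h.transcendental P
      ((map_eq_zero (σ : M →+* AlgebraicClosure M)).1 (h1.trans hP))
  have hr1 : τ α + ι x * τ γ = σ' α + ι x * σ' γ := by
    have h1 := hfix _ (genPt_mem x α β γ δ 1)
    simp only [genPt, linePt, Matrix.cons_val_one, Matrix.cons_val_zero, map_add, map_mul,
      hx0] at h1
    exact h1.symm
  have hr2 : τ β + ι x * τ δ = σ' β + ι x * σ' δ := by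
    have h1 := hfix _ (genPt_mem x α β γ δ 2)
    simp only [genPt, linePt, Matrix.cons_val, map_add, map_mul, hx0] at h1
    exact h1.symm
  let e : Fin 4 → k := ![α, β, γ, δ]
  have hi : ∃ i, ∀ P : Polynomial k,
      P.eval₂ (σ' : k →+* AlgebraicClosure M) (τ (e i)) = 0 → P = 0 := by
    rcases hσ with hσ | hσ
    · rcases eval₂_injective_of_relation (σ' : k →+* AlgebraicClosure M) hx hr1 hσ with h1 | h1
      · exact ⟨0, h1⟩
      · exact ⟨2, h1⟩
    · rcases eval₂_injective_of_relation (σ' : k →+* AlgebraicClosure M) hx hr2 hσ with h1 | h1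
      · exact ⟨1, h1⟩
      · exact ⟨3, h1⟩
  obtain ⟨i, hi⟩ := hi
  have htr : Transcendental K (e i) := by
    rw [transcendental_iff]
    intro p hp
    have h1 : (p.map (algebraMap K k)) = 0 := by
      apply hi
      rw [Polynomial.eval₂_map, AlgHom.comp_algebraMap, ← AlgHom.comp_algebraMap τ,
        ← AlgHom.coe_toRingHom τ, ← Polynomial.hom_eval₂]
      change τ (Polynomial.aeval (e i) p) = 0
      rw [hp, map_zero]
    exact (Polynomial.map_eq_zero _).1 h1
  choose c hc hcint using fun j => exists_isIntegralElem_of_not_algebraicIndependent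
    (h.not_algebraicIndependent hf hf0 hdir (e j) (e i)) htr
  have hprod : ∀ j, (Polynomial.aeval (R := K) (e i)).toRingHom.IsIntegralElem
      (Polynomial.aeval (e i) (∏ j, c j) * e j) := by
    intro j
    rw [← Finset.prod_erase_mul _ _ (Finset.mem_univ j), map_mul, mul_assoc]
    exact RingHom.IsIntegralElem.mul _ (RingHom.isIntegralElem_map _) (hcint j)
  have hprod0 : ∏ j, c j ≠ 0 := Finset.prod_ne_zero_iff.2 fun j _ => hc j
  have hsp := fun a0 ha0 => exists_specialization τ σ' (e i) hi e _ hprod a0 ha0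
  have hinf : {a0 : K | (∏ j, c j).eval a0 ≠ 0}.Infinite := by
    have h1 : {a0 : K | (∏ j, c j).eval a0 = 0}.Finite :=
      Polynomial.finite_setOf_isRoot hprod0
    exact h1.infinite_compl
  obtain ⟨emb⟩ : Nonempty (Fin 3 ↪ {a0 : K | (∏ j, c j).eval a0 ≠ 0}) := by
    have := hinf.to_subtype
    exact ⟨(Fin.valEmbedding).trans (Infinite.natEmbedding _)⟩
  choose b hb1 hb2 using fun j => hsp (emb j).1 (emb j).2
  refine ⟨b, fun j l hjl => emb.injective (Subtype.ext ?_), fun j => ?_⟩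
  · rw [← hb1 j i rfl, ← hb1 l i rfl, hjl]
  · have h1 := hb2 j ((X 0 - C α) * (X 3 - C δ) - (X 1 - C β) * (X 2 - C γ)) (by
      simp only [eval₂_sub, eval₂_mul, eval₂_X, eval₂_C]
      change (τ α - σ' α) * (τ δ - σ' δ) - (τ β - σ' β) * (τ γ - σ' γ) = 0
      linear_combination (τ δ - σ' δ) * hr1 - (τ γ - σ' γ) * hr2)
    simpa [sub_eq_zero] using h1

end IsRuledModel

theorem rank_one_rows {M : Type*} [Field M] {x a b c d u₁ u₂ v₁ v₂ : M} (hdet : a * d = b * c)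
    (hmix : a * v₂ - b * v₁ + u₁ * d - u₂ * c = 0) (huv : u₁ * v₂ = u₂ * v₁) (ha : a ≠ 0)
    (hne : a * (u₂ + x * v₂) - b * (u₁ + x * v₁) ≠ 0) : u₁ * c = v₁ * a ∧ u₂ * c = v₂ * a := by
  have hPR : a * (a * v₂ - b * v₁) = c * (a * u₂ - b * u₁) := by
    linear_combination a * hmix - u₁ * hdet
  have hP : a * u₂ - b * u₁ ≠ 0 := by
    intro hP
    rw [hP, mul_zero] at hPR
    have hR := (mul_eq_zero.1 hPR).resolve_left ha
    exact hne (by linear_combination hP + x * hR)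
  constructor
  · apply mul_left_cancel₀ hP
    linear_combination -u₁ * hPR + a * a * huv
  · apply mul_left_cancel₀ hP
    linear_combination -u₂ * hPR + a * b * huv

theorem rank_one_column {M : Type*} [Field M] {x c d u₁ u₂ v₁ v₂ : M}
    (hmix : u₁ * d - u₂ * c = 0) (huv : u₁ * v₂ = u₂ * v₁)
    (hne : c * (u₂ + x * v₂) - d * (u₁ + x * v₁) ≠ 0) : u₁ = 0 ∧ u₂ = 0 := by
  have hne' : c * v₂ - d * v₁ ≠ 0 := fun h0 => hne (by linear_combination x * h0 - hmix)
  constructor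
  · refine (mul_eq_zero.1 ?_).resolve_right hne'
    linear_combination c * huv - v₁ * hmix
  · refine (mul_eq_zero.1 ?_).resolve_right hne'
    linear_combination d * huv - v₂ * hmix

namespace IsRuledModel

variable {f : MvPolynomial (Fin 3) K} {k M : Type} [Field k] [Field M] [Algebra K k]
    [Algebra K M] [Algebra k M] [IsScalarTower K k M] {x : M} {α β γ δ : k}

local notation "κ" => algebraMap K M
local notation "ι" => algebraMap k M

theorem eq_zero_of_totalDegree_le (h : IsRuledModel f x α β γ δ)
    (hdeg : ∀ Q : MvPolynomial (Fin 3) K, Q.totalDegree ≤ 2 → f ∣ Q → Q = 0)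
    {Q : MvPolynomial (Fin 3) K} (hQ : Q.totalDegree ≤ 2)
    (h0 : aeval (genPt x α β γ δ) Q = 0) (p : Fin 3 → K) : eval p Q = 0 := by
  rw [hdeg Q hQ ((h.aeval_eq_zero_iff Q).1 h0), map_zero]

theorem linear_ne_zero (h : IsRuledModel f x α β γ δ)
    (hdeg : ∀ Q : MvPolynomial (Fin 3) K, Q.totalDegree ≤ 2 → f ∣ Q → Q = 0)
    (b : Fin 4 → K) {A B : K} (hAB : A ≠ 0 ∨ B ≠ 0) :
    κ A * ((ι β - κ (b 1)) + x * (ι δ - κ (b 3))) -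
      κ B * ((ι α - κ (b 0)) + x * (ι γ - κ (b 2))) ≠ 0 := by
  intro h0
  let Q : MvPolynomial (Fin 3) K := C A * (X 2 - (C (b 1) + C (b 3) * X 0)) -
    C B * (X 1 - (C (b 0) + C (b 2) * X 0))
  have hQ : Q.totalDegree ≤ 2 := by
    have hl : ∀ (a c : K) (i : Fin 3),
        (X i - (C a + C c * X 0) : MvPolynomial (Fin 3) K).totalDegree ≤ 1 := by
      intro a c i
      refine (totalDegree_sub _ _).trans (max_le (totalDegree_X _).le
        ((totalDegree_add _ _).trans (max_le (by simp) ((totalDegree_mul _ _).trans ?_))))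
      rw [totalDegree_C, totalDegree_X]
    refine (totalDegree_sub _ _).trans (max_le ((totalDegree_mul _ _).trans ?_)
      ((totalDegree_mul _ _).trans ?_)) <;> rw [totalDegree_C] <;>
      linarith [hl (b 1) (b 3) 2, hl (b 0) (b 2) 1]
  have hQ0 := h.eq_zero_of_totalDegree_le hdeg hQ (by
    rw [← h0]
    simp only [Q, genPt, linePt, map_sub, map_mul, map_add, aeval_X, aeval_C, Matrix.cons_val]
    ring)
  have h1 := hQ0 ![0, b 0, b 1 + 1]
  have h2 := hQ0 ![0, b 0 + 1, b 1]
  simp [Q] at h1 h2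
  rcases hAB with hA | hB
  · exact hA h1
  · exact hB h2

theorem exists_ratio (h : IsRuledModel f x α β γ δ)
    (hdeg : ∀ Q : MvPolynomial (Fin 3) K, Q.totalDegree ≤ 2 → f ∣ Q → Q = 0)
    (b c : Fin 4 → K) (hbc : b ≠ c)
    (hb : (κ (b 0) - ι α) * (κ (b 3) - ι δ) = (κ (b 1) - ι β) * (κ (b 2) - ι γ))
    (hc : (κ (c 0) - ι α) * (κ (c 3) - ι δ) = (κ (c 1) - ι β) * (κ (c 2) - ι γ))
    (hdet : (c 0 - b 0) * (c 3 - b 3) = (c 1 - b 1) * (c 2 - b 2)) :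
    ∃ l m : K, (l ≠ 0 ∨ m ≠ 0) ∧
      (ι α - κ (b 0)) * κ m = (ι γ - κ (b 2)) * κ l ∧
      (ι β - κ (b 1)) * κ m = (ι δ - κ (b 3)) * κ l := by
  have hdet' : (κ (c 0) - κ (b 0)) * (κ (c 3) - κ (b 3)) =
      (κ (c 1) - κ (b 1)) * (κ (c 2) - κ (b 2)) := by
    simpa using congrArg κ hdet
  have hmix : (κ (c 0) - κ (b 0)) * (ι δ - κ (b 3)) - (κ (c 1) - κ (b 1)) * (ι γ - κ (b 2)) +
      (ι α - κ (b 0)) * (κ (c 3) - κ (b 3)) - (ι β - κ (b 1)) * (κ (c 2) - κ (b 2)) = 0 := by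
    linear_combination hdet' + hb - hc
  have huv : (ι α - κ (b 0)) * (ι δ - κ (b 3)) = (ι β - κ (b 1)) * (ι γ - κ (b 2)) := by
    linear_combination hb
  have hκ : ∀ {y : K}, y ≠ 0 → κ y ≠ 0 := fun hy => by simpa using hy
  simp only [← map_sub κ] at hdet' hmix
  by_cases ha : c 0 - b 0 = 0
  · by_cases hb' : c 1 - b 1 = 0
    · refine ⟨0, 1, Or.inr one_ne_zero, ?_⟩
      have hne := h.linear_ne_zero hdeg b (A := c 2 - b 2) (B := c 3 - b 3) (by
        by_contra! hcon
        apply hbc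
        rw [sub_eq_zero] at ha hb'
        have h2 := sub_eq_zero.1 hcon.1
        have h3 := sub_eq_zero.1 hcon.2
        funext i
        fin_cases i
        exacts [ha.symm, hb'.symm, h2.symm, h3.symm])
      rw [ha, hb', map_zero] at hmix
      replace hmix : (ι α - κ (b 0)) * κ (c 3 - b 3) - (ι β - κ (b 1)) * κ (c 2 - b 2) = 0 := by
        linear_combination hmix
      obtain ⟨h1, h2⟩ := rank_one_column hmix huv hne
      rw [h1, h2, map_zero, map_one]
      simp
    · have hne := h.linear_ne_zero hdeg b (A := c 0 - b 0) (B := c 1 - b 1) (Or.inr hb')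
      have := rank_one_rows (x := x) (b := κ (c 0 - b 0)) (c := κ (c 3 - b 3)) hdet'.symm
        (by linear_combination -hmix) huv.symm (hκ hb')
        (fun h0 => hne (by linear_combination -h0))
      exact ⟨c 1 - b 1, c 3 - b 3, Or.inl hb', this.2, this.1⟩
  · have hne := h.linear_ne_zero hdeg b (A := c 0 - b 0) (B := c 1 - b 1) (Or.inl ha)
    exact ⟨c 0 - b 0, c 2 - b 2, Or.inl ha, rank_one_rows hdet' hmix huv (hκ ha) hne⟩

/-- The generic ruling cannot meet two intersecting constant lines. -/
theorem false_of_two_lines (h : IsRuledModel f x α β γ δ)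
    (hdeg : ∀ Q : MvPolynomial (Fin 3) K, Q.totalDegree ≤ 2 → f ∣ Q → Q = 0)
    (hva : ¬ ∃ q : Fin 3 → K, ∀ s : K, f ∣ bind₁ (fun i => X i + C s * (C (q i) - X i)) f)
    (hvb : ¬ ∃ q : Fin 3 → K, q ≠ 0 ∧ ∀ s : K, f ∣ bind₁ (fun i => X i + C (s * q i)) f)
    (b c : Fin 4 → K) (hbc : b ≠ c)
    (hb : (κ (b 0) - ι α) * (κ (b 3) - ι δ) = (κ (b 1) - ι β) * (κ (b 2) - ι γ))
    (hc : (κ (c 0) - ι α) * (κ (c 3) - ι δ) = (κ (c 1) - ι β) * (κ (c 2) - ι γ))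
    (hdet : (c 0 - b 0) * (c 3 - b 3) = (c 1 - b 1) * (c 2 - b 2)) : False := by
  obtain ⟨l, m, hlm, h1, h2⟩ := h.exists_ratio hdeg b c hbc hb hc hdet
  by_cases hm : m = 0
  · have hl : l ≠ 0 := hlm.resolve_right (not_not.2 hm)
    have hl' : κ l ≠ 0 := by simpa using hl
    rw [hm, map_zero, mul_zero] at h1 h2
    have hγ : ι γ = κ (b 2) := sub_eq_zero.1 ((mul_eq_zero.1 h1.symm).resolve_right hl')
    have hδ : ι δ = κ (b 3) := sub_eq_zero.1 ((mul_eq_zero.1 h2.symm).resolve_right hl')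
    refine hvb ⟨![1, b 2, b 3], fun h0 => one_ne_zero (congrFun h0 0), fun s => ?_⟩
    rw [← h.aeval_eq_zero_iff, aeval_bind₁, ← h.aeval_linePt_eq_zero (x + κ s)]
    congr 1
    congr 1
    funext i
    fin_cases i <;> simp [linePt, hγ, hδ] <;> ring
  · have hm' : κ m ≠ 0 := by simpa using hm
    refine hva ⟨![-l / m, b 0 - l / m * b 2, b 1 - l / m * b 3], fun s => ?_⟩
    rw [← h.aeval_eq_zero_iff, aeval_bind₁, ← h.aeval_linePt_eq_zero (x + κ s * (κ (-l / m) - x))]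
    congr 1
    congr 1
    funext i
    fin_cases i
    · simp [linePt]
    · simp [linePt]
      field_simp
      linear_combination (-κ s) * h1
    · simp [linePt]
      field_simp
      linear_combination (-κ s) * h2

end IsRuledModel

theorem ruling_mul_eq {M : Type*} [Field M] {x u₁ u₂ v₁ v₂ a b c d : M}
    (huv : u₁ * v₂ = u₂ * v₁)
    (hmix : a * v₂ - b * v₁ + u₁ * d - u₂ * c = a * d - b * c) :
    v₁ * (a * (u₂ + x * v₂) - b * (u₁ + x * v₁) - x * (a * d - b * c)) =
      u₁ * (c * (u₂ + x * v₂) - d * (u₁ + x * v₁) + (a * d - b * c)) ∧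
    v₂ * (a * (u₂ + x * v₂) - b * (u₁ + x * v₁) - x * (a * d - b * c)) =
      u₂ * (c * (u₂ + x * v₂) - d * (u₁ + x * v₁) + (a * d - b * c)) := by
  constructor
  · linear_combination (u₁ + x * v₁) * hmix - (a + x * c) * huv
  · linear_combination (u₂ + x * v₂) * hmix - (b + x * d) * huv

theorem eq_of_forall_quadric_eq_zero [Infinite K] {a b c d a' b' c' d' : K}
    (hD : a * d - b * c ≠ 0) (hD' : a' * d' - b' * c' ≠ 0)
    (h : ∀ z y₁ y₂ : K, (a * y₂ - b * y₁ - z * (a * d - b * c)) *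
        (c' * y₂ - d' * y₁ + (a' * d' - b' * c')) -
      (a' * y₂ - b' * y₁ - z * (a' * d' - b' * c')) *
        (c * y₂ - d * y₁ + (a * d - b * c)) = 0) :
    a = a' ∧ b = b' ∧ c = c' ∧ d = d' := by
  classical
  obtain ⟨t, ht⟩ := Infinite.exists_notMem_finset ({0, 1} : Finset K)
  have ht0 : t ≠ 0 := fun h => ht (by simp [h])
  have ht1 : t - 1 ≠ 0 := fun h => ht (by simp [sub_eq_zero.1 h])
  set D := a * d - b * c with hDdef
  set D' := a' * d' - b' * c' with hDdef'
  have hlin : ∀ y₁ y₂ : K, D' * (a * y₂ - b * y₁) - D * (a' * y₂ - b' * y₁) = 0 := by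
    intro y₁ y₂
    have h1 := h 0 y₁ y₂
    have h2 := h 0 (t * y₁) (t * y₂)
    apply (mul_eq_zero.1 (_ : t * (t - 1) * _ = 0)).resolve_left (mul_ne_zero ht0 ht1)
    linear_combination t ^ 2 * h1 - h2
  have hlin' : ∀ y₁ y₂ : K, D' * (c * y₂ - d * y₁) - D * (c' * y₂ - d' * y₁) = 0 := by
    intro y₁ y₂
    linear_combination h 1 y₁ y₂ - h 0 y₁ y₂
  have ha : D' * a = D * a' := by linear_combination hlin 0 1
  have hb : D' * b = D * b' := by linear_combination -hlin 1 0
  have hc : D' * c = D * c' := by linear_combination hlin' 0 1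
  have hd : D' * d = D * d' := by linear_combination -hlin' 1 0
  have hDD : D' = D := by
    apply mul_left_cancel₀ (mul_ne_zero hD hD')
    linear_combination -D' * D' * hDdef + D * D * hDdef' + D' * d * ha + D * a' * hd -
      D' * c * hb - D * b' * hc
  rw [hDD] at ha hb hc hd
  exact ⟨mul_left_cancel₀ hD ha, mul_left_cancel₀ hD hb, mul_left_cancel₀ hD hc,
    mul_left_cancel₀ hD hd⟩

theorem totalDegree_quadric_le (l₁ l₂ l₃ l₄ : MvPolynomial (Fin 3) K)
    (h₁ : l₁.totalDegree ≤ 1) (h₂ : l₂.totalDegree ≤ 1) (h₃ : l₃.totalDegree ≤ 1)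
    (h₄ : l₄.totalDegree ≤ 1) : (l₁ * l₂ - l₃ * l₄).totalDegree ≤ 2 := by
  refine (totalDegree_sub _ _).trans (max_le ((totalDegree_mul _ _).trans ?_)
    ((totalDegree_mul _ _).trans ?_)) <;> lia

namespace IsRuledModel

section

variable {f : MvPolynomial (Fin 3) K} {k M : Type} [Field k] [Field M] [Algebra K k]
    [Algebra K M] [Algebra k M] [IsScalarTower K k M] {x : M} {α β γ δ : k}

local notation "κ" => algebraMap K M
local notation "ι" => algebraMap k M

theorem eq_of_three_lines [Infinite K] (h : IsRuledModel f x α β γ δ)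
    (hdeg : ∀ Q : MvPolynomial (Fin 3) K, Q.totalDegree ≤ 2 → f ∣ Q → Q = 0)
    (b c c' : Fin 4 → K)
    (hb : (κ (b 0) - ι α) * (κ (b 3) - ι δ) = (κ (b 1) - ι β) * (κ (b 2) - ι γ))
    (hc : (κ (c 0) - ι α) * (κ (c 3) - ι δ) = (κ (c 1) - ι β) * (κ (c 2) - ι γ))
    (hc' : (κ (c' 0) - ι α) * (κ (c' 3) - ι δ) = (κ (c' 1) - ι β) * (κ (c' 2) - ι γ))
    (hdet : (c 0 - b 0) * (c 3 - b 3) - (c 1 - b 1) * (c 2 - b 2) ≠ 0)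
    (hdet' : (c' 0 - b 0) * (c' 3 - b 3) - (c' 1 - b 1) * (c' 2 - b 2) ≠ 0) : c = c' := by
  let y₁ : MvPolynomial (Fin 3) K := X 1 - (C (b 0) + C (b 2) * X 0)
  let y₂ : MvPolynomial (Fin 3) K := X 2 - (C (b 1) + C (b 3) * X 0)
  have hl : ∀ (a c : K) (i : Fin 3),
      (X i - (C a + C c * X 0) : MvPolynomial (Fin 3) K).totalDegree ≤ 1 := by
    intro a c i
    refine (totalDegree_sub _ _).trans (max_le (totalDegree_X _).le
      ((totalDegree_add _ _).trans (max_le (by simp) ((totalDegree_mul _ _).trans ?_))))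
    rw [totalDegree_C, totalDegree_X]
  have hsm : ∀ (a : K) (p : MvPolynomial (Fin 3) K), p.totalDegree ≤ 1 →
      (C a * p).totalDegree ≤ 1 := by
    intro a p hp
    refine (totalDegree_mul _ _).trans ?_
    rw [totalDegree_C]
    lia
  have hlc : ∀ a b : K, (C a * y₂ - C b * y₁).totalDegree ≤ 1 := fun a b =>
    (totalDegree_sub _ _).trans (max_le (hsm _ _ (hl _ _ _)) (hsm _ _ (hl _ _ _)))
  have hE : ∀ a b e : K, (C a * y₂ - C b * y₁ - C e * X 0).totalDegree ≤ 1 := fun a b e =>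
    (totalDegree_sub _ _).trans (max_le (hlc a b) (hsm _ _ (totalDegree_X _).le))
  have hF : ∀ a b e : K, (C a * y₂ - C b * y₁ + C e).totalDegree ≤ 1 := fun a b e =>
    (totalDegree_add _ _).trans (max_le (hlc a b) (by simp))
  let D := (c 0 - b 0) * (c 3 - b 3) - (c 1 - b 1) * (c 2 - b 2)
  let D' := (c' 0 - b 0) * (c' 3 - b 3) - (c' 1 - b 1) * (c' 2 - b 2)
  have hQ := h.eq_zero_of_totalDegree_le hdeg (totalDegree_quadric_le _ _ _ _
    (hE (c 0 - b 0) (c 1 - b 1) D) (hF (c' 2 - b 2) (c' 3 - b 3) D')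
    (hE (c' 0 - b 0) (c' 1 - b 1) D') (hF (c 2 - b 2) (c 3 - b 3) D)) (by
      have huv : (ι α - κ (b 0)) * (ι δ - κ (b 3)) = (ι β - κ (b 1)) * (ι γ - κ (b 2)) := by
        linear_combination hb
      obtain ⟨h1, h2⟩ := ruling_mul_eq (x := x) huv (a := κ (c 0) - κ (b 0))
        (b := κ (c 1) - κ (b 1)) (c := κ (c 2) - κ (b 2)) (d := κ (c 3) - κ (b 3))
        (by linear_combination hb - hc)
      obtain ⟨h1', h2'⟩ := ruling_mul_eq (x := x) huv (a := κ (c' 0) - κ (b 0))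
        (b := κ (c' 1) - κ (b 1)) (c := κ (c' 2) - κ (b 2)) (d := κ (c' 3) - κ (b 3))
        (by linear_combination hb - hc')
      have hY₁ : aeval (genPt x α β γ δ) y₁ = (ι α - κ (b 0)) + x * (ι γ - κ (b 2)) := by
        simp only [y₁, genPt, linePt, map_sub, map_mul, map_add, aeval_X, aeval_C,
          Matrix.cons_val]
        ring
      have hY₂ : aeval (genPt x α β γ δ) y₂ = (ι β - κ (b 1)) + x * (ι δ - κ (b 3)) := by
        simp only [y₂, genPt, linePt, map_sub, map_mul, map_add, aeval_X, aeval_C,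
          Matrix.cons_val]
        ring
      have hX : aeval (genPt x α β γ δ) (X 0 : MvPolynomial (Fin 3) K) = x := by
        simp [genPt, linePt]
      simp only [map_sub, map_mul, map_add, hY₁, hY₂, aeval_C, D, D', hX]
      generalize hu₁ : ι α - κ (b 0) = u₁ at *
      generalize hu₂ : ι β - κ (b 1) = u₂ at *
      generalize hv₁ : ι γ - κ (b 2) = v₁ at *
      generalize hv₂ : ι δ - κ (b 3) = v₂ at *
      have hne := h.linear_ne_zero hdeg b (A := 1) (B := 0) (Or.inl one_ne_zero)
      rw [map_one, map_zero, hu₂, hv₂, zero_mul, one_mul, sub_zero] at hne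
      by_cases hu : u₂ = 0
      · have hv : v₂ ≠ 0 := fun hv => hne (by rw [hu, hv]; ring)
        apply mul_left_cancel₀ hv
        rw [mul_zero]
        linear_combination ((κ (c' 2) - κ (b 2)) * (u₂ + x * v₂) - (κ (c' 3) - κ (b 3)) * (u₁ + x * v₁) +
          ((κ (c' 0) - κ (b 0)) * (κ (c' 3) - κ (b 3)) - (κ (c' 1) - κ (b 1)) *
            (κ (c' 2) - κ (b 2)))) * h2 - ((κ (c 2) - κ (b 2)) * (u₂ + x * v₂) -
          (κ (c 3) - κ (b 3)) * (u₁ + x * v₁) +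
          ((κ (c 0) - κ (b 0)) * (κ (c 3) - κ (b 3)) - (κ (c 1) - κ (b 1)) *
            (κ (c 2) - κ (b 2)))) * h2'
      · apply mul_left_cancel₀ hu
        rw [mul_zero]
        linear_combination ((κ (c' 0) - κ (b 0)) * (u₂ + x * v₂) -
          (κ (c' 1) - κ (b 1)) * (u₁ + x * v₁) -
          x * ((κ (c' 0) - κ (b 0)) * (κ (c' 3) - κ (b 3)) - (κ (c' 1) - κ (b 1)) *
            (κ (c' 2) - κ (b 2)))) * h2 - ((κ (c 0) - κ (b 0)) * (u₂ + x * v₂) -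
          (κ (c 1) - κ (b 1)) * (u₁ + x * v₁) -
          x * ((κ (c 0) - κ (b 0)) * (κ (c 3) - κ (b 3)) - (κ (c 1) - κ (b 1)) *
            (κ (c 2) - κ (b 2)))) * h2')
  obtain ⟨h0, h1, h2, h3⟩ := eq_of_forall_quadric_eq_zero hdet hdet' (fun z w₁ w₂ => by
    have := hQ ![z, w₁ + (b 0 + b 2 * z), w₂ + (b 1 + b 3 * z)]
    simp only [y₁, y₂, map_sub, map_mul, map_add, eval_X, eval_C, Matrix.cons_val,
      add_sub_cancel_right] at this
    linear_combination this)
  funext i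
  fin_cases i
  exacts [sub_left_injective h0, sub_left_injective h1, sub_left_injective h2,
    sub_left_injective h3]

/-- The generic ruling is determined by the generic point. -/
theorem coordField_eq_top [IsAlgClosed K] (h : IsRuledModel f x α β γ δ)
    (hf : f ≠ 0) (hf0 : eval 0 f = 0)
    (hdir : ¬ ∃ w : Fin 3 → K, w ≠ 0 ∧ w 0 = 0 ∧ ∀ s : K, eval (s • w) f = 0)
    (hdeg : ∀ Q : MvPolynomial (Fin 3) K, Q.totalDegree ≤ 2 → f ∣ Q → Q = 0)
    (hva : ¬ ∃ q : Fin 3 → K, ∀ s : K, f ∣ bind₁ (fun i => X i + C s * (C (q i) - X i)) f)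
    (hvb : ¬ ∃ q : Fin 3 → K, q ≠ 0 ∧ ∀ s : K, f ∣ bind₁ (fun i => X i + C (s * q i)) f) :
    coordField K x α β γ δ = ⊤ := by
  by_contra htop
  obtain ⟨b, hbinj, hb⟩ := h.exists_three_lines hf hf0 hdir htop
  have hb' : ∀ j, (κ (b j 0) - ι α) * (κ (b j 3) - ι δ) =
      (κ (b j 1) - ι β) * (κ (b j 2) - ι γ) := by
    intro j
    have := congrArg ι (hb j)
    simpa only [map_mul, map_sub, ← IsScalarTower.algebraMap_apply K k M] using this
  have hdet : ∀ j, j ≠ 0 → (b j 0 - b 0 0) * (b j 3 - b 0 3) -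
      (b j 1 - b 0 1) * (b j 2 - b 0 2) ≠ 0 := fun j hj h0 =>
    h.false_of_two_lines hdeg hva hvb (b 0) (b j) (fun h1 => hj (hbinj h1).symm) (hb' 0) (hb' j)
      (sub_eq_zero.1 h0)
  have h12 := h.eq_of_three_lines hdeg (b 0) (b 1) (b 2) (hb' 0) (hb' 1) (hb' 2)
    (hdet 1 (by decide)) (hdet 2 (by decide))
  exact absurd (hbinj h12) (by decide)

end

end IsRuledModel

/-! ### Conductors of hypersurfaces -/

/-- If `t` generates the field `M` over an integrally closed domain `R`, with minimal polynomial
`p`, then `p'(t)` multiplies integral elements of `M` into `R[t]`. -/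
theorem aeval_derivative_mul_mem_adjoin {R M : Type*} [CommRing R] [IsDomain R]
    [IsIntegrallyClosed R] [Field M] [Algebra R M] [FaithfulSMul R M] {t y : M}
    {p : Polynomial R} (hp : p.Monic) (hker : ∀ g, Polynomial.aeval t g = 0 ↔ p ∣ g)
    (hgen : ∀ m : M, ∃ a ∈ Algebra.adjoin R {t}, ∃ b ∈ Algebra.adjoin R {t}, m = a / b)
    (hy : IsIntegral R y) :
    Polynomial.aeval t p.derivative * y ∈ Algebra.adjoin R {t} := by
  by_cases h0 : Polynomial.aeval t p.derivative = 0
  · rw [h0, zero_mul]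
    exact zero_mem _
  have hpt : Polynomial.aeval t p = 0 := (hker p).2 dvd_rfl
  have hmin : p = minpoly R t := by
    refine minpoly.unique' _ _ hp hpt fun q hq => ?_
    by_contra! hc
    exact hc.1 (Polynomial.eq_zero_of_dvd_of_degree_lt ((hker q).1 hc.2) hq)
  have ht : IsIntegral R t := ⟨p, hp, hpt⟩
  let F := FractionRing R
  letI : Algebra F M := FractionRing.liftAlgebra R M
  haveI : IsScalarTower R F M := FractionRing.isScalarTower_liftAlgebra R M
  have hminF : minpoly F t = p.map (algebraMap R F) := by
    rw [hmin]
    exact minpoly.isIntegrallyClosed_eq_field_fractions' F ht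
  have htF : IsIntegral F t := ht.tower_top
  have hder : Polynomial.aeval t (minpoly F t).derivative = Polynomial.aeval t p.derivative := by
    rw [hminF, Polynomial.derivative_map, Polynomial.aeval_map_algebraMap]
  have hsep : IsSeparable F t := by
    refine (Polynomial.separable_iff_derivative_ne_zero (minpoly.irreducible htF)).2 fun h => h0 ?_
    rw [← hder, h, map_zero]
  have hle : ∀ a ∈ Algebra.adjoin R {t}, a ∈ IntermediateField.adjoin F {t} := by
    intro a ha
    induction ha using Algebra.adjoin_induction with
    | mem x hx => exact IntermediateField.subset_adjoin F _ hx
    | algebraMap r =>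
      rw [IsScalarTower.algebraMap_apply R F M]
      exact (IntermediateField.adjoin F {t}).algebraMap_mem _
    | add x y _ _ hx hy => exact add_mem hx hy
    | mul x y _ _ hx hy => exact mul_mem hx hy
  have htop : IntermediateField.adjoin F {t} = ⊤ := by
    rw [eq_top_iff]
    intro m _
    obtain ⟨a, ha, b, hb, rfl⟩ := hgen m
    exact div_mem (hle a ha) (hle b hb)
  haveI hfin : FiniteDimensional F M := by
    have := IntermediateField.adjoin.finiteDimensional htF
    rw [htop] at this
    exact IntermediateField.topEquiv.toLinearEquiv.finiteDimensional
  haveI hsepM : Algebra.IsSeparable F M := by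
    have := (IntermediateField.isSeparable_adjoin_simple_iff_isSeparable F M).2 hsep
    rw [htop] at this
    exact Algebra.IsSeparable.of_algHom F _ (IntermediateField.topEquiv (F := F) (E := M)).symm.toAlgHom
  have halg : Algebra.adjoin F {t} = ⊤ := by
    rw [← IntermediateField.adjoin_simple_toSubalgebra_of_isAlgebraic htF.isAlgebraic, htop,
      IntermediateField.top_toSubalgebra]
  have hdual := traceForm_dualSubmodule_adjoin R F halg ht
  have hadj : ∀ a ∈ Algebra.adjoin R {t}, IsIntegral R a := by
    intro a ha
    exact ((le_integralClosure_iff_isIntegral).2 (Algebra.IsIntegral.adjoin (by simpa using ht)) ha :)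
  have hmem : y ∈ (Algebra.traceForm F M).dualSubmodule
      (Subalgebra.toSubmodule (Algebra.adjoin R {t})) := by
    rw [LinearMap.BilinForm.mem_dualSubmodule]
    intro a ha
    have h1 : IsIntegral R (Algebra.trace F M (y * a)) :=
      Algebra.isIntegral_trace (hy.mul (hadj a ha))
    obtain ⟨r, hr⟩ := IsIntegrallyClosed.isIntegral_iff.1 h1
    rw [Submodule.mem_one]
    exact ⟨r, hr⟩
  rw [hdual, hder] at hmem
  obtain ⟨a, ha, rfl⟩ := hmem
  simpa [smul_eq_mul, mul_inv_cancel_left₀ h0] using ha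

section Substitution

variable {R : Type*} [CommRing R] [Algebra K R]

theorem natDegree_prod_linear_pow_le_and_coeff (h v : Fin 3 → R) (m : Fin 3 →₀ ℕ) :
    (m.prod fun i n => (Polynomial.C (h i) + Polynomial.C (v i) * Polynomial.X) ^ n).natDegree ≤
        m.degree ∧
      (m.prod fun i n => (Polynomial.C (h i) + Polynomial.C (v i) * Polynomial.X) ^ n).coeff
        m.degree = m.prod fun i n => v i ^ n := by
  have hd : ∀ i, (Polynomial.C (h i) + Polynomial.C (v i) * Polynomial.X).natDegree ≤ 1 := by
    intro i
    rw [add_comm]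
    exact Polynomial.natDegree_linear_le
  have hpow : ∀ i n, ((Polynomial.C (h i) + Polynomial.C (v i) * Polynomial.X) ^ n).natDegree ≤ n :=
    fun i n => by simpa using Polynomial.natDegree_pow_le_of_le n (hd i)
  have hc : ∀ i n, ((Polynomial.C (h i) + Polynomial.C (v i) * Polynomial.X) ^ n).coeff n =
      v i ^ n := fun i n => by
    have := Polynomial.coeff_pow_of_natDegree_le (m := n) (hd i)
    rw [mul_one] at this
    rw [this]
    simp [Polynomial.coeff_C]
  rw [Finsupp.prod_fintype _ _ (by simp), Finsupp.prod_fintype _ _ (by simp),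
    Finsupp.degree_eq_sum, Fin.prod_univ_three, Fin.prod_univ_three, Fin.sum_univ_three]
  have h2 := Polynomial.natDegree_mul_le_of_le (hpow 0 (m 0)) (hpow 1 (m 1))
  refine ⟨Polynomial.natDegree_mul_le_of_le h2 (hpow 2 (m 2)), ?_⟩
  rw [Polynomial.coeff_mul_add_eq_of_natDegree_le h2 (hpow 2 (m 2)),
    Polynomial.coeff_mul_add_eq_of_natDegree_le (hpow 0 (m 0)) (hpow 1 (m 1)), hc, hc, hc]

theorem aeval_linear_natDegree_le_and_coeff (h : Fin 3 → R) (v : Fin 3 → K)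
    (f : MvPolynomial (Fin 3) K) :
    (aeval (fun i => Polynomial.C (h i) + Polynomial.C (algebraMap K R (v i)) * Polynomial.X)
        f).natDegree ≤ f.totalDegree ∧
      (aeval (fun i => Polynomial.C (h i) + Polynomial.C (algebraMap K R (v i)) * Polynomial.X)
        f).coeff f.totalDegree =
        algebraMap K R (eval v (homogeneousComponent f.totalDegree f)) := by
  classical
  have key : ∀ m : Fin 3 →₀ ℕ, _ := fun m => natDegree_prod_linear_pow_le_and_coeff h
    (fun i => algebraMap K R (v i)) m
  have hsum : aeval (fun i => Polynomial.C (h i) + Polynomial.C (algebraMap K R (v i)) *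
      Polynomial.X) f = ∑ m ∈ f.support, Polynomial.C (algebraMap K R (f.coeff m)) *
        (m.prod fun i n => (Polynomial.C (h i) + Polynomial.C (algebraMap K R (v i)) *
          Polynomial.X) ^ n) := by
    rw [aeval_def, eval₂_eq]
    rfl
  constructor
  · rw [hsum]
    refine Polynomial.natDegree_sum_le_of_forall_le _ _ fun m hm => ?_
    refine (Polynomial.natDegree_C_mul_le _ _).trans ((key m).1.trans ?_)
    exact le_totalDegree hm
  · rw [hsum, Polynomial.finsetSum_coeff, homogeneousComponent_apply, map_sum, map_sum,
      Finset.sum_filter]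
    refine Finset.sum_congr rfl fun m hm => ?_
    rw [Polynomial.coeff_C_mul]
    split_ifs with hmd
    · rw [← hmd, (key m).2, eval_monomial, map_mul, map_finsuppProd]
      simp
    · have hlt : m.degree < f.totalDegree :=
        lt_of_le_of_ne (le_totalDegree hm) hmd
      rw [Polynomial.coeff_eq_zero_of_natDegree_lt ((key m).1.trans_lt hlt), mul_zero]

end Substitution

section Conductor

variable {M : Type*} [Field M] [Algebra K M] {g : Fin 3 → M} {f : MvPolynomial (Fin 3) K}

local notation "R₂" => MvPolynomial (Fin 2) K

theorem exists_sum_pderiv_mul_eq (hker : ∀ a : MvPolynomial (Fin 3) K, aeval g a = 0 ↔ f ∣ a) (hf : f ≠ 0)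
    (hgen : ∀ m : M, ∃ a b : MvPolynomial (Fin 3) K, m = aeval g a / aeval g b)
    {y : M} (hy : (aeval g : MvPolynomial (Fin 3) K →ₐ[K] M).toRingHom.IsIntegralElem y)
    {v : Fin 3 → K} (hv : v 0 ≠ 0)
    (hvf : eval v (homogeneousComponent f.totalDegree f) ≠ 0) :
    ∃ a : MvPolynomial (Fin 3) K, (∑ i, algebraMap K M (v i) * aeval g (pderiv i f)) * y = aeval g a := by
  set u := eval v (homogeneousComponent f.totalDegree f) with hu
  let η : R₂ →ₐ[K] M := aeval ![g 1 - algebraMap K M (v 1 / v 0) * g 0,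
    g 2 - algebraMap K M (v 2 / v 0) * g 0]
  letI : Algebra R₂ M := η.toRingHom.toAlgebra
  have hη : ∀ r : R₂, algebraMap R₂ M r = η r := fun _ => rfl
  haveI : IsScalarTower K R₂ M := IsScalarTower.of_algebraMap_eq fun c => by
    rw [hη, algebraMap_eq, ← algebraMap_eq, AlgHom.commutes]
  set t : M := algebraMap K M (v 0)⁻¹ * g 0 with ht
  let hh : Fin 3 → R₂ := ![0, X 0, X 1]
  let L : Fin 3 → Polynomial R₂ := fun i =>
    Polynomial.C (hh i) + Polynomial.C (algebraMap K R₂ (v i)) * Polynomial.X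
  have hv' : algebraMap K M (v 0) ≠ 0 := by simpa using hv
  -- substitution and its inverse
  have hψ : ∀ a : MvPolynomial (Fin 3) K, Polynomial.aeval t (aeval L a) = aeval g a := by
    intro a
    have h1 := comp_aeval_apply L ((Polynomial.aeval t : Polynomial R₂ →ₐ[R₂] M).restrictScalars K) a
    rw [AlgHom.restrictScalars_apply] at h1
    rw [h1]
    congr 2
    funext i
    fin_cases i
    · simp [L, hh, ht, hη, hv', ← IsScalarTower.algebraMap_apply]
    · simp [L, hh, ht, hη, η, ← IsScalarTower.algebraMap_apply]
      ring
    · simp [L, hh, ht, hη, η, ← IsScalarTower.algebraMap_apply]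
      ring
  let σ : R₂ →ₐ[K] MvPolynomial (Fin 3) K := aeval ![X 1 - C (v 1 / v 0) * X 0,
    X 2 - C (v 2 / v 0) * X 0]
  let τ : Polynomial R₂ →+* MvPolynomial (Fin 3) K :=
    Polynomial.eval₂RingHom σ.toRingHom (C (v 0)⁻¹ * X 0)
  have hτ : ∀ q, aeval g (τ q) = Polynomial.aeval t q := by
    intro q
    have : ((aeval g : MvPolynomial (Fin 3) K →ₐ[K] M) : MvPolynomial (Fin 3) K →+* M).comp τ =
        ((Polynomial.aeval t : Polynomial R₂ →ₐ[R₂] M) : Polynomial R₂ →+* M) := by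
      refine Polynomial.ringHom_ext' (MvPolynomial.ringHom_ext (fun c => ?_) fun i => ?_) ?_
      · simp [τ, ← IsScalarTower.algebraMap_apply, hη]
      · fin_cases i <;> simp [τ, σ, hη, η]
      · simp [τ, ht]
    exact congrArg (fun φ : Polynomial R₂ →+* M => φ q) this
  have hψτ : ∀ q, aeval L (τ q) = q := by
    intro q
    have : ((aeval L : MvPolynomial (Fin 3) K →ₐ[K] Polynomial R₂) :
        MvPolynomial (Fin 3) K →+* Polynomial R₂).comp τ = RingHom.id _ := by
      have e : ∀ c : K, (algebraMap K (Polynomial R₂)) c = Polynomial.C (C c) := fun c => rfl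
      refine Polynomial.ringHom_ext' (MvPolynomial.ringHom_ext (fun c => ?_) fun i => ?_) ?_
      · simp [τ, e]
      · fin_cases i
        · simp [τ, σ, L, hh, e, ← mul_assoc, ← Polynomial.C_mul, ← C_mul, hv, algebraMap_eq]
        · simp [τ, σ, L, hh, e, ← mul_assoc, ← Polynomial.C_mul, ← C_mul, hv, algebraMap_eq]
      · simp [τ, L, hh, e, ← mul_assoc, ← Polynomial.C_mul, ← C_mul, hv, algebraMap_eq]
    exact congrArg (fun φ : Polynomial R₂ →+* Polynomial R₂ => φ q) this
  have hdvd : ∀ q, Polynomial.aeval t q = 0 ↔ aeval L f ∣ q := by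
    intro q
    rw [← hτ, hker]
    constructor
    · rintro ⟨c, hc⟩
      exact ⟨aeval L c, by rw [← map_mul, ← hc, hψτ]⟩
    · rintro ⟨c, rfl⟩
      rw [← hker, hτ, map_mul, hψ, (hker f).2 dvd_rfl, zero_mul]
  obtain ⟨hdeg, hcoeff⟩ := aeval_linear_natDegree_le_and_coeff hh v f
  change (aeval L f).natDegree ≤ _ at hdeg
  change (aeval L f).coeff _ = _ at hcoeff
  rw [← hu] at hcoeff
  set p : Polynomial R₂ := Polynomial.C (algebraMap K R₂ u⁻¹) * aeval L f with hpdef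
  have hunit : IsUnit (Polynomial.C (algebraMap K R₂ u⁻¹)) :=
    ((IsUnit.mk0 _ (inv_ne_zero hvf)).map _).map Polynomial.C
  have hpm : p.Monic := by
    refine Polynomial.monic_of_natDegree_le_of_coeff_eq_one f.totalDegree
      ((Polynomial.natDegree_C_mul_le _ _).trans hdeg) ?_
    rw [Polynomial.coeff_C_mul, hcoeff, ← map_mul, inv_mul_cancel₀ hvf, map_one]
  have hkerp : ∀ q, Polynomial.aeval t q = 0 ↔ p ∣ q := fun q => by
    rw [hdvd, hpdef]
    exact hunit.mul_left_dvd.symm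
  have hp1 : p.natDegree ≠ 0 := by
    intro h0
    have h1 := hpm.natDegree_eq_zero.1 h0
    have h2 := (hkerp 1).2 (h1 ▸ dvd_rfl)
    simp at h2
  haveI : FaithfulSMul R₂ M := by
    rw [faithfulSMul_iff_algebraMap_injective, injective_iff_map_eq_zero]
    intro r hr
    by_contra hr0
    have h1 := (hkerp (Polynomial.C r)).1 (by rw [Polynomial.aeval_C, hr])
    have h2 := Polynomial.natDegree_le_of_dvd h1 (by simpa using hr0)
    rw [Polynomial.natDegree_C] at h2
    omega
  have hadj : ∀ a : MvPolynomial (Fin 3) K, aeval g a ∈ Algebra.adjoin R₂ {t} := fun a => by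
    rw [← hψ]
    exact Polynomial.aeval_mem_adjoin_singleton R₂ t
  have htint : IsIntegral R₂ t := ⟨p, hpm, (hkerp p).2 dvd_rfl⟩
  haveI : Algebra.IsIntegral R₂ (Algebra.adjoin R₂ {t}) :=
    Algebra.IsIntegral.adjoin (by simpa using htint)
  have hyR : IsIntegral R₂ y := by
    refine isIntegral_trans (A := Algebra.adjoin R₂ {t}) y ?_
    obtain ⟨P, hP, hPy⟩ := hy
    let φ : MvPolynomial (Fin 3) K →+* Algebra.adjoin R₂ {t} :=
      (aeval g : MvPolynomial (Fin 3) K →ₐ[K] M).toRingHom.codRestrict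
        (Algebra.adjoin R₂ {t}).toSubring hadj
    refine ⟨P.map φ, hP.map _, ?_⟩
    rw [Polynomial.eval₂_map]
    exact hPy
  have hmem := aeval_derivative_mul_mem_adjoin (t := t) hpm hkerp (fun m => by
    obtain ⟨a, b, rfl⟩ := hgen m
    exact ⟨_, hadj a, _, hadj b, rfl⟩) hyR
  rw [Algebra.adjoin_singleton_eq_range_aeval] at hmem
  obtain ⟨q, hq⟩ := hmem
  have hder : Polynomial.aeval t p.derivative =
      algebraMap K M u⁻¹ * ∑ i, algebraMap K M (v i) * aeval g (pderiv i f) := by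
    have h1 : (aeval L f).derivative = ∑ i, aeval L (pderiv i f) * Polynomial.C (algebraMap K R₂ (v i)) := by
      have := derivation_aeval_eq_sum
        ((Polynomial.derivative' : Derivation R₂ (Polynomial R₂) _).restrictScalars K) L f
      simpa [L, smul_eq_mul] using this
    rw [hpdef, Polynomial.derivative_C_mul, h1, map_mul, map_sum, Polynomial.aeval_C,
      ← IsScalarTower.algebraMap_apply]
    congr 1
    refine Finset.sum_congr rfl fun i _ => ?_
    rw [map_mul, hψ, Polynomial.aeval_C, ← IsScalarTower.algebraMap_apply, mul_comm]
  refine ⟨C u * τ q, ?_⟩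
  have hu' : algebraMap K M u ≠ 0 := by simpa using hvf
  rw [map_mul, hτ, aeval_C]
  have hq' : Polynomial.aeval t q = Polynomial.aeval t p.derivative * y := hq
  rw [hq', hder, map_inv₀]
  field_simp

end Conductor

theorem homogeneousComponent_totalDegree_ne_zero {σ : Type*} {f : MvPolynomial σ K} (hf : f ≠ 0) :
    homogeneousComponent f.totalDegree f ≠ 0 := by
  obtain ⟨m, hm, hd⟩ := Finset.exists_mem_eq_sup f.support (support_nonempty.2 hf)
    (fun s => s.sum fun _ e => e)
  intro h0
  have h1 := congrArg (coeff m) h0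
  rw [coeff_homogeneousComponent, if_pos (show m.degree = f.totalDegree from hd.symm), coeff_zero] at h1
  exact mem_support_iff.1 hm h1

section Conductor

variable {M : Type*} [Field M] [Algebra K M] {g : Fin 3 → M} {f : MvPolynomial (Fin 3) K}

theorem exists_pderiv_mul_eq [Infinite K]
    (hker : ∀ a : MvPolynomial (Fin 3) K, aeval g a = 0 ↔ f ∣ a) (hf : f ≠ 0)
    (hgen : ∀ m : M, ∃ a b : MvPolynomial (Fin 3) K, m = aeval g a / aeval g b)
    {y : M} (hy : (aeval g : MvPolynomial (Fin 3) K →ₐ[K] M).toRingHom.IsIntegralElem y)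
    (j : Fin 3) : ∃ a : MvPolynomial (Fin 3) K, aeval g (pderiv j f) * y = aeval g a := by
  classical
  let U : Submodule K (Fin 3 → K) :=
    { carrier := {v | ∃ a : MvPolynomial (Fin 3) K,
        (∑ i, algebraMap K M (v i) * aeval g (pderiv i f)) * y = aeval g a}
      add_mem' := by
        rintro v w ⟨a, ha⟩ ⟨b, hb⟩
        refine ⟨a + b, ?_⟩
        rw [map_add, ← ha, ← hb, ← add_mul, ← Finset.sum_add_distrib]
        simp [add_mul]
      zero_mem' := ⟨0, by simp⟩
      smul_mem' := by
        rintro c v ⟨a, ha⟩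
        refine ⟨C c * a, ?_⟩
        rw [map_mul, aeval_C, ← ha, ← mul_assoc, Finset.mul_sum]
        simp [mul_assoc] }
  have hU : U = ⊤ := by
    by_contra hne
    obtain ⟨ℓ, hℓ, hle⟩ := Submodule.exists_le_ker_of_lt_top U (lt_top_iff_ne_top.2 hne)
    let P : MvPolynomial (Fin 3) K := ∑ i, C (ℓ (Pi.single i 1)) * X i
    have hP : ∀ v, eval v P = ℓ v := by
      intro v
      conv_rhs => rw [← Finset.univ_sum_single v]
      rw [map_sum, map_sum]
      refine Finset.sum_congr rfl fun i _ => ?_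
      rw [eval_mul, eval_C, eval_X, mul_comm, ← smul_eq_mul, ← map_smul, ← Pi.single_smul,
        smul_eq_mul, mul_one]
    have h0 : X 0 * homogeneousComponent f.totalDegree f * P = 0 := by
      refine MvPolynomial.funext fun v => ?_
      rw [map_zero, eval_mul, eval_mul, eval_X, hP]
      by_cases hv : v 0 = 0
      · simp [hv]
      by_cases hvf : eval v (homogeneousComponent f.totalDegree f) = 0
      · simp [hvf]
      have hvU : v ∈ U := exists_sum_pderiv_mul_eq hker hf hgen hy hv hvf
      rw [LinearMap.mem_ker.1 (hle hvU), mul_zero]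
    rcases mul_eq_zero.1 h0 with h0 | h0
    · rcases mul_eq_zero.1 h0 with h0 | h0
      · exact X_ne_zero _ h0
      · exact homogeneousComponent_totalDegree_ne_zero hf h0
    · exact hℓ (LinearMap.ext fun v => by rw [← hP, h0]; simp)
  obtain ⟨a, ha⟩ : Pi.single j 1 ∈ U := hU ▸ Submodule.mem_top
  refine ⟨a, ?_⟩
  rw [← ha, Finset.sum_eq_single j]
  · simp
  · intro i _ hi
    simp [hi]
  · simp

/-- The denominators of `y` with respect to the image of `aeval g`. -/
def denomIdeal (g : Fin 3 → M) (y : M) : Ideal (MvPolynomial (Fin 3) K) where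
  carrier := {a | ∃ b : MvPolynomial (Fin 3) K, aeval g a * y = aeval g b}
  add_mem' := by
    rintro a a' ⟨b, hb⟩ ⟨b', hb'⟩
    exact ⟨b + b', by rw [map_add, map_add, add_mul, hb, hb']⟩
  zero_mem' := ⟨0, by simp⟩
  smul_mem' := by
    rintro c a ⟨b, hb⟩
    exact ⟨c * b, by rw [smul_eq_mul, map_mul, map_mul, mul_assoc, hb]⟩

theorem mem_denomIdeal {y : M} {a : MvPolynomial (Fin 3) K} :
    a ∈ denomIdeal g y ↔ ∃ b : MvPolynomial (Fin 3) K, aeval g a * y = aeval g b := Iff.rfl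

theorem mul_mem_denomIdeal {y : M} {a c : MvPolynomial (Fin 3) K} :
    a ∈ denomIdeal g (aeval g c * y) ↔ a * c ∈ denomIdeal g y := by
  rw [mem_denomIdeal, mem_denomIdeal, map_mul, mul_assoc]

theorem exists_eq_X_mul_add_X_mul {h : MvPolynomial (Fin 3) K}
    (hh : aeval ![0, 0, (Polynomial.X : Polynomial K)] h = 0) :
    ∃ h₀ h₁ : MvPolynomial (Fin 3) K, h = X 0 * h₀ + X 1 * h₁ := by
  let I : Ideal (MvPolynomial (Fin 3) K) := Ideal.span {X 0, X 1}
  have hX0 : Ideal.Quotient.mkₐ K I (X 0) = 0 :=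
    Ideal.Quotient.eq_zero_iff_mem.2 (Ideal.subset_span (by simp))
  have hX1 : Ideal.Quotient.mkₐ K I (X 1) = 0 :=
    Ideal.Quotient.eq_zero_iff_mem.2 (Ideal.subset_span (by simp))
  have key : (Ideal.Quotient.mkₐ K I) = ((Polynomial.aeval (Ideal.Quotient.mkₐ K I (X 2))).comp
      (aeval ![0, 0, (Polynomial.X : Polynomial K)])) := by
    refine MvPolynomial.algHom_ext fun i => ?_
    fin_cases i
    · simpa using hX0
    · simpa using hX1
    · simp
  have hmem : Ideal.Quotient.mkₐ K I h = 0 := by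
    rw [key, AlgHom.comp_apply, hh, map_zero]
  obtain ⟨a, b, hab⟩ := Ideal.mem_span_pair.1 (Ideal.Quotient.eq_zero_iff_mem.1 hmem)
  exact ⟨a, b, by rw [← hab]; ring⟩

theorem one_mem_denomIdeal_of_X_mem
    (hker : ∀ a : MvPolynomial (Fin 3) K, aeval g a = 0 ↔ f ∣ a) (hg : g 0 ≠ 0)
    (hf : aeval ![0, 0, (Polynomial.X : Polynomial K)] f ≠ 0) {y : M}
    (h0 : (X 0 : MvPolynomial (Fin 3) K) ∈ denomIdeal g y)
    (h1 : (X 1 : MvPolynomial (Fin 3) K) ∈ denomIdeal g y) :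
    (1 : MvPolynomial (Fin 3) K) ∈ denomIdeal g y := by
  obtain ⟨a₀, ha₀⟩ := h0
  obtain ⟨a₁, ha₁⟩ := h1
  rw [aeval_X] at ha₀ ha₁
  obtain ⟨h, hh⟩ : f ∣ X 1 * a₀ - X 0 * a₁ := by
    rw [← hker, map_sub, map_mul, map_mul, ← ha₀, ← ha₁, aeval_X, aeval_X]
    ring
  have hπ := congrArg (aeval ![0, 0, (Polynomial.X : Polynomial K)]) hh
  rw [map_sub, map_mul, map_mul, map_mul, aeval_X, aeval_X] at hπ
  have hh0 : aeval ![0, 0, (Polynomial.X : Polynomial K)] h = 0 := by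
    refine (mul_eq_zero.1 ?_).resolve_left hf
    rw [← hπ]
    simp
  obtain ⟨b₀, b₁, rfl⟩ := exists_eq_X_mul_add_X_mul hh0
  have heq : X 1 * (a₀ - f * b₁) = X 0 * (a₁ + f * b₀) := by linear_combination hh
  have hdvd : (X 0 : MvPolynomial (Fin 3) K) ∣ a₀ - f * b₁ := by
    refine (X_prime.dvd_or_dvd (heq ▸ dvd_mul_right _ _ : _ ∣ X 1 * (a₀ - f * b₁))).resolve_left ?_
    rw [X_dvd_X]
    decide
  obtain ⟨q, hq⟩ := hdvd
  refine ⟨q, mul_left_cancel₀ hg ?_⟩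
  have := congrArg (aeval g) hq
  rw [map_sub, map_mul, map_mul, (hker f).2 dvd_rfl, aeval_X] at this
  rw [map_one, one_mul, ha₀, ← this]
  ring

theorem one_mem_denomIdeal_of_X_pow_mem
    (hker : ∀ a : MvPolynomial (Fin 3) K, aeval g a = 0 ↔ f ∣ a) (hg : g 0 ≠ 0)
    (hf : aeval ![0, 0, (Polynomial.X : Polynomial K)] f ≠ 0) (n m : ℕ) {y : M}
    (h0 : (X 0 ^ n : MvPolynomial (Fin 3) K) ∈ denomIdeal g y)
    (h1 : (X 1 ^ m : MvPolynomial (Fin 3) K) ∈ denomIdeal g y) :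
    (1 : MvPolynomial (Fin 3) K) ∈ denomIdeal g y := by
  have step : ∀ (n : ℕ) (z : M), (X 0 ^ n : MvPolynomial (Fin 3) K) ∈ denomIdeal g z →
      (X 1 : MvPolynomial (Fin 3) K) ∈ denomIdeal g z →
      (1 : MvPolynomial (Fin 3) K) ∈ denomIdeal g z := by
    intro n
    induction n with
    | zero => intro z hz _; simpa using hz
    | succ n ih =>
      intro z hz hz1
      refine ih z ?_ hz1
      have := one_mem_denomIdeal_of_X_mem (y := aeval g (X 0 ^ n : MvPolynomial (Fin 3) K) * z)
        hker hg hf (mul_mem_denomIdeal.2 (by rwa [← pow_succ']))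
        (mul_mem_denomIdeal.2 (Ideal.mul_mem_right _ _ hz1))
      simpa using mul_mem_denomIdeal.1 this
  induction m with
  | zero => simpa using h1
  | succ m ih =>
    refine ih ?_
    have := step n (aeval g (X 1 ^ m : MvPolynomial (Fin 3) K) * y)
      (mul_mem_denomIdeal.2 (Ideal.mul_mem_right _ _ h0))
      (mul_mem_denomIdeal.2 (by rwa [← pow_succ']))
    simpa using mul_mem_denomIdeal.1 this

theorem exists_mem_denomIdeal [IsAlgClosed K]
    (hker : ∀ a : MvPolynomial (Fin 3) K, aeval g a = 0 ↔ f ∣ a) (hg : g 0 ≠ 0)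
    (hf : aeval ![0, 0, (Polynomial.X : Polynomial K)] f ≠ 0)
    (hgen : ∀ m : M, ∃ a b : MvPolynomial (Fin 3) K, m = aeval g a / aeval g b)
    {c : MvPolynomial (Fin 3) K} (hc : eval 0 c ≠ 0)
    (hsing : ∀ p, eval p f = 0 → (∀ i, eval p (pderiv i f) = 0) → eval p c ≠ 0 → p = 0)
    {y : M} (hy : (aeval g : MvPolynomial (Fin 3) K →ₐ[K] M).toRingHom.IsIntegralElem y) :
    ∃ e ∈ denomIdeal (K := K) g y, eval 0 e ≠ 0 := by
  have hf' : f ≠ 0 := by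
    rintro rfl
    exact hf (map_zero _)
  have hfJ : f ∈ denomIdeal g y := ⟨0, by rw [(hker f).2 dvd_rfl, zero_mul, map_zero]⟩
  have hdJ : ∀ i, pderiv i f ∈ denomIdeal g y := fun i => exists_pderiv_mul_eq hker hf' hgen hy i
  have hrad : ∀ i : Fin 3, c * X i ∈ (denomIdeal (K := K) g y).radical := by
    intro i
    rw [← MvPolynomial.vanishingIdeal_zeroLocus_eq_radical (K := K), mem_vanishingIdeal_iff]
    intro p hp
    rw [MvPolynomial.mem_zeroLocus_iff] at hp
    simp only [aeval_eq_eval] at hp ⊢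
    by_cases hcp : eval p c = 0
    · simp [hcp]
    · have : p = 0 := hsing p (hp f hfJ) (fun i => hp _ (hdJ i)) hcp
      simp [this]
  obtain ⟨n, hn⟩ := hrad 0
  obtain ⟨m, hm⟩ := hrad 1
  have h1 := one_mem_denomIdeal_of_X_pow_mem hker hg hf n m (y := aeval g (c ^ (n + m)) * y)
    (mul_mem_denomIdeal.2 (by
      rw [pow_add, ← mul_assoc, mul_comm (X 0 ^ n), ← mul_pow]
      exact Ideal.mul_mem_right _ _ hn))
    (mul_mem_denomIdeal.2 (by
      rw [add_comm, pow_add, ← mul_assoc, mul_comm (X 1 ^ m), ← mul_pow]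
      exact Ideal.mul_mem_right _ _ hm))
  refine ⟨c ^ (n + m), by simpa using mul_mem_denomIdeal.1 h1, ?_⟩
  rw [map_pow]
  exact pow_ne_zero _ hc

end Conductor

/-! ### No isolated singularities -/

/-- If `f = 0` is invariant under all the maps `z ↦ z + s W z`, then its singular points move
along `W`. -/
theorem singular_of_forall_dvd_bind₁ {f : MvPolynomial (Fin 3) K} (hf0 : eval 0 f = 0)
    (hd0 : ∀ i, eval 0 (pderiv i f) = 0) (W : Fin 3 → MvPolynomial (Fin 3) K)
    (hW : ∀ s : K, f ∣ bind₁ (fun i => X i + C s * W i) f) :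
    ∃ P : Polynomial K, P ≠ 0 ∧ ∀ s, P.eval s ≠ 0 →
      eval (fun i => s * eval 0 (W i)) f = 0 ∧
        ∀ i, eval (fun i => s * eval 0 (W i)) (pderiv i f) = 0 := by
  classical
  let B : Matrix (Fin 3) (Fin 3) K := fun i j => eval 0 (pderiv j (W i))
  let P : Polynomial K := (1 + (Polynomial.X : Polynomial K) • B.map Polynomial.C).det
  have hP : ∀ s, P.eval s = (1 + s • B).det := by
    intro s
    rw [← Polynomial.coe_evalRingHom, RingHom.map_det]
    congr 1
    ext i j
    simp [Matrix.one_apply, apply_ite, mul_comm s]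
  refine ⟨P, fun h => ?_, fun s hs => ?_⟩
  · have := hP 0
    simp [h] at this
  obtain ⟨h, hh⟩ := hW s
  have hev : ∀ q : MvPolynomial (Fin 3) K, eval 0 (bind₁ (fun i => X i + C s * W i) q) =
      eval (fun i => s * eval 0 (W i)) q := by
    intro q
    rw [eval_bind₁_eq]
    congr 2
    funext i
    rw [map_add, eval_X, map_mul, eval_C]
    simp
  refine ⟨by rw [← hev, hh, map_mul, hf0, zero_mul], ?_⟩
  have hvec : Matrix.vecMul (fun i => eval (fun i => s * eval 0 (W i)) (pderiv i f)) (1 + s • B) = 0 := by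
    funext j
    have h1 := derivation_aeval_eq_sum (pderiv j) (fun i => X i + C s * W i) f
    change pderiv j (bind₁ (fun i => X i + C s * W i) f) =
      ∑ i, bind₁ (fun i => X i + C s * W i) (pderiv i f) • _ at h1
    have h2 := congrArg (eval 0) h1
    rw [hh, Derivation.leibniz, map_add, smul_eq_mul, smul_eq_mul, map_mul, map_mul, hf0, hd0,
      zero_mul, mul_zero, zero_add, map_sum] at h2
    rw [Pi.zero_apply, h2, Matrix.vecMul, dotProduct]
    refine Finset.sum_congr rfl fun i _ => ?_
    rw [smul_eq_mul, map_mul, hev, map_add, pderiv_C_mul, map_add, pderiv_X, map_mul, eval_C]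
    congr 1
    simp only [Matrix.add_apply, Matrix.one_apply,
      Pi.single_apply, eq_comm (a := i)]
    have hB : (s • B) i j = s * eval 0 (pderiv j (W i)) := rfl
    rw [hB]
    split_ifs <;> simp
  exact fun i => congrFun (Matrix.eq_zero_of_vecMul_eq_zero ((hP s) ▸ hs) hvec) i

theorem false_of_isolated_singularity [IsAlgClosed K] {f : MvPolynomial (Fin 3) K} (hf : Prime f)
    (hf0 : eval 0 f = 0) (hd0 : ∀ i, eval 0 (pderiv i f) = 0)
    {c : MvPolynomial (Fin 3) K} (hc : eval 0 c ≠ 0)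
    (hsing : ∀ p, eval p f = 0 → (∀ i, eval p (pderiv i f) = 0) → eval p c ≠ 0 → p = 0)
    (hline : ∀ p, eval p f = 0 → ∃ w : Fin 3 → K, w ≠ 0 ∧ ∀ s : K, eval (p + s • w) f = 0)
    (hdir : ¬ ∃ w : Fin 3 → K, w ≠ 0 ∧ w 0 = 0 ∧ ∀ s : K, eval (s • w) f = 0)
    (hdeg : ∀ Q : MvPolynomial (Fin 3) K, Q.totalDegree ≤ 2 → f ∣ Q → Q = 0)
    (hva : ¬ ∃ q : Fin 3 → K, ∀ s : K, f ∣ bind₁ (fun i => X i + C s * (C (q i) - X i)) f)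
    (hvb : ¬ ∃ q : Fin 3 → K, q ≠ 0 ∧ ∀ s : K, f ∣ bind₁ (fun i => X i + C (s * q i)) f) :
    False := by
  obtain ⟨k, M, _, _, _, _, _, _, x, α, β, γ, δ, h⟩ := exists_isRuledModel hf hf0 hline hdir
  have htop := h.coordField_eq_top hf.ne_zero hf0 hdir hdeg hva hvb
  set g := IsRuledModel.genPt x α β γ δ with hg
  have hker : ∀ a : MvPolynomial (Fin 3) K, aeval g a = 0 ↔ f ∣ a := h.aeval_eq_zero_iff
  have hgen : ∀ m : M, ∃ a b : MvPolynomial (Fin 3) K, m = aeval g a / aeval g b := by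
    intro m
    have hm : m ∈ IntermediateField.adjoin K (Set.range g) := by
      have : m ∈ IsRuledModel.coordField K x α β γ δ := htop ▸ IntermediateField.mem_top
      exact this
    exact (IntermediateField.mem_adjoin_range_iff K g m).1 hm
  have hg0 : g 0 ≠ 0 := by
    intro h0
    refine h.transcendental ?_
    have : x = 0 := h0
    rw [this]
    exact isAlgebraic_zero
  have hf2 : aeval ![0, 0, (Polynomial.X : Polynomial K)] f ≠ 0 := by
    intro h0
    refine hdir ⟨![0, 0, 1], fun h => by simpa using congrFun h 2, rfl, fun s => ?_⟩
    have h1 := comp_aeval_apply ![0, 0, (Polynomial.X : Polynomial K)] (Polynomial.aeval s) f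
    rw [h0, map_zero] at h1
    refine Eq.trans ?_ h1.symm
    rw [aeval_eq_eval]
    congr 2
    funext i
    fin_cases i <;> simp
  obtain ⟨c₁, hc₁, hγ, hδ⟩ := h.exists_isIntegralElem hdir
  obtain ⟨e₂, ⟨b₂, hb₂⟩, he₂⟩ := exists_mem_denomIdeal hker hg0 hf2 hgen hc hsing hγ
  obtain ⟨e₃, ⟨b₃, hb₃⟩, he₃⟩ := exists_mem_denomIdeal hker hg0 hf2 hgen hc hsing hδ
  let W : Fin 3 → MvPolynomial (Fin 3) K := ![e₂ * e₃ * c₁, e₃ * b₂, e₂ * b₃]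
  have hW : ∀ s : K, f ∣ bind₁ (fun i => X i + C s * W i) f := by
    intro s
    rw [← hker, aeval_bind₁]
    rw [← h.aeval_linePt_eq_zero (x + algebraMap K M s * aeval g (e₂ * e₃ * c₁))]
    congr 2
    funext i
    fin_cases i
    · simp [W, hg, linePt]
    · simp only [W, Fin.mk_one, Matrix.cons_val_one, Matrix.cons_val_zero, map_add, map_mul,
        aeval_X, aeval_C, ← hb₂]
      simp only [hg, linePt, Matrix.cons_val_one, Matrix.cons_val_zero]
      ring
    · simp only [W, Fin.reduceFinMk, Matrix.cons_val, map_add, map_mul,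
        aeval_X, aeval_C, ← hb₃]
      simp only [hg, linePt, Matrix.cons_val]
      ring
  have hW0 : eval 0 (W 0) ≠ 0 := by
    change eval 0 (e₂ * e₃ * c₁) ≠ 0
    rw [map_mul, map_mul]
    exact mul_ne_zero (mul_ne_zero he₂ he₃) hc₁
  obtain ⟨P, hP, hPs⟩ := singular_of_forall_dvd_bind₁ hf0 hd0 W hW
  let Q : Polynomial K := aeval (fun i => Polynomial.X * Polynomial.C (eval 0 (W i))) c
  have hQs : ∀ s, Q.eval s = eval (fun i => s * eval 0 (W i)) c := by
    intro s
    have h1 := comp_aeval_apply (fun i => Polynomial.X * Polynomial.C (eval 0 (W i)))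
      (Polynomial.aeval s) c
    rw [← Polynomial.coe_aeval_eq_eval]
    rw [h1, aeval_eq_eval]
    simp [mul_comm s]
  have hQ : Q ≠ 0 := by
    intro h0
    have := hQs 0
    simp only [zero_mul, h0, Polynomial.eval_zero] at this
    exact hc this.symm
  obtain ⟨s, hs⟩ : ∃ s, (P * Q * Polynomial.X).eval s ≠ 0 := by
    by_contra! hall
    refine mul_ne_zero (mul_ne_zero hP hQ) Polynomial.X_ne_zero (Polynomial.funext fun s => ?_)
    rw [hall s, Polynomial.eval_zero]
  rw [Polynomial.eval_mul, Polynomial.eval_mul, Polynomial.eval_X] at hs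
  have hs0 : s ≠ 0 := right_ne_zero_of_mul hs
  have hsP := left_ne_zero_of_mul (left_ne_zero_of_mul hs)
  have hsQ := right_ne_zero_of_mul (left_ne_zero_of_mul hs)
  rw [hQs] at hsQ
  obtain ⟨h1, h2⟩ := hPs s hsP
  have := congrFun (hsing _ h1 h2 hsQ) 0
  exact mul_ne_zero hs0 hW0 this

/-! ### Passing to an affine chart -/

theorem eval_smul_of_isHomogeneous {σ : Type*} [Fintype σ] {F : MvPolynomial σ K} {D : ℕ}
    (hF : F.IsHomogeneous D) (c : K) (v : σ → K) : eval (c • v) F = c ^ D * eval v F := by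
  rw [eval_eq', eval_eq', Finset.mul_sum]
  refine Finset.sum_congr rfl fun m hm => ?_
  have h1 : m.degree = D := by
    rw [Finsupp.degree_eq_weight_one]
    exact hF (mem_support_iff.1 hm)
  simp only [Pi.smul_apply, smul_eq_mul, mul_pow, Finset.prod_mul_distrib]
  rw [Finset.prod_pow_eq_pow_sum, ← Finsupp.degree_eq_sum, h1]
  ring

/-- Dehomogenization with respect to the variable `X 0`. -/
noncomputable def dehom : MvPolynomial (Fin 4) K →ₐ[K] MvPolynomial (Fin 3) K :=
  aeval (Fin.cons 1 X)

theorem eval_dehom (F : MvPolynomial (Fin 4) K) (p : Fin 3 → K) :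
    eval p (dehom F) = eval (Fin.cons 1 p : Fin 4 → K) F := by
  have h := comp_aeval_apply (Fin.cons 1 X : Fin 4 → MvPolynomial (Fin 3) K) (aeval p) F
  rw [aeval_eq_eval] at h
  change eval p (dehom F) = _ at h
  rw [h, aeval_eq_eval]
  congr 2
  funext i
  refine Fin.cases ?_ (fun j => ?_) i
  · simp
  · simp

theorem pderiv_dehom (F : MvPolynomial (Fin 4) K) (i : Fin 3) :
    pderiv i (dehom F) = dehom (pderiv i.succ F) := by
  have h := derivation_aeval_eq_sum (pderiv i) (Fin.cons 1 X : Fin 4 → MvPolynomial (Fin 3) K) F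
  change pderiv i (dehom F) = _ at h
  rw [h, Finset.sum_eq_single i.succ]
  · simp [dehom]
  · intro j _
    refine Fin.cases ?_ (fun j => ?_) j
    · simp
    · intro hj
      have : j ≠ i := fun h => hj (by rw [h])
      simp [pderiv_X_of_ne this]
  · simp

theorem exists_homogenization (a : MvPolynomial (Fin 3) K) {n : ℕ} (hn : a.totalDegree ≤ n) :
    ∃ A : MvPolynomial (Fin 4) K, ∀ (t : K) (z : Fin 3 → K),
      eval (Fin.cons t (t • z) : Fin 4 → K) A = t ^ n * eval z a := by
  refine ⟨∑ m ∈ a.support, C (a.coeff m) * (X 0 ^ (n - m.degree) * ∏ i, X i.succ ^ m i),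
    fun t z => ?_⟩
  rw [map_sum, eval_eq', Finset.mul_sum]
  refine Finset.sum_congr rfl fun m hm => ?_
  have hmn : m.degree ≤ n := (le_totalDegree hm).trans hn
  simp only [map_mul, eval_C, map_pow, eval_X, Fin.cons_zero, map_prod, Fin.cons_succ,
    Pi.smul_apply, smul_eq_mul, mul_pow, Finset.prod_mul_distrib]
  rw [Finset.prod_pow_eq_pow_sum, ← Finsupp.degree_eq_sum]
  conv_rhs => rw [← Nat.sub_add_cancel hmn, pow_add]
  ring

theorem cons_smul_tail {v : Fin 4 → K} (h : v 0 ≠ 0) :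
    (Fin.cons (v 0) (v 0 • ((v 0)⁻¹ • Fin.tail v)) : Fin 4 → K) = v := by
  rw [smul_smul, mul_inv_cancel₀ h, one_smul, Fin.cons_self_tail]

theorem smul_cons_one (t : K) (z : Fin 3 → K) :
    t • (Fin.cons 1 z : Fin 4 → K) = Fin.cons t (t • z) := by
  funext i
  refine Fin.cases ?_ (fun j => ?_) i <;> simp

section Chart

variable {F : MvPolynomial (Fin 4) K} {D : ℕ}

theorem eval_cons_smul (hF : F.IsHomogeneous D) (t : K) (z : Fin 3 → K) :
    eval (Fin.cons t (t • z) : Fin 4 → K) F = t ^ D * eval z (dehom F) := by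
  rw [← smul_cons_one, eval_smul_of_isHomogeneous hF, eval_dehom]

/-- The point `(1, 0, 0, 0)`. -/
abbrev basePt : Fin 4 → K := Fin.cons 1 0

theorem not_dvd_X_zero (h0 : eval (basePt : Fin 4 → K) F = 0) : ¬ F ∣ X 0 := by
  rintro ⟨c, hc⟩
  have := congrArg (eval (basePt : Fin 4 → K)) hc
  rw [map_mul, h0, zero_mul, eval_X] at this
  simp at this

theorem dehom_dvd_iff [IsAlgClosed K] (hF : F.IsHomogeneous D) (hp : Prime F)
    (h0 : eval (basePt : Fin 4 → K) F = 0) {a : MvPolynomial (Fin 3) K}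
    {A : MvPolynomial (Fin 4) K} {n : ℕ}
    (hA : ∀ (t : K) (z : Fin 3 → K),
      eval (Fin.cons t (t • z) : Fin 4 → K) A = t ^ n * eval z a) :
    dehom F ∣ a ↔ F ∣ A := by
  constructor
  · rintro ⟨c, hc⟩
    refine (hp.dvd_or_dvd (dvd_of_forall_eval_eq_zero hp (g := X 0 * A)
      fun v hv => ?_)).resolve_left (not_dvd_X_zero h0)
    rw [map_mul, eval_X]
    by_cases h : v 0 = 0
    · rw [h, zero_mul]
    rw [← cons_smul_tail h] at hv ⊢
    rw [eval_cons_smul hF] at hv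
    have hv' := (mul_eq_zero.1 hv).resolve_left (pow_ne_zero _ h)
    rw [hA, hc, map_mul, hv', zero_mul, mul_zero, mul_zero]
  · intro h
    have : dehom A = a := MvPolynomial.funext fun z => by
      have := hA 1 z
      rwa [one_smul, one_pow, one_mul, ← eval_dehom] at this
    rw [← this]
    exact map_dvd _ h

theorem prime_dehom [IsAlgClosed K] (hF : F.IsHomogeneous D) (hp : Prime F)
    (h0 : eval (basePt : Fin 4 → K) F = 0) : Prime (dehom F) := by
  refine ⟨fun h => ?_, fun h => ?_, fun a b hab => ?_⟩
  · refine mul_ne_zero (X_ne_zero (0 : Fin 4)) hp.ne_zero (MvPolynomial.funext fun v => ?_)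
    rw [map_mul, eval_X, map_zero]
    by_cases hv : v 0 = 0
    · rw [hv, zero_mul]
    · rw [← cons_smul_tail hv, eval_cons_smul hF, h, map_zero, mul_zero, mul_zero]
  · have h1 := h.map (eval (0 : Fin 3 → K))
    rw [eval_dehom, h0] at h1
    exact not_isUnit_zero h1
  · obtain ⟨A, hA⟩ := exists_homogenization a le_rfl
    obtain ⟨B, hB⟩ := exists_homogenization b le_rfl
    rw [dehom_dvd_iff hF hp h0 hA, dehom_dvd_iff hF hp h0 hB]
    refine hp.dvd_or_dvd ((dehom_dvd_iff hF hp h0 (n := a.totalDegree + b.totalDegree) ?_).1 hab)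
    intro t z
    rw [map_mul, map_mul, hA, hB]
    ring

theorem eq_zero_of_dehom_dvd [IsAlgClosed K] (hF : F.IsHomogeneous D) (hp : Prime F)
    (h0 : eval (basePt : Fin 4 → K) F = 0) (hD : 3 ≤ D) {Q : MvPolynomial (Fin 3) K}
    (hQ : Q.totalDegree ≤ 2) (hdvd : dehom F ∣ Q) : Q = 0 := by
  by_contra hQ0
  have hdeg : (dehom F).totalDegree ≤ 2 := by
    obtain ⟨c, rfl⟩ := hdvd
    rw [totalDegree_mul_of_isDomain (left_ne_zero_of_mul hQ0) (right_ne_zero_of_mul hQ0)] at hQ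
    omega
  obtain ⟨A, hA⟩ := exists_homogenization (dehom F) hdeg
  have heq : X 0 * F = X 0 * (X 0 ^ (D - 2) * A) := by
    refine MvPolynomial.funext fun v => ?_
    rw [map_mul, map_mul, map_mul, map_pow, eval_X]
    by_cases hv : v 0 = 0
    · rw [hv, zero_mul, zero_mul]
    · rw [← cons_smul_tail hv, eval_cons_smul hF, hA, Fin.cons_zero, ← mul_assoc (_ ^ (D - 2)),
        ← pow_add, Nat.sub_add_cancel (by omega)]
  have heq' := mul_left_cancel₀ (X_ne_zero _) heq
  have hX : (X 0 : MvPolynomial (Fin 4) K) ∣ F := by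
    rw [heq']
    exact Dvd.dvd.mul_right (dvd_pow_self _ (by omega)) _
  exact not_dvd_X_zero h0 ((hp.irreducible.dvd_comm X_prime.irreducible).2 hX)

theorem exists_line_dehom (hl : ∀ v, v ≠ 0 → eval v F = 0 →
      ∃ w : Fin 4 → K, (∀ c : K, w ≠ c • v) ∧ ∀ a b : K, eval (a • v + b • w) F = 0)
    (p : Fin 3 → K) (hp : eval p (dehom F) = 0) :
    ∃ w : Fin 3 → K, w ≠ 0 ∧ ∀ s : K, eval (p + s • w) (dehom F) = 0 := by
  rw [eval_dehom] at hp
  obtain ⟨w, hw, hF⟩ := hl _ (fun h => by simpa using congrFun h 0) hp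
  refine ⟨Fin.tail w - w 0 • p, fun h => hw (w 0) ?_, fun s => ?_⟩
  · funext i
    refine Fin.cases ?_ (fun j => ?_) i
    · simp
    · have := congrFun h j
      simpa [Fin.tail, sub_eq_zero] using this
  · rw [eval_dehom, ← hF (1 - s * w 0) s]
    congr 2
    funext i
    refine Fin.cases ?_ (fun j => ?_) i
    · simp
    · simp [Fin.tail]
      ring

theorem false_of_isolated_singularity_basePt [IsAlgClosed K] (hF : F.IsHomogeneous D)
    (hp : Prime F) (hD : 3 ≤ D)
    (h0 : eval (basePt : Fin 4 → K) F = 0)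
    (hd0 : ∀ i, eval (basePt : Fin 4 → K) (pderiv i F) = 0)
    {c : MvPolynomial (Fin 4) K} (hc : eval (basePt : Fin 4 → K) c ≠ 0)
    (hsing : ∀ v : Fin 4 → K, v ≠ 0 → eval v F = 0 → (∀ i, eval v (pderiv i F) = 0) →
      eval v c ≠ 0 → ∃ s : K, v = s • basePt)
    (hl : ∀ v, v ≠ 0 → eval v F = 0 →
      ∃ w : Fin 4 → K, (∀ c : K, w ≠ c • v) ∧ ∀ a b : K, eval (a • v + b • w) F = 0)
    (hdir : ∀ w : Fin 4 → K, w 0 = 0 → w 1 = 0 → (∀ s : K, eval (basePt + s • w) F = 0) → w = 0)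
    (hcone : ¬ ∃ q : Fin 4 → K, q ≠ 0 ∧ ∀ v, eval v F = 0 → ∀ s : K, eval (v + s • q) F = 0) :
    False := by
  have hev : ∀ (s : K) (q v : Fin 4 → K),
      eval v (bind₁ (fun i => X i + C (s * q i)) F) = eval (v + s • q) F := by
    intro s q v
    rw [eval_bind₁_eq]
    congr 2
    funext i
    simp
  refine false_of_isolated_singularity (prime_dehom hF hp h0) (c := dehom c) ?_ ?_ ?_ ?_
    (exists_line_dehom hl) ?_ (fun Q => eq_zero_of_dehom_dvd hF hp h0 hD) ?_ ?_
  · rwa [eval_dehom]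
  · intro i
    rw [pderiv_dehom, eval_dehom, hd0]
  · rwa [eval_dehom]
  · intro p hfp hdp hcp
    rw [eval_dehom] at hfp hcp
    have hd : ∀ i, eval (Fin.cons 1 p : Fin 4 → K) (pderiv i F) = 0 := by
      have hs : ∀ i : Fin 3, eval (Fin.cons 1 p : Fin 4 → K) (pderiv i.succ F) = 0 := fun i => by
        rw [← eval_dehom, ← pderiv_dehom, hdp]
      intro i
      refine Fin.cases ?_ hs i
      have he := congrArg (eval (Fin.cons 1 p : Fin 4 → K)) hF.sum_X_mul_pderiv
      rw [map_sum, Fin.sum_univ_succ] at he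
      simpa [hs, hfp] using he
    obtain ⟨s, hs⟩ := hsing _ (fun h => by simpa using congrFun h 0) hfp hd hcp
    funext i
    simpa using congrFun hs i.succ
  · rintro ⟨w, hw, hw0, hws⟩
    refine hw ?_
    have := hdir (Fin.cons 0 w) (by simp) (by simpa using hw0) fun s => by
      refine Eq.trans ?_ (hws s)
      rw [eval_dehom]
      congr 2
      funext i
      refine Fin.cases ?_ (fun j => ?_) i <;> simp
    funext i
    simpa using congrFun this i.succ
  · rintro ⟨q, hq⟩
    refine hcone ⟨Fin.cons 1 q, fun h => by simpa using congrFun h 0, fun v hv s => ?_⟩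
    have hdvd : F ∣ (X 0 * (X 0 + C s)) * bind₁ (fun i => X i + C (s * (Fin.cons 1 q : Fin 4 → K) i)) F := by
      refine dvd_of_forall_eval_eq_zero hp fun v hv => ?_
      rw [map_mul, map_mul, map_add, eval_X, eval_C, hev]
      by_cases h : v 0 = 0
      · rw [h, zero_mul, zero_mul]
      by_cases h' : v 0 + s = 0
      · rw [h', mul_zero, zero_mul]
      convert mul_zero _
      set z := (v 0)⁻¹ • Fin.tail v with hz
      have hv2 : v = Fin.cons (v 0) (v 0 • z) := (cons_smul_tail h).symm
      have hfz : eval z (dehom F) = 0 := by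
        rw [hv2, eval_cons_smul hF] at hv
        exact (mul_eq_zero.1 hv).resolve_left (pow_ne_zero _ (by simpa using h))
      obtain ⟨e, he⟩ := hq (s / (v 0 + s))
      have he' := congrArg (eval z) he
      rw [map_mul, hfz, zero_mul, eval_bind₁_eq] at he'
      have : v + s • (Fin.cons 1 q : Fin 4 → K) = Fin.cons (v 0 + s) ((v 0 + s) •
          fun i => eval z (X i + C (s / (v 0 + s)) * (C (q i) - X i))) := by
        funext i
        refine Fin.cases ?_ (fun j => ?_) i
        · simp
        · simp [hz, Fin.tail]
          field_simp
          ring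
      rw [this, eval_cons_smul hF, he', mul_zero]
    have h1 : ¬ F ∣ X 0 + C s := by
      rintro ⟨e, he⟩
      have := congrArg (eval ((1 - s) • (basePt : Fin 4 → K))) he
      rw [map_mul, eval_smul_of_isHomogeneous hF, h0, mul_zero, zero_mul] at this
      simp at this
    have h2 := (hp.dvd_or_dvd hdvd).resolve_left fun h =>
      (hp.dvd_or_dvd h).elim (not_dvd_X_zero h0) h1
    obtain ⟨e, he⟩ := h2
    rw [← hev, he, map_mul, hv, zero_mul]
  · rintro ⟨q, hq0, hq⟩
    refine hcone ⟨Fin.cons 0 q, fun h => hq0 (funext fun i => by simpa using congrFun h i.succ),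
      fun v hv s => ?_⟩
    have hdvd : F ∣ X 0 * bind₁ (fun i => X i + C (s * (Fin.cons 0 q : Fin 4 → K) i)) F := by
      refine dvd_of_forall_eval_eq_zero hp fun v hv => ?_
      rw [map_mul, eval_X, hev]
      by_cases h : v 0 = 0
      · rw [h, zero_mul]
      convert mul_zero _
      set z := (v 0)⁻¹ • Fin.tail v with hz
      have hv2 : v = Fin.cons (v 0) (v 0 • z) := (cons_smul_tail h).symm
      have hfz : eval z (dehom F) = 0 := by
        rw [hv2, eval_cons_smul hF] at hv
        exact (mul_eq_zero.1 hv).resolve_left (pow_ne_zero _ (by simpa using h))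
      obtain ⟨e, he⟩ := hq (s / v 0)
      have he' := congrArg (eval z) he
      rw [map_mul, hfz, zero_mul, eval_bind₁_eq] at he'
      have : v + s • (Fin.cons 0 q : Fin 4 → K) = Fin.cons (v 0) (v 0 •
          fun i => eval z (X i + C (s / v 0 * q i))) := by
        funext i
        refine Fin.cases ?_ (fun j => ?_) i
        · simp
        · simp [hz, Fin.tail]
          field_simp
      rw [this, eval_cons_smul hF, he', mul_zero]
    obtain ⟨e, he⟩ := (hp.dvd_or_dvd hdvd).resolve_left (not_dvd_X_zero h0)
    rw [← hev, he, map_mul, hv, zero_mul]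

end Chart

/-! ### Linear changes of coordinates -/

/-- Composition of a polynomial with a linear map. -/
noncomputable def linSub {n : ℕ} (L : (Fin n → K) →ₗ[K] (Fin n → K)) :
    MvPolynomial (Fin n) K →ₐ[K] MvPolynomial (Fin n) K :=
  aeval fun i => ∑ j, C (L (Pi.single j 1) i) * X j

theorem eval_linSub_coord {n : ℕ} (L : (Fin n → K) →ₗ[K] (Fin n → K)) (v : Fin n → K) (i : Fin n) :
    eval v (∑ j, C (L (Pi.single j 1) i) * X j) = L v i := by
  rw [L.pi_apply_eq_sum_univ v, Finset.sum_apply, map_sum]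
  refine Finset.sum_congr rfl fun j _ => ?_
  rw [map_mul, eval_C, eval_X, Pi.smul_apply, smul_eq_mul, mul_comm]
  have h : (Pi.single j 1 : Fin n → K) = fun k => if j = k then 1 else 0 :=
    funext fun k => by simp [Pi.single_apply, eq_comm]
  rw [h]

theorem eval_linSub {n : ℕ} (L : (Fin n → K) →ₗ[K] (Fin n → K)) (F : MvPolynomial (Fin n) K)
    (v : Fin n → K) : eval v (linSub L F) = eval (L v) F := by
  have h := eval_bind₁_eq v (fun i => ∑ j, C (L (Pi.single j 1) i) * X j) F
  rw [funext (eval_linSub_coord L v)] at h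
  exact h

theorem eval_pderiv_linSub {n : ℕ} (L : (Fin n → K) →ₗ[K] (Fin n → K)) {F : MvPolynomial (Fin n) K}
    {v : Fin n → K} (h : ∀ i, eval (L v) (pderiv i F) = 0) (i : Fin n) :
    eval v (pderiv i (linSub L F)) = 0 := by
  rw [linSub, derivation_aeval_eq_sum, map_sum]
  refine Finset.sum_eq_zero fun j _ => ?_
  change eval v (linSub L (pderiv j F) • _) = 0
  rw [smul_eq_mul, map_mul, eval_linSub, h, zero_mul]

theorem linSub_linSub_symm [Infinite K] {n : ℕ} (A : (Fin n → K) ≃ₗ[K] (Fin n → K))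
    (F : MvPolynomial (Fin n) K) :
    linSub A.symm.toLinearMap (linSub A.toLinearMap F) = F :=
  MvPolynomial.funext fun v => by simp [eval_linSub]

theorem prime_linSub [Infinite K] {n : ℕ} (A : (Fin n → K) ≃ₗ[K] (Fin n → K))
    {F : MvPolynomial (Fin n) K} (hF : Prime F) : Prime (linSub A.toLinearMap F) := by
  let e : MvPolynomial (Fin n) K ≃+* MvPolynomial (Fin n) K :=
    { (linSub A.toLinearMap : MvPolynomial (Fin n) K →+* MvPolynomial (Fin n) K) with
      invFun := linSub A.symm.toLinearMap
      left_inv := linSub_linSub_symm A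
      right_inv := linSub_linSub_symm A.symm }
  exact (MulEquiv.prime_iff e.toMulEquiv).2 hF

theorem isHomogeneous_linSub {n : ℕ} (L : (Fin n → K) →ₗ[K] (Fin n → K))
    {F : MvPolynomial (Fin n) K} {D : ℕ} (hF : F.IsHomogeneous D) :
    (linSub L F).IsHomogeneous D := by
  have h := hF.aeval (n := 1) (fun i => ∑ j, C (L (Pi.single j 1) i) * X j) fun i =>
    IsHomogeneous.sum _ _ _ fun j _ => by
      simpa using (isHomogeneous_C (Fin n) (L (Pi.single j 1) i)).mul (isHomogeneous_X K j)
  rwa [one_mul] at h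

theorem exists_linearEquiv_basePt {x : Fin 4 → K} (hx : x ≠ 0)
    {μ : Module.Dual K (Fin 4 → K)} (hμ : μ ≠ 0) (hμx : μ x = 0) :
    ∃ A : (Fin 4 → K) ≃ₗ[K] (Fin 4 → K), A basePt = x ∧ ∀ w, μ (A w) = w 1 := by
  obtain ⟨ν₀, hν₀⟩ : ∃ f : Module.Dual K (Fin 4 → K), f x ≠ 0 := by
    by_contra! h
    exact hx ((Module.forall_dual_apply_eq_zero_iff K x).1 h)
  set ν : Module.Dual K (Fin 4 → K) := (ν₀ x)⁻¹ • ν₀ with hνdef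
  have hν : ν x = 1 := by simp [hνdef, hν₀]
  obtain ⟨u, hu⟩ : ∃ u, μ u ≠ 0 := by
    by_contra! h
    exact hμ (LinearMap.ext h)
  set v₁ : Fin 4 → K := (μ u)⁻¹ • u - ((μ u)⁻¹ * ν u) • x with hv₁
  have hμ1 : μ v₁ = 1 := by simp [hv₁, hμx, hu]
  have hν1 : ν v₁ = 0 := by simp [hv₁, hν]
  have hsurj : Function.Surjective (ν.prod μ) := fun ⟨a, b⟩ =>
    ⟨a • x + b • v₁, by simp [hν, hν1, hμx, hμ1]⟩
  have hrank : Module.finrank K (LinearMap.ker (ν.prod μ)) = 2 := by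
    have h := LinearMap.finrank_range_add_finrank_ker (ν.prod μ)
    rw [LinearMap.range_eq_top.2 hsurj, finrank_top] at h
    simp at h
    omega
  let b := Module.finBasisOfFinrankEq K _ hrank
  have hb : ∀ i, ν (b i) = 0 ∧ μ (b i) = 0 := fun i => by
    simpa [Prod.ext_iff] using (b i).2
  have hli : LinearIndependent K ![x, v₁, (b 0 : Fin 4 → K), (b 1 : Fin 4 → K)] := by
    rw [Fintype.linearIndependent_iff]
    intro g hg
    simp only [Fin.sum_univ_four, Matrix.cons_val] at hg
    have h0 : g 0 = 0 := by simpa [hν, hν1, hb] using congrArg ν hg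
    have h1 : g 1 = 0 := by simpa [hμx, hμ1, hb] using congrArg μ hg
    have hb2 := Fintype.linearIndependent_iff.1 b.linearIndependent ![g 2, g 3] (by
      ext1
      simpa [Fin.sum_univ_two, h0, h1] using hg)
    have h2 := hb2 0
    have h3 := hb2 1
    intro i
    fin_cases i
    exacts [h0, h1, h2, h3]
  let B := basisOfLinearIndependentOfCardEqFinrank hli (by simp)
  have hB : ∀ w, B.equivFun.symm w = w 0 • x + w 1 • v₁ + w 2 • (b 0 : Fin 4 → K) +
      w 3 • (b 1 : Fin 4 → K) := fun w => by
    simp [B, Module.Basis.equivFun_symm_apply, Fin.sum_univ_four]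
  refine ⟨B.equivFun.symm, ?_, fun w => ?_⟩
  · rw [hB]
    have h1 : (basePt : Fin 4 → K) 1 = 0 := rfl
    have h2 : (basePt : Fin 4 → K) 2 = 0 := rfl
    have h3 : (basePt : Fin 4 → K) 3 = 0 := rfl
    rw [h1, h2, h3]
    simp
  · rw [hB]
    simp [hμx, hμ1, hb]

theorem false_of_isolated_singularity_point [IsAlgClosed K] {F : MvPolynomial (Fin 4) K} {D : ℕ}
    (hF : F.IsHomogeneous D) (hp : Prime F) (hD : 3 ≤ D) {x : Fin 4 → K} (hx : x ≠ 0)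
    (h0 : eval x F = 0) (hd0 : ∀ i, eval x (pderiv i F) = 0)
    {c : MvPolynomial (Fin 4) K} (hc : eval x c ≠ 0)
    (hsing : ∀ v, v ≠ 0 → eval v F = 0 → (∀ i, eval v (pderiv i F) = 0) → eval v c ≠ 0 →
      ∃ s : K, v = s • x)
    (hl : ∀ v, v ≠ 0 → eval v F = 0 → ∃ w : Fin 4 → K, (∀ c : K, w ≠ c • v) ∧
      ∀ a b : K, eval (a • v + b • w) F = 0)
    {μ : Module.Dual K (Fin 4 → K)} (hμx : μ x = 0)
    (hμ : ∀ w, μ w = 0 → (∀ s : K, eval (x + s • w) F = 0) → ∃ s : K, w = s • x)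
    (hcone : ¬ ∃ q, q ≠ 0 ∧ ∀ v, eval v F = 0 → ∀ s : K, eval (v + s • q) F = 0) : False := by
  have hμ0 : μ ≠ 0 := by
    rintro rfl
    obtain ⟨w, hw, hw'⟩ := hl x hx h0
    obtain ⟨s, hs⟩ := hμ w rfl fun s => by simpa using hw' 1 s
    exact hw s hs
  obtain ⟨A, hA, hAμ⟩ := exists_linearEquiv_basePt hx hμ0 hμx
  have hev : ∀ (G : MvPolynomial (Fin 4) K) v, eval v (linSub A.toLinearMap G) = eval (A v) G :=
    fun G v => eval_linSub _ G v
  have hpd : ∀ v, (∀ i, eval v (pderiv i (linSub A.toLinearMap F)) = 0) →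
      ∀ i, eval (A v) (pderiv i F) = 0 := fun v h i => by
    rw [← linSub_linSub_symm A F]
    exact eval_pderiv_linSub A.symm.toLinearMap (by simpa using h) i
  refine false_of_isolated_singularity_basePt (isHomogeneous_linSub _ hF) (prime_linSub A hp) hD
    ?_ ?_ (c := linSub A.toLinearMap c) ?_ ?_ ?_ ?_ ?_
  · rwa [hev, hA]
  · exact eval_pderiv_linSub _ (by simpa [hA] using hd0)
  · rwa [hev, hA]
  · intro v hv hFv hdv hcv
    rw [hev] at hFv hcv
    obtain ⟨s, hs⟩ := hsing (A v) (by simpa using hv) hFv (hpd v hdv) hcv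
    refine ⟨s, A.injective ?_⟩
    rw [hs, map_smul, hA]
  · intro v hv hFv
    rw [hev] at hFv
    obtain ⟨w, hw, hw'⟩ := hl (A v) (by simpa using hv) hFv
    refine ⟨A.symm w, fun c hc => hw c ?_, fun a b => ?_⟩
    · rw [← A.apply_symm_apply w, hc, map_smul]
    · rw [hev]
      simpa using hw' a b
  · intro w hw0 hw1 hw
    obtain ⟨s, hs⟩ := hμ (A w) (by rw [hAμ, hw1]) fun s => by
      have := hw s
      rw [hev] at this
      simpa [hA] using this
    rw [← hA, ← map_smul] at hs
    have hs' := A.injective hs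
    have hs0 : s = 0 := by
      rw [hs'] at hw0
      simpa using hw0
    rw [hs', hs0, zero_smul]
  · rintro ⟨q, hq, hq'⟩
    refine hcone ⟨A q, by simpa using hq, fun v hv s => ?_⟩
    have := hq' (A.symm v) (by rw [hev]; simpa using hv) s
    rw [hev] at this
    simpa using this

/-! ### The Zariski topology on projective space -/

section Zariski

variable {n : ℕ}

theorem vanishes_mk_iff (p : MvPolynomial (Fin n) K) {v : Fin n → K} (hv : v ≠ 0) :
    vanishes p (Projectivization.mk K v hv) ↔ ∀ c : K, c ≠ 0 → eval (c • v) p = 0 := by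
  refine ⟨fun h c hc => h _ (smul_ne_zero hc hv) ?_, fun h w hw hwv => ?_⟩
  · rw [Projectivization.mk_eq_mk_iff']
    exact ⟨c, rfl⟩
  · obtain ⟨a, rfl⟩ := (Projectivization.mk_eq_mk_iff' K w v hw hv).1 hwv
    refine h a ?_
    rintro rfl
    exact hw (zero_smul K v)

theorem vanishes_mk_of_isHomogeneous {p : MvPolynomial (Fin n) K} {D : ℕ} (hp : p.IsHomogeneous D)
    {v : Fin n → K} (hv : v ≠ 0) :
    vanishes p (Projectivization.mk K v hv) ↔ eval v p = 0 := by
  rw [vanishes_mk_iff]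
  refine ⟨fun h => by simpa using h 1 one_ne_zero, fun h c _ => ?_⟩
  rw [eval_smul_of_isHomogeneous hp, h, mul_zero]

theorem exists_mk_eq (x : PP K n) : ∃ (v : Fin n → K) (hv : v ≠ 0), Projectivization.mk K v hv = x :=
  ⟨x.rep, x.rep_nonzero, x.mk_rep⟩

/-- Restriction of polynomials to the line through the origin spanned by `v`. -/
noncomputable def restrictLine (v : Fin n → K) : MvPolynomial (Fin n) K →ₐ[K] Polynomial K :=
  aeval fun i => Polynomial.C (v i) * Polynomial.X

theorem eval_restrictLine (v : Fin n → K) (p : MvPolynomial (Fin n) K) (c : K) :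
    (restrictLine v p).eval c = eval (c • v) p := by
  have h := comp_aeval_apply (fun i => Polynomial.C (v i) * Polynomial.X) (Polynomial.aeval c) p
  rw [Polynomial.coe_aeval_eq_eval] at h
  refine h.trans ?_
  rw [aeval_eq_eval]
  congr 2
  funext i
  simp
  ring

/-- The homogeneous prime ideal of a point. -/
noncomputable def ptIdeal (x : PP K n) : Ideal (MvPolynomial (Fin n) K) :=
  RingHom.ker (restrictLine x.rep)

instance isPrime_ptIdeal (x : PP K n) : (ptIdeal x).IsPrime := RingHom.ker_isPrime _

theorem mem_ptIdeal_iff_forall [Infinite K] (p : MvPolynomial (Fin n) K) (x : PP K n) :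
    p ∈ ptIdeal x ↔ ∀ c : K, eval (c • x.rep) p = 0 := by
  rw [ptIdeal, RingHom.mem_ker]
  refine ⟨fun h c => ?_, fun h => Polynomial.funext fun c => ?_⟩
  · rw [← eval_restrictLine, h, Polynomial.eval_zero]
  · rw [eval_restrictLine, h, Polynomial.eval_zero]

theorem mem_ptIdeal_iff [Infinite K] (p : MvPolynomial (Fin n) K) (x : PP K n) :
    p ∈ ptIdeal x ↔ vanishes p x := by
  conv_rhs => rw [← x.mk_rep, vanishes_mk_iff]
  refine ⟨fun h c _ => (mem_ptIdeal_iff_forall p x).1 h c, fun h => ?_⟩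
  have h0 : Polynomial.X * restrictLine x.rep p = 0 := Polynomial.funext fun c => by
    rw [Polynomial.eval_mul, Polynomial.eval_X, eval_restrictLine, Polynomial.eval_zero]
    by_cases hc : c = 0
    · rw [hc, zero_mul]
    · rw [h c hc, mul_zero]
  exact (mul_eq_zero.1 h0).resolve_left Polynomial.X_ne_zero

/-- Points of projective space as points of the prime spectrum of the coordinate ring. -/
noncomputable def toSpec (x : PP K n) : PrimeSpectrum (MvPolynomial (Fin n) K) :=
  ⟨ptIdeal x, isPrime_ptIdeal x⟩

noncomputable instance zariskiTopology : TopologicalSpace (PP K n) :=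
  TopologicalSpace.induced toSpec inferInstance

theorem isInducing_toSpec : Topology.IsInducing (toSpec : PP K n → _) := ⟨rfl⟩

instance noetherianSpace_PP : TopologicalSpace.NoetherianSpace (PP K n) :=
  isInducing_toSpec.noetherianSpace

theorem isClosed_zeroLocus [Infinite K] (s : Set (MvPolynomial (Fin n) K)) :
    IsClosed (zeroLocus s) := by
  refine isClosed_induced_iff.2 ⟨PrimeSpectrum.zeroLocus s, PrimeSpectrum.isClosed_zeroLocus s, ?_⟩
  ext x
  exact forall₂_congr fun p _ => mem_ptIdeal_iff p x

theorem vanishes_homogeneousComponent [Infinite K] {p : MvPolynomial (Fin n) K} {x : PP K n}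
    (h : vanishes p x) (k : ℕ) : vanishes (homogeneousComponent k p) x := by
  have hm := (mem_ptIdeal_iff p x).2 h
  rw [mem_ptIdeal_iff_forall] at hm
  have h0 : ∑ i ∈ Finset.range (p.totalDegree + 1),
      Polynomial.C (eval x.rep (homogeneousComponent i p)) * Polynomial.X ^ i = 0 :=
    Polynomial.funext fun c => by
      rw [Polynomial.eval_zero, ← hm c]
      conv_rhs => rw [← sum_homogeneousComponent p]
      rw [Polynomial.eval_finsetSum, map_sum]
      refine Finset.sum_congr rfl fun i _ => ?_
      rw [eval_smul_of_isHomogeneous (homogeneousComponent_isHomogeneous i p)]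
      simp
      ring
  rw [← x.mk_rep, vanishes_mk_of_isHomogeneous (homogeneousComponent_isHomogeneous k p)]
  by_cases hk : k < p.totalDegree + 1
  · have := congrArg (fun q => Polynomial.coeff q k) h0
    simpa [Polynomial.finsetSum_coeff, Polynomial.coeff_C_mul, Polynomial.coeff_X_pow, hk]
      using this
  · rw [homogeneousComponent_eq_zero _ _ (by omega), map_zero]

theorem vanishes_of_homogeneousComponent [Infinite K] {p : MvPolynomial (Fin n) K} {x : PP K n}
    (h : ∀ k, vanishes (homogeneousComponent k p) x) : vanishes p x := by
  rw [← mem_ptIdeal_iff, ← sum_homogeneousComponent p]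
  exact Ideal.sum_mem _ fun i _ => (mem_ptIdeal_iff _ x).2 (h i)

theorem isClosed_iff_zClosed [Infinite K] {X : Set (PP K n)} : IsClosed X ↔ ZClosed X := by
  constructor
  · intro h
    obtain ⟨t, ht, rfl⟩ := isClosed_induced_iff.1 h
    obtain ⟨s, rfl⟩ := (PrimeSpectrum.isClosed_iff_zeroLocus t).1 ht
    refine ⟨{q | ∃ p ∈ s, ∃ k, q = homogeneousComponent k p}, ?_, ?_⟩
    · rintro _ ⟨p, _, k, rfl⟩
      exact ⟨k, homogeneousComponent_isHomogeneous k p⟩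
    · ext x
      constructor
      · rintro hx _ ⟨p, hp, k, rfl⟩
        exact vanishes_homogeneousComponent ((mem_ptIdeal_iff p x).1 (hx hp)) k
      · intro hx p hp
        exact (mem_ptIdeal_iff p x).2 (vanishes_of_homogeneousComponent fun k => hx _ ⟨p, hp, k, rfl⟩)
  · rintro ⟨s, _, rfl⟩
    exact isClosed_zeroLocus s

theorem isIrreducible_iff_zIrred [Infinite K] {X : Set (PP K n)} :
    IsIrreducible X ↔ ZIrred X := by
  simp only [IsIrreducible, ZIrred, isPreirreducible_iff_isClosed_union_isClosed,
    isClosed_iff_zClosed]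

/-- The ideal of all polynomials vanishing on a subset of projective space. -/
noncomputable def van (X : Set (PP K n)) : Ideal (MvPolynomial (Fin n) K) :=
  PrimeSpectrum.vanishingIdeal (toSpec '' X)

theorem mem_van [Infinite K] {X : Set (PP K n)} {p : MvPolynomial (Fin n) K} :
    p ∈ van X ↔ ∀ x ∈ X, vanishes p x := by
  rw [van, PrimeSpectrum.mem_vanishingIdeal, Set.forall_mem_image]
  exact forall₂_congr fun x _ => mem_ptIdeal_iff p x

theorem isPrime_van {X : Set (PP K n)} (hX : IsIrreducible X) : (van X).IsPrime :=
  PrimeSpectrum.isIrreducible_iff_vanishingIdeal_isPrime.1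
    (hX.image _ isInducing_toSpec.continuous.continuousOn)

theorem exists_mem_van_not_vanishes [Infinite K] {X : Set (PP K n)} (hX : IsClosed X) {x : PP K n}
    (hx : x ∉ X) : ∃ p ∈ van X, (∃ k, p.IsHomogeneous k) ∧ ¬ vanishes p x := by
  obtain ⟨s, hs, rfl⟩ := isClosed_iff_zClosed.1 hX
  simp only [zeroLocus, Set.mem_ofPred_eq, not_forall] at hx
  obtain ⟨p, hp, hpx⟩ := hx
  exact ⟨p, mem_van.2 fun y hy => hy p hp, hs p hp, hpx⟩

theorem van_lt_van [Infinite K] {X Y : Set (PP K n)} (hX : IsClosed X) (h : X ⊂ Y) :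
    van Y < van X := by
  obtain ⟨y, hy, hyX⟩ := Set.exists_of_ssubset h
  obtain ⟨p, hp, -, hpy⟩ := exists_mem_van_not_vanishes hX hyX
  refine lt_of_le_of_ne (fun q hq => mem_van.2 fun x hx => mem_van.1 hq x (h.1 hx)) ?_
  intro he
  rw [← he] at hp
  exact hpy (mem_van.1 hp y hy)

/-! ### Projective subspaces -/

/-- The linear form `f` as a polynomial. -/
noncomputable def linForm (f : Module.Dual K (Fin n → K)) : MvPolynomial (Fin n) K :=
  ∑ i, C (f (Pi.single i 1)) * X i

theorem eval_linForm (f : Module.Dual K (Fin n → K)) (v : Fin n → K) :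
    eval v (linForm f) = f v := by
  rw [linForm, f.pi_apply_eq_sum_univ v, map_sum]
  refine Finset.sum_congr rfl fun j _ => ?_
  rw [map_mul, eval_C, eval_X, smul_eq_mul, mul_comm]
  have h : (Pi.single j 1 : Fin n → K) = fun k => if j = k then 1 else 0 :=
    funext fun k => by simp [Pi.single_apply, eq_comm]
  rw [h]

theorem isHomogeneous_linForm (f : Module.Dual K (Fin n → K)) : (linForm f).IsHomogeneous 1 :=
  IsHomogeneous.sum _ _ _ fun j _ => by
    simpa using (isHomogeneous_C (Fin n) (f (Pi.single j 1))).mul (isHomogeneous_X K j)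

theorem mk_mem_projSub {U : Submodule K (Fin n → K)} {v : Fin n → K} (hv : v ≠ 0) :
    Projectivization.mk K v hv ∈ projSub U ↔ v ∈ U := by
  refine ⟨fun h => h v hv rfl, fun h w hw hwv => ?_⟩
  obtain ⟨a, rfl⟩ := (Projectivization.mk_eq_mk_iff' K w v hw hv).1 hwv
  exact U.smul_mem a h

theorem isClosed_projSub [Infinite K] (U : Submodule K (Fin n → K)) : IsClosed (projSub U) := by
  have h : projSub U = zeroLocus {p | ∃ f : Module.Dual K (Fin n → K), U ≤ LinearMap.ker f ∧
      p = linForm f} := by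
    ext x
    obtain ⟨v, hv, rfl⟩ := exists_mk_eq x
    rw [mk_mem_projSub]
    constructor
    · rintro h _ ⟨f, hf, rfl⟩
      rw [vanishes_mk_of_isHomogeneous (isHomogeneous_linForm f), eval_linForm]
      exact hf h
    · intro h
      by_contra hvU
      obtain ⟨f, hfv, hf⟩ := Submodule.exists_le_ker_of_notMem hvU
      have := h _ ⟨f, hf, rfl⟩
      rw [vanishes_mk_of_isHomogeneous (isHomogeneous_linForm f), eval_linForm] at this
      exact hfv this
  rw [h]
  exact isClosed_zeroLocus _

theorem isIrreducible_projSub [Infinite K] {U : Submodule K (Fin n → K)} (hU : U ≠ ⊥) :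
    IsIrreducible (projSub U) := by
  obtain ⟨u, huU, hu⟩ := U.ne_bot_iff.1 hU
  obtain ⟨i, hi⟩ := Function.ne_iff.1 hu
  refine ⟨⟨Projectivization.mk K u hu, (mk_mem_projSub hu).2 huU⟩, ?_⟩
  rw [isPreirreducible_iff_isClosed_union_isClosed]
  intro A B hA hB hAB
  by_contra! hcon
  obtain ⟨x, hxU, hxA⟩ := Set.not_subset.1 hcon.1
  obtain ⟨y, hyU, hyB⟩ := Set.not_subset.1 hcon.2
  obtain ⟨p, hp, ⟨k, hk⟩, hpx⟩ := exists_mem_van_not_vanishes hA hxA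
  obtain ⟨q, hq, ⟨l, hl⟩, hqy⟩ := exists_mem_van_not_vanishes hB hyB
  obtain ⟨g, hg⟩ := LinearMap.exists_leftInverse_of_injective U.subtype (by simp)
  set L := U.subtype ∘ₗ g with hL
  have hLU : ∀ v, L v ∈ U := fun v => (g v).2
  have hLid : ∀ v ∈ U, L v = v := fun v hv =>
    congrArg U.subtype (LinearMap.congr_fun hg ⟨v, hv⟩)
  obtain ⟨v, hv, rfl⟩ := exists_mk_eq x
  obtain ⟨w, hw, rfl⟩ := exists_mk_eq y
  rw [vanishes_mk_of_isHomogeneous hk] at hpx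
  rw [vanishes_mk_of_isHomogeneous hl] at hqy
  rw [mk_mem_projSub] at hxU hyU
  have h0 : linSub L (p * q * X i) = 0 := MvPolynomial.funext fun z => by
    rw [eval_linSub, map_mul, map_mul, eval_X, map_zero]
    by_cases hz : L z = 0
    · rw [hz, Pi.zero_apply, mul_zero]
    rcases hAB ((mk_mem_projSub hz).2 (hLU z)) with h | h
    · rw [(vanishes_mk_of_isHomogeneous hk hz).1 (mem_van.1 hp _ h), zero_mul, zero_mul]
    · rw [(vanishes_mk_of_isHomogeneous hl hz).1 (mem_van.1 hq _ h), mul_zero, zero_mul]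
  rw [map_mul, map_mul] at h0
  rcases mul_eq_zero.1 h0 with h0 | h0
  · rcases mul_eq_zero.1 h0 with h0 | h0
    · refine hpx ?_
      rw [← hLid v hxU, ← eval_linSub, h0, map_zero]
    · refine hqy ?_
      rw [← hLid w hyU, ← eval_linSub, h0, map_zero]
  · refine hi ?_
    have := congrArg (eval u) h0
    rwa [eval_linSub, hLid u huU, eval_X, map_zero] at this

theorem projSub_span_singleton {v : Fin n → K} (hv : v ≠ 0) :
    projSub (Submodule.span K {v}) = {Projectivization.mk K v hv} := by
  ext x
  obtain ⟨w, hw, rfl⟩ := exists_mk_eq x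
  rw [mk_mem_projSub, Submodule.mem_span_singleton, Set.mem_singleton_iff,
    Projectivization.mk_eq_mk_iff']

theorem isClosed_singleton_PP [Infinite K] (x : PP K n) : IsClosed ({x} : Set (PP K n)) := by
  obtain ⟨v, hv, rfl⟩ := exists_mk_eq x
  rw [← projSub_span_singleton hv]
  exact isClosed_projSub _

/-! ### Dimension -/

theorem dimGE_zero [Infinite K] {X : Set (PP K n)} (hX : X.Nonempty) : dimGE X 0 := by
  obtain ⟨x, hx⟩ := hX
  exact ⟨fun _ => {x}, fun _ => ⟨isClosed_iff_zClosed.1 (isClosed_singleton_PP x),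
    isIrreducible_iff_zIrred.1 isIrreducible_singleton, by simpa using hx⟩,
    fun i j hij => absurd hij (by simp [Fin.eq_zero i, Fin.eq_zero j])⟩

theorem dimGE_succ [Infinite K] {X Y : Set (PP K n)} {d : ℕ} (hX : dimGE X d) (hXY : X ⊂ Y)
    (hY : IsClosed Y) (hY' : IsIrreducible Y) : dimGE Y (d + 1) := by
  obtain ⟨f, hf, hmono⟩ := hX
  refine ⟨Fin.snoc (α := fun _ => Set (PP K n)) f Y, fun i => ?_, Fin.strictMono_iff_lt_succ.2 fun i => ?_⟩
  · refine Fin.lastCases ?_ (fun j => ?_) i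
    · rw [Fin.snoc_last]
      exact ⟨isClosed_iff_zClosed.1 hY, isIrreducible_iff_zIrred.1 hY', subset_rfl⟩
    · rw [Fin.snoc_castSucc]
      exact ⟨(hf j).1, (hf j).2.1, (hf j).2.2.trans hXY.1⟩
  · rw [Fin.snoc_castSucc]
    refine Fin.lastCases ?_ (fun j => ?_) i
    · rw [Fin.succ_last, Fin.snoc_last]
      exact (hf _).2.2.trans_ssubset hXY
    · rw [Fin.succ_castSucc, Fin.snoc_castSucc]
      exact hmono Fin.castSucc_lt_succ

end Zariski

/-! ### The equation of a surface -/

theorem not_lt_chain_six {I : Fin 6 → Ideal (MvPolynomial (Fin 4) K)} (hI : ∀ i, (I i).IsPrime)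
    (h : StrictMono I) : False := by
  let s : LTSeries (PrimeSpectrum (MvPolynomial (Fin 4) K)) :=
    { length := 5
      toFun := fun i => ⟨I i, hI i⟩
      step := fun i => h Fin.castSucc_lt_succ }
  have h1 := Order.LTSeries.length_le_krullDim s
  have h2 : Order.krullDim (PrimeSpectrum (MvPolynomial (Fin 4) K)) = 4 := by
    change ringKrullDim (MvPolynomial (Fin 4) K) = 4
    rw [MvPolynomial.ringKrullDim_of_isNoetherianRing, ringKrullDim_eq_zero_of_field]
    simp
  rw [h2] at h1
  change ((5 : ℕ) : WithBot ℕ∞) ≤ ((4 : ℕ) : WithBot ℕ∞) at h1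
  have h3 : (5 : ℕ) ≤ 4 := by exact_mod_cast h1
  omega

theorem van_lt_ker_eval_zero [Infinite K] {n : ℕ} {X : Set (PP K n)} (hX : X.Nonempty) :
    van X < RingHom.ker (eval (0 : Fin n → K)) := by
  obtain ⟨x, hx⟩ := hX
  refine lt_of_le_of_ne (fun p hp => ?_) fun he => ?_
  · have := (mem_ptIdeal_iff_forall p x).1 ((mem_ptIdeal_iff p x).2 (mem_van.1 hp x hx)) 0
    rwa [zero_smul] at this
  · obtain ⟨i, hi⟩ := Function.ne_iff.1 x.rep_nonzero
    have h : (MvPolynomial.X i : MvPolynomial (Fin n) K) ∈ van X := by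
      rw [he, RingHom.mem_ker, eval_X, Pi.zero_apply]
    have := mem_van.1 h x hx
    rw [← x.mk_rep, vanishes_mk_of_isHomogeneous (isHomogeneous_X K i), eval_X] at this
    exact hi this

theorem isHomogeneous_of_dvd_homogeneousComponent {σ : Type*} {F : MvPolynomial σ K} (hF : F ≠ 0)
    (h : F ∣ homogeneousComponent F.totalDegree F) : F.IsHomogeneous F.totalDegree := by
  obtain ⟨q, hq⟩ := h
  have h0 := homogeneousComponent_totalDegree_ne_zero hF
  have hhom := homogeneousComponent_isHomogeneous F.totalDegree F
  have hq0 : q ≠ 0 := by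
    rintro rfl
    rw [mul_zero] at hq
    exact h0 hq
  have hdeg := hhom.totalDegree h0
  rw [hq, totalDegree_mul_of_isDomain hF hq0] at hdeg
  obtain ⟨a, rfl⟩ : ∃ a, q = C a := ⟨_, totalDegree_eq_zero_iff_eq_C.1 (by omega)⟩
  have ha : a ≠ 0 := by
    rintro rfl
    exact hq0 C_0
  have hFe : F = homogeneousComponent F.totalDegree F * C a⁻¹ := by
    conv_rhs => rw [hq]
    rw [mul_assoc, ← C_mul, mul_inv_cancel₀ ha, C_1, mul_one]
  have := hhom.mul (isHomogeneous_C σ a⁻¹)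
  rwa [add_zero, ← hFe] at this

theorem exists_equation [IsAlgClosed K] {S : Set (PP K 4)} (hS : IsClosed S)
    (hirr : IsIrreducible S) (hdim : dimGE S 2) (hne : S ≠ Set.univ) :
    ∃ (F : MvPolynomial (Fin 4) K) (D : ℕ), Prime F ∧ F.IsHomogeneous D ∧
      ∀ p, p ∈ van S ↔ F ∣ p := by
  obtain ⟨x, hx⟩ := (Set.ne_univ_iff_exists_notMem S).1 hne
  obtain ⟨p, hp, -, hpx⟩ := exists_mem_van_not_vanishes hS hx
  have hprime := isPrime_van hirr
  have hbot : van S ≠ ⊥ := by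
    intro h
    rw [h, Ideal.mem_bot] at hp
    refine hpx ?_
    rw [hp]
    exact fun v _ _ => map_zero _
  obtain ⟨F, hFS, hF⟩ := hprime.exists_mem_prime_of_ne_bot hbot
  have hspan : van S = Ideal.span {F} := by
    by_contra hcon
    obtain ⟨f, hf, hmono⟩ := hdim
    have hprimeF : (Ideal.span {F}).IsPrime := (Ideal.span_singleton_prime hF.ne_zero).2 hF
    have hlt : Ideal.span {F} < van (f 2) := by
      have h1 : Ideal.span {F} < van S :=
        lt_of_le_of_ne ((Ideal.span_singleton_le_iff_mem _).2 hFS) (Ne.symm hcon)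
      exact h1.trans_le fun q hq => mem_van.2 fun y hy => mem_van.1 hq y ((hf 2).2.2 hy)
    refine not_lt_chain_six (I := ![⊥, Ideal.span {F}, van (f 2), van (f 1), van (f 0),
      RingHom.ker (eval (0 : Fin 4 → K))]) (fun i => ?_) (Fin.strictMono_iff_lt_succ.2 fun i => ?_)
    · have hv : ∀ j, (van (f j)).IsPrime := fun j =>
        isPrime_van (isIrreducible_iff_zIrred.2 (hf j).2.1)
      fin_cases i
      exacts [Ideal.isPrime_bot, hprimeF, hv 2, hv 1, hv 0, RingHom.ker_isPrime _]
    · have hv : ∀ j k, j < k → van (f k) < van (f j) := fun j k hjk =>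
        van_lt_van (isClosed_iff_zClosed.2 (hf j).1) (hmono hjk)
      fin_cases i
      · exact bot_lt_iff_ne_bot.2 fun h => hF.ne_zero (Ideal.span_singleton_eq_bot.1 h)
      · exact hlt
      · exact hv 1 2 (by decide)
      · exact hv 0 1 (by decide)
      · exact van_lt_ker_eval_zero (hf 0).2.1.1
  have hmem : ∀ p, p ∈ van S ↔ F ∣ p := fun p => by rw [hspan, Ideal.mem_span_singleton]
  refine ⟨F, F.totalDegree, hF, isHomogeneous_of_dvd_homogeneousComponent hF.ne_zero ?_, hmem⟩
  rw [← hmem, mem_van]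
  exact fun x hx => vanishes_homogeneousComponent (mem_van.1 hFS x hx) _

section Equation

variable {S : Set (PP K 4)} {F : MvPolynomial (Fin 4) K} {D : ℕ}

theorem mk_mem_iff_eval_eq_zero [Infinite K] (hS : IsClosed S) (hF : F.IsHomogeneous D)
    (hFS : ∀ p, p ∈ van S ↔ F ∣ p) {v : Fin 4 → K} (hv : v ≠ 0) :
    Projectivization.mk K v hv ∈ S ↔ eval v F = 0 := by
  rw [← vanishes_mk_of_isHomogeneous hF hv]
  refine ⟨fun h => mem_van.1 ((hFS F).2 dvd_rfl) _ h, fun h => ?_⟩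
  by_contra hx
  obtain ⟨p, hp, -, hpx⟩ := exists_mem_van_not_vanishes hS hx
  obtain ⟨q, rfl⟩ := (hFS p).1 hp
  exact hpx fun w hw hwv => by rw [map_mul, h w hw hwv, zero_mul]

theorem gradSpan_eq [Infinite K] (hF : F.IsHomogeneous D)
    (hFS : ∀ p, p ∈ van S ↔ F ∣ p) {v : Fin 4 → K} (hv : eval v F = 0) :
    gradSpan S v = Submodule.span K {fun i => eval v (pderiv i F)} := by
  refine le_antisymm (Submodule.span_le.2 ?_) (Submodule.span_mono ?_)
  · rintro _ ⟨p, ⟨-, hp⟩, rfl⟩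
    obtain ⟨q, rfl⟩ := (hFS p).1 (mem_van.2 hp)
    refine Submodule.mem_span_singleton.2 ⟨eval v q, ?_⟩
    funext i
    simp [hv]
  · rintro _ rfl
    exact ⟨F, ⟨⟨D, hF⟩, mem_van.1 ((hFS F).2 dvd_rfl)⟩, rfl⟩

theorem mk_mem_singLocus [Infinite K] (hS : IsClosed S) (hF : F.IsHomogeneous D)
    (hFS : ∀ p, p ∈ van S ↔ F ∣ p) {v : Fin 4 → K} (hv : v ≠ 0) :
    Projectivization.mk K v hv ∈ singLocus S ↔
      eval v F = 0 ∧ ∀ i, eval v (pderiv i F) = 0 := by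
  rw [singLocus, Set.mem_ofPred_eq, mk_mem_iff_eval_eq_zero hS hF hFS hv]
  refine and_congr_right fun h0 => ?_
  have hrank : ∀ w, eval w F = 0 → (Module.finrank K (gradSpan S w) = 1 ↔
      ¬ ∀ i, eval w (pderiv i F) = 0) := fun w hw => by
    rw [gradSpan_eq hF hFS hw]
    by_cases h : (fun i => eval w (pderiv i F)) = 0
    · rw [h, Submodule.span_zero_singleton, finrank_bot]
      simpa using congrFun h
    · rw [finrank_span_singleton h]
      simpa using fun h' => h (funext h')
  constructor
  · intro h
    by_contra hcon
    refine h fun w hw hwv => ?_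
    obtain ⟨a, rfl⟩ := (Projectivization.mk_eq_mk_iff' K w v hw hv).1 hwv
    have ha : a ≠ 0 := by
      rintro rfl
      exact hw (zero_smul K v)
    rw [hrank _ (by rw [eval_smul_of_isHomogeneous hF, h0, mul_zero])]
    intro h'
    refine hcon fun i => ?_
    have := h' i
    rw [eval_smul_of_isHomogeneous hF.pderiv] at this
    exact (mul_eq_zero.1 this).resolve_left (pow_ne_zero _ ha)
  · intro h hsm
    exact (hrank v h0).1 (hsm v hv rfl) h

theorem singLocus_eq_zeroLocus [Infinite K] (hS : IsClosed S) (hF : F.IsHomogeneous D)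
    (hFS : ∀ p, p ∈ van S ↔ F ∣ p) :
    singLocus S = zeroLocus (insert F (Set.range fun i => pderiv i F)) := by
  ext x
  obtain ⟨v, hv, rfl⟩ := exists_mk_eq x
  rw [mk_mem_singLocus hS hF hFS hv]
  simp only [zeroLocus, Set.mem_ofPred_eq, Set.forall_mem_insert, Set.forall_mem_range,
    vanishes_mk_of_isHomogeneous hF, vanishes_mk_of_isHomogeneous hF.pderiv]

theorem isClosed_singLocus [Infinite K] (hS : IsClosed S) (hF : F.IsHomogeneous D)
    (hFS : ∀ p, p ∈ van S ↔ F ∣ p) : IsClosed (singLocus S) := by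
  rw [singLocus_eq_zeroLocus hS hF hFS]
  exact isClosed_zeroLocus _

theorem singLocus_ne [IsAlgClosed K] (hS : IsClosed S) (hF : F.IsHomogeneous D) (hp : Prime F)
    (hFS : ∀ p, p ∈ van S ↔ F ∣ p) : singLocus S ≠ S := by
  intro h
  obtain ⟨i, hi⟩ := exists_pderiv_ne_zero_of_irreducible hp.irreducible
  have hdvd : F ∣ pderiv i F := by
    rw [← hFS, mem_van]
    intro x hx
    rw [← h] at hx
    obtain ⟨v, hv, rfl⟩ := exists_mk_eq x
    rw [vanishes_mk_of_isHomogeneous hF.pderiv]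
    exact ((mk_mem_singLocus hS hF hFS hv).1 hx).2 i
  have := totalDegree_le_of_dvd_of_isDomain hdvd hi
  have := totalDegree_pderiv_lt hi
  omega

end Equation

/-! ### Lines in Plücker coordinates -/

theorem wedgePt_add_smul (w : Fin 6 → K) (u v : Fin 4 → K) (s t : K) :
    wedgePt w (s • u + t • v) = s • wedgePt w u + t • wedgePt w v := by
  funext i
  fin_cases i <;> simp [wedgePt] <;> ring

theorem wedgePt_smul_left (w : Fin 6 → K) (v : Fin 4 → K) (s : K) :
    wedgePt (s • w) v = s • wedgePt w v := by
  funext i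
  fin_cases i <;> simp [wedgePt] <;> ring

theorem exists_span_of_rows {w : Fin 6 → K} {c : K} (hc : c ≠ 0) (a b : Fin 4)
    (u₁ u₂ : Fin 4 → K) (h₁a : u₁ a = 0) (h₁b : u₁ b = c) (h₂a : u₂ a = -c) (h₂b : u₂ b = 0)
    (h₁ : wedgePt w u₁ = 0) (h₂ : wedgePt w u₂ = 0)
    (h : ∀ v, wedgePt w v = 0 → c • v = v b • u₁ - v a • u₂) :
    ∃ u₁ u₂ : Fin 4 → K, LinearIndependent K ![u₁, u₂] ∧
      ∀ v, wedgePt w v = 0 ↔ v ∈ Submodule.span K {u₁, u₂} := by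
  refine ⟨u₁, u₂, LinearIndependent.pair_iff.2 fun s t hst => ⟨?_, ?_⟩, fun v => ?_⟩
  · simpa [h₁b, h₂b, hc] using congrFun hst b
  · simpa [h₁a, h₂a, hc] using congrFun hst a
  · rw [Submodule.mem_span_pair]
    constructor
    · intro hv
      refine ⟨c⁻¹ * v b, - (c⁻¹ * v a), ?_⟩
      rw [← inv_smul_smul₀ hc v, h v hv]
      simp only [smul_sub, smul_smul, neg_smul, ← sub_eq_add_neg, Pi.sub_apply, Pi.smul_apply,
        smul_eq_mul, h₁a, h₁b, h₂a, h₂b]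
      congr 2 <;> field_simp <;> simp
    · rintro ⟨s, t, rfl⟩
      rw [wedgePt_add_smul, h₁, h₂, smul_zero, smul_zero, add_zero]

theorem exists_span_of_isLineRep {w : Fin 6 → K} (hw : IsLineRep w) :
    ∃ u₁ u₂ : Fin 4 → K, LinearIndependent K ![u₁, u₂] ∧
      ∀ v, wedgePt w v = 0 ↔ v ∈ Submodule.span K {u₁, u₂} := by
  obtain ⟨hw0, hq⟩ := hw
  rw [plQuad] at hq
  have hv : ∀ v, wedgePt w v = 0 → (w 0 * v 2 - w 1 * v 1 + w 3 * v 0 = 0 ∧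
      w 0 * v 3 - w 2 * v 1 + w 4 * v 0 = 0 ∧ w 1 * v 3 - w 2 * v 2 + w 5 * v 0 = 0 ∧
      w 3 * v 3 - w 4 * v 2 + w 5 * v 1 = 0) := fun v h =>
    ⟨congrFun h 0, congrFun h 1, congrFun h 2, congrFun h 3⟩
  have h₀ : wedgePt w ![0, w 0, w 1, w 2] = 0 := by
    funext i
    fin_cases i <;> simp [wedgePt] <;> first | ring1 | linear_combination hq
  have h₁ : wedgePt w ![-w 0, 0, w 3, w 4] = 0 := by
    funext i
    fin_cases i <;> simp [wedgePt] <;> first | ring1 | linear_combination hq | linear_combination -hq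
  have h₂ : wedgePt w ![-w 1, -w 3, 0, w 5] = 0 := by
    funext i
    fin_cases i <;> simp [wedgePt] <;> first | ring1 | linear_combination hq | linear_combination -hq
  have h₃ : wedgePt w ![-w 2, -w 4, -w 5, 0] = 0 := by
    funext i
    fin_cases i <;> simp [wedgePt] <;> first | ring1 | linear_combination hq | linear_combination -hq
  obtain ⟨k, hk⟩ := Function.ne_iff.1 hw0
  fin_cases k
  on_goal 1 => refine exists_span_of_rows hk 0 1 _ _ rfl rfl rfl rfl h₀ h₁ fun v h => ?_
  on_goal 2 => refine exists_span_of_rows hk 0 2 _ _ rfl rfl rfl rfl h₀ h₂ fun v h => ?_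
  on_goal 3 => refine exists_span_of_rows hk 0 3 _ _ rfl rfl rfl rfl h₀ h₃ fun v h => ?_
  on_goal 4 => refine exists_span_of_rows hk 1 2 _ _ rfl rfl rfl rfl h₁ h₂ fun v h => ?_
  on_goal 5 => refine exists_span_of_rows hk 1 3 _ _ rfl rfl rfl rfl h₁ h₃ fun v h => ?_
  on_goal 6 => refine exists_span_of_rows hk 2 3 _ _ rfl rfl rfl rfl h₂ h₃ fun v h => ?_
  all_goals
    obtain ⟨e0, e1, e2, e3⟩ := hv v h
    funext i
    fin_cases i <;> simp <;> first
      | ring1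
      | linear_combination e0
      | linear_combination e1
      | linear_combination e2
      | linear_combination e3
      | linear_combination -e0
      | linear_combination -e1
      | linear_combination -e2
      | linear_combination -e3

theorem exists_lineOfRep_eq_projSub {w : Fin 6 → K} (hw : IsLineRep w) :
    ∃ u₁ u₂ : Fin 4 → K, LinearIndependent K ![u₁, u₂] ∧
      lineOfRep w = projSub (Submodule.span K {u₁, u₂}) := by
  obtain ⟨u₁, u₂, hu, h⟩ := exists_span_of_isLineRep hw
  refine ⟨u₁, u₂, hu, Set.ext fun x => ?_⟩
  exact forall₃_congr fun v _ _ => h v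

theorem lineOf_mk {w : Fin 6 → K} (hw : w ≠ 0) :
    lineOf (Projectivization.mk K w hw) = lineOfRep w := by
  refine Set.ext fun p => ⟨fun h => h w hw rfl, fun h w' hw' he v hv hvp => ?_⟩
  obtain ⟨a, rfl⟩ := (Projectivization.mk_eq_mk_iff' K w' w hw' hw).1 he
  rw [wedgePt_smul_left, h v hv hvp, smul_zero]

theorem exists_lineOf_eq_projSub {x : PP K 6} (hx : x ∈ grass K) :
    ∃ u₁ u₂ : Fin 4 → K, LinearIndependent K ![u₁, u₂] ∧
      lineOf x = projSub (Submodule.span K {u₁, u₂}) := by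
  obtain ⟨w, hw, rfl, hq⟩ := hx
  rw [lineOf_mk]
  exact exists_lineOfRep_eq_projSub ⟨hw, hq⟩

/-! ### Lines on a surface -/

section Lines

variable {n : ℕ} {F : MvPolynomial (Fin n) K} {D : ℕ}

/-- Restriction of a polynomial to the affine line through `a` in direction `b`. -/
noncomputable def restrictAff (a b : Fin n → K) (F : MvPolynomial (Fin n) K) : Polynomial K :=
  aeval (fun i => Polynomial.C (a i) + Polynomial.C (b i) * Polynomial.X) F

theorem eval_restrictAff (a b : Fin n → K) (F : MvPolynomial (Fin n) K) (c : K) :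
    (restrictAff a b F).eval c = eval (a + c • b) F := by
  have h := comp_aeval_apply (fun i => Polynomial.C (a i) + Polynomial.C (b i) * Polynomial.X)
    (Polynomial.aeval c) F
  rw [Polynomial.coe_aeval_eq_eval] at h
  refine h.trans ?_
  rw [aeval_eq_eval]
  congr 2
  funext i
  simp
  ring

theorem natDegree_restrictAff_le (a b : Fin n → K) (hF : F.IsHomogeneous D) :
    (restrictAff a b F).natDegree ≤ D := by
  have h := aeval_natDegree_le (n := 1) F hF.totalDegree_le
    (fun i => Polynomial.C (a i) + Polynomial.C (b i) * Polynomial.X) fun i => by compute_degree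
  rwa [mul_one] at h

theorem eval_eq_zero_of_forall_ne_zero [Infinite K] {a b : Fin n → K}
    (h : ∀ c : K, c ≠ 0 → eval (a + c • b) F = 0) : eval a F = 0 := by
  have h0 : Polynomial.X * restrictAff a b F = 0 := Polynomial.funext fun c => by
    rw [Polynomial.eval_mul, Polynomial.eval_X, eval_restrictAff, Polynomial.eval_zero]
    by_cases hc : c = 0
    · rw [hc, zero_mul]
    · rw [h c hc, mul_zero]
  have h1 := (mul_eq_zero.1 h0).resolve_left Polynomial.X_ne_zero
  have h2 := eval_restrictAff a b F 0
  rwa [h1, Polynomial.eval_zero, zero_smul, add_zero, eq_comm] at h2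

theorem eval_eq_zero_of_forall_add_smul [Infinite K] (hF : F.IsHomogeneous D) {a b : Fin n → K}
    (h : ∀ c : K, eval (a + c • b) F = 0) (s t : K) : eval (s • a + t • b) F = 0 := by
  have hne : ∀ s : K, s ≠ 0 → eval (s • a + t • b) F = 0 := fun s hs => by
    have : s • a + t • b = s • (a + (s⁻¹ * t) • b) := by
      rw [smul_add, smul_smul, mul_inv_cancel_left₀ hs]
    rw [this, eval_smul_of_isHomogeneous hF, h, mul_zero]
  by_cases hs : s = 0
  · rw [hs, zero_smul, zero_add]
    refine eval_eq_zero_of_forall_ne_zero (b := a) fun c hc => ?_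
    rw [add_comm]
    exact hne c hc
  · exact hne s hs

end Lines

section Surface

variable {S : Set (PP K 4)} {F : MvPolynomial (Fin 4) K} {D : ℕ}

theorem exists_line_through_of_ruled (hF : F.IsHomogeneous D)
    (hFS : ∀ v (hv : v ≠ 0), Projectivization.mk K v hv ∈ S ↔ eval v F = 0)
    (hr : ∀ p ∈ S, ∃ x ∈ linesOf S, p ∈ lineOf x) {v : Fin 4 → K} (hv : v ≠ 0)
    (hFv : eval v F = 0) : ∃ w : Fin 4 → K, (∀ c : K, w ≠ c • v) ∧
      ∀ a b : K, eval (a • v + b • w) F = 0 := by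
  obtain ⟨x, ⟨hxg, hxS⟩, hvx⟩ := hr _ ((hFS v hv).2 hFv)
  obtain ⟨u₁, u₂, hu, hx⟩ := exists_lineOf_eq_projSub hxg
  rw [hx] at hxS hvx
  rw [mk_mem_projSub] at hvx
  have hmem : ∀ w ∈ Submodule.span K {u₁, u₂}, ∀ a b : K, eval (a • v + b • w) F = 0 := by
    intro w hw a b
    by_cases h : a • v + b • w = 0
    · rw [h, ← zero_smul K v, eval_smul_of_isHomogeneous hF, hFv, mul_zero]
    · exact (hFS _ h).1 (hxS ((mk_mem_projSub h).2
        (add_mem (Submodule.smul_mem _ _ hvx) (Submodule.smul_mem _ _ hw))))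
  have h1 : u₁ ∈ Submodule.span K {u₁, u₂} := Submodule.subset_span (by simp)
  have h2 : u₂ ∈ Submodule.span K {u₁, u₂} := Submodule.subset_span (by simp)
  by_contra! hcon
  rw [LinearIndependent.pair_iff] at hu
  have hex : ∀ u ∈ Submodule.span K {u₁, u₂}, ∃ c : K, u = c • v := fun u hu => by
    by_contra! hc
    obtain ⟨a, b, hab⟩ := hcon u hc
    exact hab (hmem u hu a b)
  obtain ⟨c₁, hc₁⟩ := hex u₁ h1
  obtain ⟨c₂, hc₂⟩ := hex u₂ h2
  have h3 := hu c₂ (-c₁) (by rw [hc₁, hc₂, smul_smul, smul_smul, neg_mul, neg_smul, mul_comm,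
    add_neg_cancel])
  have h4 := hu 1 0 (by rw [hc₁, neg_eq_zero.1 h3.2]; simp)
  exact one_ne_zero h4.1

theorem le_degree_of_ncard_eq [Infinite K] (hF : F.IsHomogeneous D)
    (hFS : ∀ v (hv : v ≠ 0), Projectivization.mk K v hv ∈ S ↔ eval v F = 0)
    {w : Fin 6 → K} (hw : IsLineRep w) (hwS : ¬ lineOfRep w ⊆ S) {d : ℕ}
    (hd : (S ∩ lineOfRep w).ncard = d) : d ≤ D := by
  obtain ⟨u₁, u₂, -, hx⟩ := exists_lineOfRep_eq_projSub hw
  rw [hx] at hwS hd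
  obtain ⟨y, hy, hyS⟩ := Set.not_subset.1 hwS
  obtain ⟨b, hb, rfl⟩ := exists_mk_eq y
  rw [hFS] at hyS
  rw [mk_mem_projSub] at hy
  obtain ⟨a, ha⟩ : ∃ a, ∀ v ∈ Submodule.span K {u₁, u₂}, ∃ s t : K, v = s • a + t • b := by
    obtain ⟨p, q, hpq⟩ := Submodule.mem_span_pair.1 hy
    by_cases hp : p = 0
    · have hq : q ≠ 0 := by
        rintro rfl
        exact hb (by rw [← hpq, hp]; simp)
      refine ⟨u₁, fun v hv => ?_⟩
      obtain ⟨s, t, rfl⟩ := Submodule.mem_span_pair.1 hv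
      refine ⟨s, t * q⁻¹, ?_⟩
      rw [← hpq, hp, zero_smul, zero_add, smul_smul, inv_mul_cancel_right₀ hq]
    · refine ⟨u₂, fun v hv => ?_⟩
      obtain ⟨s, t, rfl⟩ := Submodule.mem_span_pair.1 hv
      refine ⟨t - s * p⁻¹ * q, s * p⁻¹, ?_⟩
      rw [← hpq, smul_add, smul_smul, smul_smul, inv_mul_cancel_right₀ hp, sub_smul]
      abel
  have hP : restrictAff a b F ≠ 0 := by
    intro h
    refine hyS ?_
    have := eval_eq_zero_of_forall_add_smul hF (a := a) (b := b)
      (fun c => by rw [← eval_restrictAff, h, Polynomial.eval_zero]) 0 1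
    simpa using this
  have hroot : ∀ x ∈ S ∩ projSub (Submodule.span K {u₁, u₂}), ∃ τ : K,
      (restrictAff a b F).IsRoot τ ∧ ∃ h, x = Projectivization.mk K (a + τ • b) h := by
    rintro x ⟨hxS, hxL⟩
    obtain ⟨v, hv, rfl⟩ := exists_mk_eq x
    rw [hFS] at hxS
    rw [mk_mem_projSub] at hxL
    obtain ⟨s, t, rfl⟩ := ha v hxL
    have hs : s ≠ 0 := by
      rintro rfl
      rw [zero_smul, zero_add] at hxS hv
      rw [eval_smul_of_isHomogeneous hF] at hxS
      refine hyS ((mul_eq_zero.1 hxS).resolve_left (pow_ne_zero _ ?_))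
      rintro rfl
      exact hv (zero_smul K b)
    have he : s • a + t • b = s • (a + (s⁻¹ * t) • b) := by
      rw [smul_add, smul_smul, mul_inv_cancel_left₀ hs]
    refine ⟨s⁻¹ * t, ?_, ?_, ?_⟩
    · rw [he, eval_smul_of_isHomogeneous hF] at hxS
      rw [Polynomial.IsRoot, eval_restrictAff]
      exact (mul_eq_zero.1 hxS).resolve_left (pow_ne_zero _ hs)
    · intro h
      rw [he, h, smul_zero] at hv
      exact hv rfl
    · rw [Projectivization.mk_eq_mk_iff']
      exact ⟨s, he.symm⟩
  classical
  choose! f hf hf' using hroot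
  have hle := Set.ncard_le_ncard_of_injOn (t := ((restrictAff a b F).roots.toFinset : Set K)) f
    (fun x hx => by simpa [hP] using hf x hx)
    (fun x hx y hy hxy => by
      obtain ⟨h1, h1'⟩ := hf' x hx
      obtain ⟨h2, h2'⟩ := hf' y hy
      rw [h1', h2', Projectivization.mk_eq_mk_iff']
      exact ⟨1, by rw [hxy, one_smul]⟩)
    (Finset.finite_toSet _)
  rw [hd, Set.ncard_coe_finset] at hle
  calc d ≤ _ := hle
    _ ≤ _ := Multiset.toFinset_card_le _
    _ ≤ _ := Polynomial.card_roots' _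
    _ ≤ D := natDegree_restrictAff_le a b hF

theorem irreducible_linForm {n : ℕ} {f : Module.Dual K (Fin n → K)} (hf : f ≠ 0) :
    Irreducible (linForm f) := by
  have h0 : linForm f ≠ 0 := fun h => hf (LinearMap.ext fun v => by
    rw [← eval_linForm, h, map_zero, LinearMap.zero_apply])
  refine irreducible_of_totalDegree_eq_one ((isHomogeneous_linForm f).totalDegree h0) fun x hx => ?_
  refine isUnit_iff_ne_zero.2 ?_
  rintro rfl
  exact h0 (MvPolynomial.ext _ _ fun m => by rw [zero_dvd_iff.1 (hx m), coeff_zero])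

theorem isCone_of_forall_add_smul [IsAlgClosed K] (hF : F.IsHomogeneous D) (hp : Prime F)
    (hD : 2 ≤ D) (hFS : ∀ v (hv : v ≠ 0), Projectivization.mk K v hv ∈ S ↔ eval v F = 0)
    {q : Fin 4 → K} (hq : q ≠ 0) (h : ∀ v, eval v F = 0 → ∀ s : K, eval (v + s • q) F = 0) :
    IsCone S := by
  refine ⟨Projectivization.mk K q hq, fun x ⟨hxg, hxS⟩ => ?_⟩
  obtain ⟨u₁, u₂, hu, hx⟩ := exists_lineOf_eq_projSub hxg
  rw [hx] at hxS ⊢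
  rw [mk_mem_projSub]
  by_contra hqU
  have hli : LinearIndependent K (Fin.cons q ![u₁, u₂] : Fin 3 → Fin 4 → K) :=
    linearIndependent_finCons.2 ⟨hu, by simpa [Set.pair_comm] using hqU⟩
  set W := Submodule.span K (Set.range (Fin.cons q ![u₁, u₂] : Fin 3 → Fin 4 → K)) with hW
  have hrank : Module.finrank K W = 3 := by
    rw [finrank_span_eq_card hli, Fintype.card_fin]
  have hFW : ∀ v ∈ W, eval v F = 0 := by
    intro v hv
    rw [hW, Fin.range_cons, Submodule.mem_span_insert] at hv
    obtain ⟨s, z, hz, rfl⟩ := hv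
    rw [add_comm]
    refine h z ?_ s
    have hz' : z ∈ Submodule.span K {u₁, u₂} := by simpa [Set.pair_comm] using hz
    have hne : ∀ u, u ≠ 0 → u ∈ Submodule.span K {u₁, u₂} → eval u F = 0 := fun u hu0 hu =>
      (hFS u hu0).1 (hxS ((mk_mem_projSub hu0).2 hu))
    by_cases hz0 : z = 0
    · rw [hz0, ← zero_smul K u₁, eval_smul_of_isHomogeneous hF, hne u₁ (hu.ne_zero 0)
        (Submodule.subset_span (by simp)), mul_zero]
    · exact hne z hz0 hz'
  obtain ⟨f, hf, hWf⟩ := Submodule.exists_le_ker_of_lt_top W (lt_top_iff_ne_top.2 fun ht => by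
    rw [ht, finrank_top, Module.finrank_fin_fun] at hrank
    omega)
  have hker : W = LinearMap.ker f := Submodule.eq_of_le_of_finrank_le hWf (by
    have := Module.Dual.finrank_ker_add_one_of_ne_zero hf
    rw [Module.finrank_fin_fun] at this
    omega)
  have hirr := irreducible_linForm hf
  have hdvd : linForm f ∣ F := dvd_of_forall_eval_eq_zero hirr.prime fun v hv => hFW v (by
    rw [hker, LinearMap.mem_ker, ← eval_linForm, hv])
  have h1 := totalDegree_le_of_dvd_of_isDomain (hirr.associated_of_dvd hp.irreducible hdvd).dvd'
    hirr.ne_zero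
  rw [hF.totalDegree hp.ne_zero, (isHomogeneous_linForm f).totalDegree hirr.ne_zero] at h1
  omega

/-- Only finitely many lines of a surface which is not a cone pass through a given point, so that
a general plane through the point contains none of them. -/
theorem exists_dual_avoiding_lines [IsAlgClosed K] (hF : F.IsHomogeneous D)
    (hS : IsClosed S) (hirr : IsIrreducible S) (hdim : ¬ dimGE S 3)
    (hFS : ∀ v (hv : v ≠ 0), Projectivization.mk K v hv ∈ S ↔ eval v F = 0)
    (hcone : ¬ ∃ q, q ≠ 0 ∧ ∀ v, eval v F = 0 → ∀ s : K, eval (v + s • q) F = 0)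
    {x : Fin 4 → K} (hx : x ≠ 0) (hFx : eval x F = 0) :
    ∃ μ : Module.Dual K (Fin 4 → K), μ x = 0 ∧
      ∀ w, μ w = 0 → (∀ s : K, eval (x + s • w) F = 0) → ∃ s : K, w = s • x := by
  set T : Set (PP K 4) :=
    zeroLocus (Set.range fun s : K => bind₁ (fun i => X i + C (s * x i)) F) with hT
  have hTcl : IsClosed T := isClosed_zeroLocus _
  have hTmem : ∀ v (hv : v ≠ 0), Projectivization.mk K v hv ∈ T ↔
      ∀ s c : K, c ≠ 0 → eval (c • v + s • x) F = 0 := by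
    intro v hv
    simp only [hT, zeroLocus, Set.mem_ofPred_eq, Set.forall_mem_range, vanishes_mk_iff,
      eval_bind₁_eq, map_add, eval_X, eval_C]
    rfl
  have hTS : T ⊂ S := by
    refine Set.ssubset_iff_subset_ne.2 ⟨fun y hy => ?_, fun he => hcone ⟨x, hx, fun v hv s => ?_⟩⟩
    · obtain ⟨v, hv, rfl⟩ := exists_mk_eq y
      rw [hFS]
      simpa using (hTmem v hv).1 hy 0 1 one_ne_zero
    · by_cases hv0 : v = 0
      · rw [hv0, zero_add, eval_smul_of_isHomogeneous hF, hFx, mul_zero]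
      · have := (hFS v hv0).2 hv
        rw [← he, hTmem] at this
        simpa using this s 1 one_ne_zero
  obtain ⟨Z, hZfin, hZcl, hZirr, hTZ⟩ :=
    TopologicalSpace.NoetherianSpace.exists_finite_set_isClosed_irreducible hTcl
  set L : (Fin 4 → K) → Set (PP K 4) := fun w => projSub (Submodule.span K {x, w}) with hL
  have hline : ∀ w, (∀ s : K, w ≠ s • x) → (∀ s : K, eval (x + s • w) F = 0) → L w ∈ Z := by
    intro w hw hFw
    have hLT : L w ⊆ T := by
      intro y hy
      obtain ⟨v, hv, rfl⟩ := exists_mk_eq y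
      obtain ⟨a, b, rfl⟩ := Submodule.mem_span_pair.1 ((mk_mem_projSub hv).1 hy)
      rw [hTmem]
      intro s c _
      have : c • (a • x + b • w) + s • x = (c * a + s) • x + (c * b) • w := by module
      rw [this]
      exact eval_eq_zero_of_forall_add_smul hF hFw _ _
    have hxw : Submodule.span K {x, w} ≠ ⊥ := (Submodule.ne_bot_iff _).2
      ⟨x, Submodule.subset_span (by simp), hx⟩
    have hLirr : IsIrreducible (L w) := isIrreducible_projSub hxw
    obtain ⟨z, hz, hLz⟩ := isIrreducible_iff_sUnion_isClosed.1 hLirr hZfin.toFinset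
      (fun z hz => hZcl z (hZfin.mem_toFinset.1 hz)) (by
        rw [hZfin.coe_toFinset, ← hTZ]
        exact hLT)
    rw [hZfin.mem_toFinset] at hz
    by_cases he : L w = z
    · rwa [he]
    exfalso
    have hzS : z ⊂ S := by
      refine lt_of_le_of_lt ?_ hTS
      rw [hTZ]
      exact Set.subset_sUnion_of_mem hz
    have hw0 : w ≠ 0 := fun h => hw 0 (by rw [h, zero_smul])
    have hxL : ({Projectivization.mk K x hx} : Set (PP K 4)) ⊂ L w := by
      refine Set.ssubset_iff_subset_ne.2 ⟨Set.singleton_subset_iff.2 ((mk_mem_projSub hx).2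
        (Submodule.subset_span (by simp))), fun he => ?_⟩
      have hwL : Projectivization.mk K w hw0 ∈ L w :=
        (mk_mem_projSub hw0).2 (Submodule.subset_span (by simp))
      rw [← he, Set.mem_singleton_iff, Projectivization.mk_eq_mk_iff'] at hwL
      obtain ⟨s, hs⟩ := hwL
      exact hw s hs.symm
    have h1 := dimGE_succ (dimGE_zero (Set.singleton_nonempty _)) hxL (isClosed_projSub _) hLirr
    have h2 := dimGE_succ h1 (Set.ssubset_iff_subset_ne.2 ⟨hLz, he⟩) (hZcl z hz) (hZirr z hz)
    exact hdim (dimGE_succ h2 hzS hS hirr)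
  let I := {z : Set (PP K 4) // z ∈ Z ∧ ∃ w, (∀ s : K, w ≠ s • x) ∧ L w = z}
  have : Finite I := (hZfin.subset fun z hz => hz.1 : {z | z ∈ Z ∧
    ∃ w, (∀ s : K, w ≠ s • x) ∧ L w = z}.Finite).to_subtype
  choose g hg hg' using fun z : I => z.2.2
  obtain ⟨f, hf⟩ := Module.exists_dual_forall_apply_ne_zero (K := K)
    (fun z : I => (Submodule.span K {x}).mkQ (g z)) fun z h => by
      rw [Submodule.mkQ_apply, Submodule.Quotient.mk_eq_zero, Submodule.mem_span_singleton] at h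
      obtain ⟨s, hs⟩ := h
      exact hg z s hs.symm
  have hfx : (f ∘ₗ (Submodule.span K {x}).mkQ) x = 0 := by
    have : (Submodule.span K {x}).mkQ x = 0 :=
      (Submodule.Quotient.mk_eq_zero _).2 (Submodule.mem_span_singleton_self x)
    rw [LinearMap.comp_apply, this, map_zero]
  refine ⟨f ∘ₗ (Submodule.span K {x}).mkQ, hfx, fun w hw hFw => ?_⟩
  by_contra! hcon
  let z : I := ⟨L w, hline w hcon hFw, w, hcon, rfl⟩
  have hgz : g z ≠ 0 := fun h => hg z 0 (by rw [h, zero_smul])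
  have hmem : Projectivization.mk K (g z) hgz ∈ L w := by
    rw [← show L (g z) = L w from hg' z]
    exact (mk_mem_projSub hgz).2 (Submodule.subset_span (by simp))
  obtain ⟨a, b, hab⟩ := Submodule.mem_span_pair.1 ((mk_mem_projSub hgz).1 hmem)
  refine hf z ?_
  change (f ∘ₗ (Submodule.span K {x}).mkQ) (g z) = 0
  rw [← hab, map_add, map_smul, map_smul, hfx, hw, smul_zero, smul_zero, add_zero]

end Surface

/-! STATEMENT 8: the singular locus of a ruled surface of degree ≥ 3 (not a cone)
is empty or purely 1-dimensional; in particular there are no isolated singular points. -/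

theorem statement_8 (K : Type) [Field K] [IsAlgClosed K]
    (S : Set (PP K 4)) (d : ℕ) (hd : 3 ≤ d)
    (hruled : IsRuled S) (hdeg : HasSurfDeg S d) (hcone : ¬ IsCone S) :
    singLocus S = ∅ ∨
      (∀ x ∈ singLocus S, ∃ W : Set (PP K 4),
        ZClosed W ∧ ZIrred W ∧ HasDim W 1 ∧ W ⊆ singLocus S ∧ x ∈ W) := by
  refine Or.inr fun x hx => ?_
  obtain ⟨hcl, hirr, ⟨hdim, hdim'⟩, hr⟩ := hruled
  rw [← isClosed_iff_zClosed] at hcl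
  rw [← isIrreducible_iff_zIrred] at hirr
  obtain ⟨-, w, hw, hwS, hwd⟩ := hdeg
  have hne : S ≠ Set.univ := by
    rintro rfl
    exact hwS (Set.subset_univ _)
  obtain ⟨F, D, hp, hF, hvan⟩ := exists_equation hcl hirr hdim hne
  have hFS : ∀ v (hv : v ≠ 0), Projectivization.mk K v hv ∈ S ↔ eval v F = 0 :=
    fun v hv => mk_mem_iff_eval_eq_zero hcl hF hvan hv
  have hD : 3 ≤ D := hd.trans (le_degree_of_ncard_eq hF hFS hw hwS hwd)
  have hcone' : ¬ ∃ q, q ≠ 0 ∧ ∀ v, eval v F = 0 → ∀ s : K, eval (v + s • q) F = 0 :=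
    fun ⟨q, hq, h⟩ => hcone (isCone_of_forall_add_smul hF hp (by omega) hFS hq h)
  have hsub : singLocus S ⊂ S := Set.ssubset_iff_subset_ne.2
    ⟨fun y hy => hy.1, singLocus_ne hcl hF hp hvan⟩
  obtain ⟨Z, hZfin, hZcl, hZirr, hZ⟩ :=
    TopologicalSpace.NoetherianSpace.exists_finite_set_isClosed_irreducible
      (isClosed_singLocus hcl hF hvan)
  have hZsub : ∀ W ∈ Z, W ⊆ singLocus S := fun W hW => by
    rw [hZ]
    exact Set.subset_sUnion_of_mem hW
  by_cases hex : ∃ W ∈ Z, x ∈ W ∧ W ≠ {x}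
  · obtain ⟨W, hWZ, hxW, hWx⟩ := hex
    refine ⟨W, isClosed_iff_zClosed.1 (hZcl W hWZ), isIrreducible_iff_zIrred.1 (hZirr W hWZ),
      ⟨?_, fun h => ?_⟩, hZsub W hWZ, hxW⟩
    · exact dimGE_succ (dimGE_zero (Set.singleton_nonempty x)) (Set.ssubset_iff_subset_ne.2
        ⟨Set.singleton_subset_iff.2 hxW, hWx.symm⟩) (hZcl W hWZ) (hZirr W hWZ)
    · exact hdim' (dimGE_succ h ((hZsub W hWZ).trans_ssubset hsub) hcl hirr)
  · exfalso
    push Not at hex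
    have hB : IsClosed (⋃₀ {W ∈ Z | x ∉ W}) := by
      rw [Set.sUnion_eq_biUnion]
      exact (hZfin.subset (Set.sep_subset Z _)).isClosed_biUnion fun W hW => hZcl W hW.1
    obtain ⟨c, hcB, ⟨k, hk⟩, hcx⟩ := exists_mem_van_not_vanishes hB (x := x)
      (fun ⟨W, hW, hxW⟩ => hW.2 hxW)
    obtain ⟨v, hv, rfl⟩ := exists_mk_eq x
    rw [vanishes_mk_of_isHomogeneous hk] at hcx
    obtain ⟨h0, hd0⟩ := (mk_mem_singLocus hcl hF hvan hv).1 hx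
    obtain ⟨μ, hμv, hμ⟩ := exists_dual_avoiding_lines hF hcl hirr hdim' hFS hcone' hv h0
    refine false_of_isolated_singularity_point hF hp hD hv h0 hd0 hcx (fun u hu hu0 hud huc => ?_)
      (fun u hu hu0 => exists_line_through_of_ruled hF hFS hr hu hu0) hμv hμ hcone'
    have husing := (mk_mem_singLocus hcl hF hvan hu).2 ⟨hu0, hud⟩
    rw [hZ] at husing
    obtain ⟨W, hWZ, huW⟩ := husing
    by_cases hvW : Projectivization.mk K v hv ∈ W
    · rw [hex W hWZ hvW, Set.mem_singleton_iff, Projectivization.mk_eq_mk_iff'] at huW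
      obtain ⟨s, hs⟩ := huW
      exact ⟨s, hs.symm⟩
    · exact absurd ((vanishes_mk_of_isHomogeneous hk hu).1
        (mem_van.1 hcB _ ⟨W, ⟨hWZ, hvW⟩, huW⟩)) huc

end RQS
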